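/- arXiv:1703.07295 — 6 statements merged into one kernel-verified Lean document; each statement's English description precedes it below -/
import Mathlib

section
/- Let G be a group acting freely on a set M and let n be a natural number. Then the formula ((g⃗, σ) • x) i = g⃗ i • x (σ⁻¹ i) defines an action of the wreath product W_n = (Fin n → G) ⋊ Equiv.Perm (Fin n) on the orbit configuration space Conf^G_n(M) — in particular (g⃗, σ) • x again lies in Conf^G_n(M) — and this action is free: if (g⃗, σ) • x = x for some x ∈ Conf^G_n(M), then g⃗ i = 1 for all i and σ = 1. -/
/-- For a group `G` acting freely on a set `M` and `n : ℕ`, the formula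
`((g⃗, σ) • x) i = g⃗ i • x (σ⁻¹ i)` defines an action of
`W_n = (Fin n → G) ⋊ Equiv.Perm (Fin n)` on the orbit configuration space
`Conf^G_n(M)`: the action preserves `Conf^G_n(M)`, is unital, is compatible with the
semidirect-product multiplication `(g⃗, σ) * (h⃗, τ) = (g⃗ * (h⃗ ∘ σ⁻¹), σ * τ)`, and
is free: if `(g⃗, σ) • x = x` for some `x ∈ Conf^G_n(M)` then `g⃗ i = 1` for all `i`
and `σ = 1`. -/
theorem stmt_0 (G M : Type*) [Group G] [MulAction G M]
    (hfree : ∀ (g : G) (m : M), g • m = m → g = 1) (n : ℕ) :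
    ∀ Conf : Set (Fin n → M), Conf = {x | ∀ i j, i ≠ j → ∀ g : G, x i ≠ g • x j} →
    ∀ act : ((Fin n → G) × Equiv.Perm (Fin n)) → (Fin n → M) → (Fin n → M),
      act = (fun p x i => p.1 i • x (p.2⁻¹ i)) →
    -- the action preserves the orbit configuration space
    (∀ p x, x ∈ Conf → act p x ∈ Conf) ∧
    -- identity acts trivially
    (∀ x, act (1, 1) x = x) ∧
    -- compatibility with the multiplication of `(Fin n → G) ⋊ Equiv.Perm (Fin n)`,
    -- where `σ` acts on labels by `g⃗ ↦ g⃗ ∘ σ⁻¹`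
    (∀ (g h : Fin n → G) (σ τ : Equiv.Perm (Fin n)) (x : Fin n → M),
      act (g * (fun i => h (σ⁻¹ i)), σ * τ) x = act (g, σ) (act (h, τ) x)) ∧
    -- the action is free
    (∀ (g : Fin n → G) (σ : Equiv.Perm (Fin n)) (x : Fin n → M),
      x ∈ Conf → act (g, σ) x = x → (∀ i, g i = 1) ∧ σ = 1) := by
  rintro Conf rfl act rfl
  refine ⟨?_, ?_, ?_, ?_⟩
  · intro p x hx i j hij c h
    refine hx (p.2⁻¹ i) (p.2⁻¹ j) (fun e => hij (p.2⁻¹.injective e)) ((p.1 i)⁻¹ * (c * p.1 j)) ?_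
    rw [mul_smul, mul_smul, eq_inv_smul_iff]
    exact h
  · intro x
    funext i
    simp
  · intro g h σ τ x
    funext i
    simp [mul_smul]
  · intro g σ x hx h
    have key : ∀ i, g i • x (σ⁻¹ i) = x i := fun i => congrFun h i
    have hs : ∀ i, σ⁻¹ i = i := by
      intro i
      by_contra hne
      exact hx i (σ⁻¹ i) (fun e => hne e.symm) (g i) (key i).symm
    refine ⟨fun i => ?_, ?_⟩
    · have := key i
      rw [hs i] at this
      exact hfree _ _ this
    · exact inv_eq_one.mp (Equiv.ext hs)
end

section
/- Let G be a group acting on a set X and let n, a be natural numbers with a ≤ n. Consider the orbit configuration space Conf^G_ι(X) indexed by ι = Fin (n−a) ⊕ Fin a, and let W_{n−a} = (Fin (n−a) → G) ⋊ Equiv.Perm (Fin (n−a)) act on it through the Fin (n−a)-coordinates: ((g⃗, σ) • x)(inl k) = g⃗ k • x (inl (σ⁻¹ k)) and ((g⃗, σ) • x)(inr j) = x (inr j). Then the set of W_{n−a}-orbits of Conf^G_ι(X) is in bijection with the set of pairs (S, z), where S is a finite subset of the orbit space X/G with |S| = n − a, z ∈ Conf^G_a(X) (indexed by Fin a), and for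 all s ∈ S and all j, s ≠ [z j] (the G-orbit of z j); the bijection sends the orbit of x to the pair ({[x (inl k)] : k ∈ Fin (n−a)}, (x (inr j))_{j ∈ Fin a}). -/
open scoped Classical

/-- The orbit configuration space of a `G`-set `X`, indexed by a type `ι`. -/
def orbitConfigIdx (G : Type*) [Group G] {X : Type*} [MulAction G X] (ι : Type*) :
    Set (ι → X) :=
  {x | ∀ i j, i ≠ j → ∀ g : G, x i ≠ g • x j}

/-- The action of `W_{n−a} = (Fin (n−a) → G) ⋊ Equiv.Perm (Fin (n−a))` on functions
`Fin (n−a) ⊕ Fin a → X` through the `Fin (n−a)`-coordinates. -/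
def wAct {G X : Type*} [Group G] [MulAction G X] {m a : ℕ}
    (p : (Fin m → G) × Equiv.Perm (Fin m)) (x : Fin m ⊕ Fin a → X) :
    Fin m ⊕ Fin a → X :=
  fun i => Sum.casesOn i (fun k => p.1 k • x (Sum.inl (p.2⁻¹ k))) (fun j => x (Sum.inr j))

/-- Let `G` act on `X`, `a ≤ n`, and let
`W_{n−a} = (Fin (n−a) → G) ⋊ Equiv.Perm (Fin (n−a))` act on the orbit configuration
space indexed by `Fin (n−a) ⊕ Fin a` through the `Fin (n−a)`-coordinates.  Then the set
of `W_{n−a}`-orbits is in bijection with the set of pairs `(S, z)` where `S` is a finite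
subset of `X/G` with `|S| = n − a`, `z ∈ Conf^G_a(X)`, and `s ≠ [z j]` for all `s ∈ S`
and all `j`; the bijection sends the orbit of `x` to
`({[x (inl k)]}_k, (x (inr j))_j)`. -/
theorem stmt_2 (G X : Type*) [Group G] [MulAction G X] (n a : ℕ) (han : a ≤ n) :
    ∀ Conf : Set (Fin (n - a) ⊕ Fin a → X),
      Conf = orbitConfigIdx G (Fin (n - a) ⊕ Fin a) →
    ∀ r : Conf → Conf → Prop,
      (∀ x y : Conf, r x y ↔
        ∃ p : (Fin (n - a) → G) × Equiv.Perm (Fin (n - a)), wAct p x.1 = y.1) →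
    ∃ e : Quot r ≃
        {Sz : Finset (Quotient (MulAction.orbitRel G X)) × (Fin a → X) //
          Sz.1.card = n - a ∧
          Sz.2 ∈ orbitConfigIdx G (ι := Fin a) (X := X) ∧
          ∀ s ∈ Sz.1, ∀ j : Fin a, s ≠ Quotient.mk (MulAction.orbitRel G X) (Sz.2 j)},
      ∀ x : Conf,
        (e (Quot.mk r x)).1 =
          (Finset.image
              (fun k : Fin (n - a) =>
                Quotient.mk (MulAction.orbitRel G X) (x.1 (Sum.inl k))) Finset.univ,
            fun j : Fin a => x.1 (Sum.inr j)) := by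
  intro Conf hConf r hr
  subst hConf
  have key : ∀ u v : X, Quotient.mk (MulAction.orbitRel G X) u =
      Quotient.mk (MulAction.orbitRel G X) v ↔ ∃ g : G, g • v = u := by
    intro u v
    rw [Quotient.eq, MulAction.orbitRel_apply, MulAction.mem_orbit_iff]
  have inj : ∀ x : (orbitConfigIdx G (Fin (n - a) ⊕ Fin a) : Set (Fin (n - a) ⊕ Fin a → X)),
      Function.Injective (fun k : Fin (n - a) =>
        Quotient.mk (MulAction.orbitRel G X) (x.1 (Sum.inl k))) := by
    intro x k l h
    by_contra hkl
    obtain ⟨g, hg⟩ := (key _ _).1 h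
    exact x.2 (Sum.inl k) (Sum.inl l) (by simpa using hkl) g hg.symm
  let f : (orbitConfigIdx G (Fin (n - a) ⊕ Fin a) : Set (Fin (n - a) ⊕ Fin a → X)) →
      {Sz : Finset (Quotient (MulAction.orbitRel G X)) × (Fin a → X) //
          Sz.1.card = n - a ∧
          Sz.2 ∈ orbitConfigIdx G (ι := Fin a) (X := X) ∧
          ∀ s ∈ Sz.1, ∀ j : Fin a, s ≠ Quotient.mk (MulAction.orbitRel G X) (Sz.2 j)} :=
    fun x => ⟨(Finset.image
              (fun k : Fin (n - a) =>
                Quotient.mk (MulAction.orbitRel G X) (x.1 (Sum.inl k))) Finset.univ,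
            fun j : Fin a => x.1 (Sum.inr j)), by
      refine ⟨?_, ?_, ?_⟩
      · rw [Finset.card_image_of_injective _ (inj x)]
        simp
      · intro i j hij g
        exact x.2 (Sum.inr i) (Sum.inr j) (by simpa using hij) g
      · intro s hs j h
        obtain ⟨k, -, rfl⟩ := Finset.mem_image.1 hs
        obtain ⟨g, hg⟩ := (key _ _).1 h
        exact x.2 (Sum.inl k) (Sum.inr j) (by simp) g hg.symm⟩
  have hf : ∀ x y, r x y → f x = f y := by
    intro x y hxy
    obtain ⟨p, hp⟩ := (hr x y).1 hxy
    have h1 : ∀ k, y.1 (Sum.inl k) = p.1 k • x.1 (Sum.inl (p.2⁻¹ k)) := fun k => by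
      rw [← hp]; rfl
    have h2 : ∀ j, y.1 (Sum.inr j) = x.1 (Sum.inr j) := fun k => by
      rw [← hp]; rfl
    have h3 : ∀ k, Quotient.mk (MulAction.orbitRel G X) (y.1 (Sum.inl k)) =
        Quotient.mk (MulAction.orbitRel G X) (x.1 (Sum.inl (p.2⁻¹ k))) := fun k =>
      (key _ _).2 ⟨p.1 k, (h1 k).symm⟩
    apply Subtype.ext
    refine Prod.ext ?_ (funext fun j => (h2 j).symm)
    ext s
    simp only [f, Finset.mem_image, Finset.mem_univ, true_and]
    constructor
    · rintro ⟨k, rfl⟩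
      exact ⟨p.2 k, by rw [h3]; simp⟩
    · rintro ⟨k, rfl⟩
      exact ⟨p.2⁻¹ k, (h3 k).symm⟩
  refine ⟨Equiv.ofBijective (Quot.lift f hf) ⟨?_, ?_⟩, fun x => rfl⟩
  · rintro ⟨x⟩ ⟨y⟩ hxy
    have hxy' : f x = f y := hxy
    apply Quot.sound
    rw [hr]
    have hS := congrArg (fun t => t.1.1) hxy'
    have hz := congrArg (fun t => t.1.2) hxy'
    have hex : ∀ k, ∃ l, Quotient.mk (MulAction.orbitRel G X) (y.1 (Sum.inl k)) =
        Quotient.mk (MulAction.orbitRel G X) (x.1 (Sum.inl l)) := by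
      intro k
      have hk : Quotient.mk (MulAction.orbitRel G X) (y.1 (Sum.inl k)) ∈ (f y).1.1 :=
        Finset.mem_image.2 ⟨k, Finset.mem_univ _, rfl⟩
      have hk' : Quotient.mk (MulAction.orbitRel G X) (y.1 (Sum.inl k)) ∈ (f x).1.1 := by
        rw [hxy']; exact hk
      obtain ⟨l, -, hl⟩ := Finset.mem_image.1 hk'
      exact ⟨l, hl.symm⟩
    choose τ hτ using hex
    have hτi : Function.Injective τ := by
      intro k l h
      apply inj y
      show Quotient.mk (MulAction.orbitRel G X) (y.1 (Sum.inl k)) =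
        Quotient.mk (MulAction.orbitRel G X) (y.1 (Sum.inl l))
      rw [hτ, hτ, h]
    have hg : ∀ k, ∃ g : G, g • x.1 (Sum.inl (τ k)) = y.1 (Sum.inl k) := fun k =>
      (key _ _).1 (hτ k)
    choose g hg using hg
    refine ⟨(g, (Equiv.ofBijective τ (Finite.injective_iff_bijective.1 hτi))⁻¹), ?_⟩
    funext i
    rcases i with k | j
    · simp only [wAct, inv_inv]
      exact hg k
    · exact congrFun hz j
  · rintro ⟨⟨S, z⟩, hc, hz, hd⟩
    let e := (S.equivFinOfCardEq hc).symm
    let w : Fin (n - a) ⊕ Fin a → X := Sum.elim (fun k => (e k).1.out) z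
    have hw : ∀ k, Quotient.mk (MulAction.orbitRel G X) (w (Sum.inl k)) = (e k).1 :=
      fun k => Quotient.out_eq _
    have hwc : w ∈ orbitConfigIdx G (Fin (n - a) ⊕ Fin a) := by
      rintro (k | k) (l | l) hkl g h
      · have := (key _ _).2 ⟨g, h.symm⟩
        rw [hw, hw] at this
        exact hkl (congrArg Sum.inl (e.injective (Subtype.ext this)))
      · have := (key _ _).2 ⟨g, h.symm⟩
        rw [hw] at this
        exact hd _ (e k).2 l this
      · have := (key _ _).2 ⟨g, h.symm⟩
        rw [hw] at this
        exact hd _ (e l).2 k this.symm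
      · exact hz k l (fun h => hkl (congrArg Sum.inr h)) g h
    refine ⟨Quot.mk _ ⟨w, hwc⟩, ?_⟩
    show f ⟨w, hwc⟩ = _
    apply Subtype.ext
    refine Prod.ext ?_ rfl
    ext s
    simp only [f, Finset.mem_image, Finset.mem_univ, true_and, hw]
    constructor
    · rintro ⟨k, rfl⟩
      exact (e k).2
    · intro hs
      exact ⟨e.symm ⟨s, hs⟩, by simp⟩
end

section
/- For all integers n ≥ 1, a ≥ 1 and i ≥ 1, dim_ℚ H_i(UConf_n(ℂ ∖ {1, …, a}); ℚ) ≤ dim_ℚ H_i(UConf_n(ℂ ∖ {1, …, a−1}); ℚ) + dim_ℚ H_{i−1}(UConf_{n−1}(ℂ ∖ {1, …, a}); ℚ), where for a = 1 the set {1, …, a−1} is empty. -/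
open CategoryTheory AlgebraicTopology

/-- The `i`-th singular homology with rational coefficients, as a functor
`TopCat ⥤ ModuleCat ℚ` (singular chains via the singular simplicial set, free
`ℚ`-modules, the alternating face map complex, and homology). -/
noncomputable def singularHomologyFunctor (i : ℕ) : TopCat.{0} ⥤ ModuleCat.{0} ℚ :=
  TopCat.toSSet ⋙ ((SimplicialObject.whiskering _ _).obj (ModuleCat.free ℚ)) ⋙
    alternatingFaceMapComplex _ ⋙ HomologicalComplex.homologyFunctor _ _ i

/-- The `i`-th rational Betti number of a topological space. -/
noncomputable def bettiNumber (i : ℕ) (Y : TopCat.{0}) : ℕ :=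
  Module.finrank ℚ ((singularHomologyFunctor i).obj Y)

/-- The set `{1, 2, …, a} ⊆ ℂ`. -/
def punctures (a : ℕ) : Set ℂ := {z | ∃ k : ℕ, 1 ≤ k ∧ k ≤ a ∧ z = (k : ℂ)}

/-- The ordered configuration space `Conf_n(ℂ ∖ {1, …, a})`, as a subspace of `ℂ^n`. -/
def ConfSp (n a : ℕ) : Type :=
  {x : Fin n → ℂ // Function.Injective x ∧ ∀ k, x k ∉ punctures a}

instance (n a : ℕ) : TopologicalSpace (ConfSp n a) :=
  inferInstanceAs (TopologicalSpace {x : Fin n → ℂ // _})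

/-- Points of `Conf_n(ℂ ∖ {1, …, a})` are equivalent when they differ by a
permutation of the coordinates. -/
def confSetoid (n a : ℕ) : Setoid (ConfSp n a) where
  r x y := ∃ σ : Equiv.Perm (Fin n), x.1 ∘ ⇑σ = y.1
  iseqv := by
    constructor
    · exact fun x => ⟨1, rfl⟩
    · rintro x y ⟨σ, h⟩
      exact ⟨σ⁻¹, by funext i; simpa using congrFun h.symm (σ⁻¹ i)⟩
    · rintro x y z ⟨σ, h⟩ ⟨τ, h'⟩
      exact ⟨σ * τ, by funext i; simpa [← congrFun h' i] using congrFun h (τ i)⟩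

/-- The unordered configuration space `UConf_n(ℂ ∖ {1, …, a})`, with the quotient
topology. -/
def UConfSp (n a : ℕ) : Type := Quotient (confSetoid n a)

instance (n a : ℕ) : TopologicalSpace (UConfSp n a) :=
  inferInstanceAs (TopologicalSpace (Quotient (confSetoid n a)))

open CategoryTheory AlgebraicTopology

namespace Sol

/-- singular chains functor -/
noncomputable def chainsF : TopCat.{0} ⥤ ChainComplex (ModuleCat.{0} ℚ) ℕ :=
  TopCat.toSSet ⋙ ((SimplicialObject.whiskering _ _).obj (ModuleCat.free ℚ)) ⋙
    alternatingFaceMapComplex _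

lemma shf_eq (i : ℕ) : singularHomologyFunctor i =
    chainsF ⋙ HomologicalComplex.homologyFunctor _ _ i := rfl

abbrev Δ (n : ℕ) : Type := stdSimplex ℝ (Fin (n + 1))

abbrev Ch (n : ℕ) (X : Type) [TopologicalSpace X] : Type := C(Δ n, X) →₀ ℚ

noncomputable def face {n : ℕ} (i : Fin (n + 2)) : C(Δ n, Δ (n + 1)) :=
  ⟨stdSimplex.map i.succAbove, stdSimplex.continuous_map _⟩

noncomputable def dC (n : ℕ) (X : Type) [TopologicalSpace X] : Ch (n + 1) X →ₗ[ℚ] Ch n X :=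
  ∑ i : Fin (n + 2), ((-1 : ℚ) ^ (i : ℕ)) • Finsupp.lmapDomain ℚ ℚ (fun σ : C(Δ (n+1), X) => σ.comp (face i))

noncomputable def eC (n : ℕ) (X : TopCat.{0}) : (chainsF.obj X).X n ≃ₗ[ℚ] Ch n X :=
  Finsupp.domLCongr (X.toSSetObjEquiv (Opposite.op (SimplexCategory.mk n)))

lemma eC_mk (n : ℕ) (X : TopCat.{0})
    (s : (TopCat.toSSet.obj X).obj (Opposite.op (SimplexCategory.mk n))) :
    eC n X (ModuleCat.freeMk (R := ℚ) s) =
    Finsupp.single (X.toSSetObjEquiv (Opposite.op (SimplexCategory.mk n)) s) 1 :=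
  Finsupp.domLCongr_single _ _ _

lemma chains_d (n : ℕ) (X : TopCat.{0})
    (s : (TopCat.toSSet.obj X).obj (Opposite.op (SimplexCategory.mk (n+1)))) :
    ((chainsF.obj X).d (n+1) n).hom (ModuleCat.freeMk (R := ℚ) s) =
      ∑ i : Fin (n + 2), (-1 : ℚ) ^ (i : ℕ) •
        ModuleCat.freeMk (R := ℚ) ((TopCat.toSSet.obj X).δ i s) := by
  have h1 : (chainsF.obj X).d (n+1) n = ∑ i : Fin (n + 2), (-1 : ℤ) ^ (i : ℕ) •
      (ModuleCat.free ℚ).map ((TopCat.toSSet.obj X).δ i) :=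
    AlternatingFaceMapComplex.obj_d_eq _ _
  have h2 : (∑ i : Fin (n + 2), (-1 : ℤ) ^ (i : ℕ) •
      (ModuleCat.free ℚ).map ((TopCat.toSSet.obj X).δ i)).hom (ModuleCat.freeMk (R := ℚ) s) =
      ∑ i : Fin (n + 2), (-1 : ℚ) ^ (i : ℕ) •
        ModuleCat.freeMk (R := ℚ) ((TopCat.toSSet.obj X).δ i s) := by
    rw [ModuleCat.hom_sum, LinearMap.sum_apply]
    refine Finset.sum_congr rfl fun i _ => ?_
    rw [ModuleCat.hom_zsmul, LinearMap.smul_apply]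
    erw [ModuleCat.free_map_apply]
    rw [← Int.cast_smul_eq_zsmul ℚ]
    push_cast
    rfl
  exact (congrArg (fun f => (ModuleCat.Hom.hom f) (ModuleCat.freeMk (R := ℚ) s)) h1).trans h2

lemma eC_d (n : ℕ) (X : TopCat.{0}) (x) :
    eC n X ((chainsF.obj X).d (n+1) n x) = dC n X (eC (n+1) X x) := by
  have : (eC n X).toLinearMap ∘ₗ ((chainsF.obj X).d (n+1) n).hom =
    dC n X ∘ₗ (eC (n+1) X).toLinearMap := by
    refine Finsupp.lhom_ext' fun s => LinearMap.ext_ring ?_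
    refine (congrArg (eC n X) (chains_d n X s)).trans ?_
    refine Eq.trans ?_ (congrArg (dC n X) (eC_mk (n+1) X s)).symm
    refine (map_sum (eC n X) (fun i : Fin (n+2) => (-1 : ℚ) ^ (i : ℕ) •
        ModuleCat.freeMk (R := ℚ) ((TopCat.toSSet.obj X).δ i s)) Finset.univ).trans ?_
    rw [dC, LinearMap.sum_apply]
    refine Finset.sum_congr rfl fun i _ => ?_
    rw [LinearMap.smul_apply, Finsupp.lmapDomain_apply, Finsupp.mapDomain_single]
    refine ((eC n X).map_smul _ _).trans ?_
    congr 1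
    exact eC_mk n X _
  exact LinearMap.congr_fun this x

lemma eC_map (n : ℕ) {X Y : TopCat.{0}} (f : X ⟶ Y) (x) :
    eC n Y ((chainsF.map f).f n x) = Finsupp.lmapDomain ℚ ℚ (fun σ => f.hom.comp σ) (eC n X x) := by
  have : (eC n Y).toLinearMap ∘ₗ ((chainsF.map f).f n).hom =
    Finsupp.lmapDomain ℚ ℚ (fun σ => f.hom.comp σ) ∘ₗ (eC n X).toLinearMap := by
    refine Finsupp.lhom_ext' fun s => LinearMap.ext_ring ?_
    have h := ModuleCat.free_map_apply (R := ℚ) ((TopCat.toSSet.map f).app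
      (Opposite.op (SimplexCategory.mk n))) s
    refine (congrArg (eC n Y) h).trans ?_
    refine (eC_mk n Y _).trans ?_
    refine Eq.trans ?_ (congrArg (Finsupp.lmapDomain ℚ ℚ (fun σ => f.hom.comp σ)) (eC_mk n X s)).symm
    rw [Finsupp.lmapDomain_apply, Finsupp.mapDomain_single]
    rfl
  exact LinearMap.congr_fun this x

open HomologicalComplex in
lemma map_eq_of_homotopic {X Y : TopCat.{0}} (f g : X ⟶ Y) (h : f.hom.Homotopic g.hom) (i : ℕ) :
    (singularHomologyFunctor i).map f = (singularHomologyFunctor i).map g := by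
  obtain ⟨H⟩ := h
  have H' : TopCat.Homotopy f g := H
  exact (SimplicialObject.Homotopy.toChainHomotopy
    (H'.toSSet.toSimplicialObjectHomotopy.whiskerRight (ModuleCat.free ℚ))).homologyMap_eq i

end Sol

open CategoryTheory AlgebraicTopology

namespace Sol

abbrev A (k : ℕ) (K : Type) : Type := (Fin k → K) →₀ ℚ

noncomputable def dA (k : ℕ) (K : Type) : A (k+1) K →ₗ[ℚ] A k K :=
  ∑ i : Fin (k + 1), ((-1 : ℚ) ^ (i : ℕ)) •
    Finsupp.lmapDomain ℚ ℚ (fun v : Fin (k+1) → K => v ∘ i.succAbove)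

noncomputable def cone {k : ℕ} {K : Type} (b : K) : A k K →ₗ[ℚ] A (k+1) K :=
  Finsupp.lmapDomain ℚ ℚ (fun v : Fin k → K => (Fin.cons b v : Fin (k+1) → K))

lemma dA_single {k : ℕ} {K : Type} (v : Fin (k+1) → K) :
    dA k K (Finsupp.single v 1) = ∑ i : Fin (k + 1), ((-1 : ℚ) ^ (i : ℕ)) •
      Finsupp.single (v ∘ i.succAbove) 1 := by
  simp [dA, LinearMap.sum_apply, Finsupp.mapDomain_single]

lemma cone_single {k : ℕ} {K : Type} (b : K) (v : Fin k → K) :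
    cone b (Finsupp.single v (1:ℚ)) = Finsupp.single (Fin.cons b v : Fin (k+1) → K) 1 := by
  simp [cone, Finsupp.mapDomain_single]

lemma dA_cone {k : ℕ} {K : Type} (b : K) (c : A (k+1) K) :
    dA (k+1) K (cone b c) = c - cone b (dA k K c) := by
  have : dA (k+1) K ∘ₗ cone b = LinearMap.id - cone b ∘ₗ dA k K := by
    refine Finsupp.lhom_ext' fun v => LinearMap.ext_ring ?_
    simp only [LinearMap.comp_apply, Finsupp.lsingle_apply, LinearMap.sub_apply, LinearMap.id_apply]
    rw [cone_single, dA_single, dA_single, Fin.sum_univ_succ, map_sum, sub_eq_add_neg,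
      ← Finset.sum_neg_distrib]
    congr 1
    · simp
    · refine Finset.sum_congr rfl fun i _ => ?_
      rw [map_smul, cone_single]
      have : (Fin.cons b v : Fin (k+2) → K) ∘ i.succ.succAbove =
        (Fin.cons b (v ∘ i.succAbove) : Fin (k+1) → K) := by
        funext j
        refine Fin.cases ?_ (fun j => ?_) j
        · simp
        · simp [Fin.succ_succAbove_succ]
      rw [this, Fin.val_succ, pow_succ]
      simp
  exact LinearMap.congr_fun this c

lemma dA_cone0 {K : Type} (b : K) (c : A 0 K) : dA 0 K (cone b c) = c := by
  have : dA 0 K ∘ₗ cone b = LinearMap.id := by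
    refine Finsupp.lhom_ext' fun v => LinearMap.ext_ring ?_
    simp only [LinearMap.comp_apply, Finsupp.lsingle_apply, LinearMap.id_apply]
    rw [cone_single, dA_single]
    simp
  exact LinearMap.congr_fun this c

lemma A_ext {k : ℕ} {K M : Type} [AddCommGroup M] [Module ℚ M] {f g : A (k+1) K →ₗ[ℚ] M}
    (h : ∀ (b : K) (c : A k K), f (cone b c) = g (cone b c)) : f = g := by
  refine Finsupp.lhom_ext' fun v => LinearMap.ext_ring ?_
  have := h (v 0) (Finsupp.single (Fin.tail v) 1)
  rw [cone_single, Fin.cons_self_tail] at this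
  exact this

lemma dA_dA (k : ℕ) (K : Type) (c : A (k+2) K) : dA k K (dA (k+1) K c) = 0 := by
  have : dA k K ∘ₗ dA (k+1) K = 0 := by
    clear c
    induction k with
    | zero =>
      refine A_ext fun b c => ?_
      simp [dA_cone, dA_cone0]
    | succ k ih =>
      refine A_ext fun b c => ?_
      have := LinearMap.congr_fun ih c
      simp only [LinearMap.comp_apply, LinearMap.zero_apply] at this
      simp [dA_cone, this]
  exact LinearMap.congr_fun this c

variable {K L : Type} (b : ∀ k, (Fin (k+1) → K) → K) (b' : ∀ k, (Fin (k+1) → L) → L)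

noncomputable def sd : ∀ k, A k K →ₗ[ℚ] A k K
  | 0 => LinearMap.id
  | k + 1 => Finsupp.lift (A (k+1) K) ℚ (Fin (k+1) → K)
      (fun v => cone (b k v) (sd k (dA k K (Finsupp.single v 1))))

noncomputable def ht : ∀ k, A k K →ₗ[ℚ] A (k+1) K
  | 0 => 0
  | k + 1 => Finsupp.lift (A (k+2) K) ℚ (Fin (k+1) → K)
      (fun v => cone (b k v) (Finsupp.single v 1 - ht k (dA k K (Finsupp.single v 1))))

lemma sd_single (k : ℕ) (v : Fin (k+1) → K) : sd b (k+1) (Finsupp.single v 1) =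
    cone (b k v) (sd b k (dA k K (Finsupp.single v 1))) := by
  simp [sd, Finsupp.lift_apply]

lemma ht_single (k : ℕ) (v : Fin (k+1) → K) : ht b (k+1) (Finsupp.single v 1) =
    cone (b k v) (Finsupp.single v 1 - ht b k (dA k K (Finsupp.single v 1))) := by
  simp [ht, Finsupp.lift_apply]

lemma ht0 (c : A 0 K) : dA 0 K (ht b 0 c) = c - sd b 0 c := by simp [ht, sd]

lemma ht_succ (k : ℕ) (c : A (k+1) K) :
    dA (k+1) K (ht b (k+1) c) + ht b k (dA k K c) = c - sd b (k+1) c := by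
  have : dA (k+1) K ∘ₗ ht b (k+1) + ht b k ∘ₗ dA k K = LinearMap.id - sd b (k+1) := by
    clear c
    induction k with
    | zero =>
      refine Finsupp.lhom_ext' fun v => LinearMap.ext_ring ?_
      simp only [LinearMap.comp_apply, Finsupp.lsingle_apply, LinearMap.sub_apply,
        LinearMap.add_apply, LinearMap.id_apply]
      rw [ht_single, dA_cone, map_sub (dA 0 K), ht0, sd_single]
      abel_nf
    | succ k ih =>
      refine Finsupp.lhom_ext' fun v => LinearMap.ext_ring ?_
      simp only [LinearMap.comp_apply, Finsupp.lsingle_apply, LinearMap.sub_apply,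
        LinearMap.add_apply, LinearMap.id_apply]
      have := LinearMap.congr_fun ih (dA _ K (Finsupp.single v 1))
      simp only [LinearMap.comp_apply, LinearMap.sub_apply,
        LinearMap.add_apply, LinearMap.id_apply, dA_dA, map_zero, add_zero] at this
      rw [ht_single, dA_cone, map_sub (dA (k+1) K), this, sd_single]
      abel_nf
  exact LinearMap.congr_fun this c

lemma dA_sd (k : ℕ) (c : A (k+1) K) : dA k K (sd b (k+1) c) = sd b k (dA k K c) := by
  have h := congrArg (dA k K) (ht_succ b k c)
  rw [map_add, dA_dA, zero_add, map_sub] at h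
  have h2 : dA k K (ht b k (dA k K c)) = dA k K c - sd b k (dA k K c) := by
    cases k with
    | zero => exact ht0 b _
    | succ k =>
      have := ht_succ b k (dA _ K c)
      rwa [dA_dA, map_zero, add_zero] at this
  rw [h2] at h
  exact (sub_right_inj.1 h).symm

noncomputable def sdm : ∀ (_m k : ℕ), A k K →ₗ[ℚ] A k K
  | 0, _ => LinearMap.id
  | m+1, k => sd b k ∘ₗ sdm m k

noncomputable def htm : ∀ (_m k : ℕ), A k K →ₗ[ℚ] A (k+1) K
  | 0, _ => 0
  | m+1, k => htm m k + ht b k ∘ₗ sdm b m k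

lemma dA_sdm (m k : ℕ) (c : A (k+1) K) : dA k K (sdm b m (k+1) c) = sdm b m k (dA k K c) := by
  induction m with
  | zero => rfl
  | succ m ih => simp [sdm, dA_sd, ih]

lemma htm_succ (m k : ℕ) (c : A (k+1) K) :
    dA (k+1) K (htm b m (k+1) c) + htm b m k (dA k K c) = c - sdm b m (k+1) c := by
  induction m with
  | zero => simp [htm, sdm]
  | succ m ih =>
    have := ht_succ b k (sdm b m (k+1) c)
    rw [dA_sdm] at this
    simp only [htm, sdm, LinearMap.add_apply, LinearMap.comp_apply, map_add]
    have e : c - sd b (k+1) (sdm b m (k+1) c) = (c - sdm b m (k+1) c) +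
      (sdm b m (k+1) c - sd b (k+1) (sdm b m (k+1) c)) := by abel
    rw [e, ← ih, ← this]
    abel

lemma htm_zero (m : ℕ) (c : A 0 K) : htm b m 0 c = 0 := by
  induction m with
  | zero => rfl
  | succ m ih => simp [htm, ih, ht]

noncomputable def mA (f : K → L) (k : ℕ) : A k K →ₗ[ℚ] A k L :=
  Finsupp.lmapDomain ℚ ℚ (fun v => f ∘ v)

lemma mA_single (f : K → L) (k : ℕ) (v : Fin k → K) (r : ℚ) :
    mA f k (Finsupp.single v r) = Finsupp.single (f ∘ v) r := by
  simp [mA, Finsupp.mapDomain_single]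

lemma mA_cone (f : K → L) (k : ℕ) (p : K) (c : A k K) :
    mA f (k+1) (cone p c) = cone (f p) (mA f k c) := by
  have : mA f (k+1) ∘ₗ cone p = cone (f p) ∘ₗ mA f k := by
    refine Finsupp.lhom_ext' fun v => LinearMap.ext_ring ?_
    simp only [LinearMap.comp_apply, Finsupp.lsingle_apply]
    rw [cone_single, mA_single, mA_single, cone_single]
    congr 1
    funext j
    refine Fin.cases ?_ (fun j => ?_) j <;> simp
  exact LinearMap.congr_fun this c

lemma mA_dA (f : K → L) (k : ℕ) (c : A (k+1) K) :
    mA f k (dA k K c) = dA k L (mA f (k+1) c) := by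
  have : mA f k ∘ₗ dA k K = dA k L ∘ₗ mA f (k+1) := by
    refine Finsupp.lhom_ext' fun v => LinearMap.ext_ring ?_
    simp only [LinearMap.comp_apply, Finsupp.lsingle_apply]
    rw [dA_single, mA_single, dA_single, map_sum]
    simp only [map_smul, mA_single]
    rfl
  exact LinearMap.congr_fun this c

section nat
variable (f : K → L) (hf : ∀ k v, f (b k v) = b' k (f ∘ v))
include hf

lemma mA_sd (k : ℕ) (c : A k K) : mA f k (sd b k c) = sd b' k (mA f k c) := by
  have : mA f k ∘ₗ sd b k = sd b' k ∘ₗ mA f k := by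
    clear c
    induction k with
    | zero => rfl
    | succ k ih =>
      refine Finsupp.lhom_ext' fun v => LinearMap.ext_ring ?_
      simp only [LinearMap.comp_apply, Finsupp.lsingle_apply]
      have := LinearMap.congr_fun (ih) (dA k K (Finsupp.single v 1))
      simp only [LinearMap.comp_apply] at this
      rw [sd_single, mA_cone, this, mA_dA, mA_single, sd_single, hf]
  exact LinearMap.congr_fun this c

lemma mA_ht (k : ℕ) (c : A k K) : mA f (k+1) (ht b k c) = ht b' k (mA f k c) := by
  have : mA f (k+1) ∘ₗ ht b k = ht b' k ∘ₗ mA f k := by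
    clear c
    induction k with
    | zero => simp [ht]
    | succ k ih =>
      refine Finsupp.lhom_ext' fun v => LinearMap.ext_ring ?_
      simp only [LinearMap.comp_apply, Finsupp.lsingle_apply]
      have := LinearMap.congr_fun (ih) (dA k K (Finsupp.single v 1))
      simp only [LinearMap.comp_apply] at this
      rw [ht_single, mA_cone, map_sub, this, mA_dA, mA_single, ht_single, hf]
  exact LinearMap.congr_fun this c

lemma mA_sdm (m k : ℕ) (c : A k K) : mA f k (sdm b m k c) = sdm b' m k (mA f k c) := by
  induction m with
  | zero => rfl
  | succ m ih => simp [sdm, mA_sd b b' f hf, ih]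

lemma mA_htm (m k : ℕ) (c : A k K) : mA f (k+1) (htm b m k c) = htm b' m k (mA f k c) := by
  induction m with
  | zero => simp [htm]
  | succ m ih => simp [htm, mA_ht b b' f hf, mA_sdm b b' f hf, ih]

end nat

section mesh
variable {E : Type} [NormedAddCommGroup E] [NormedSpace ℝ E] (ι : K → E)
  (hι : ∀ k v, ι (b k v) = ((k : ℝ) + 1)⁻¹ • ∑ i, ι (v i))
include hι

lemma bary_mem (k : ℕ) (v : Fin (k+1) → K) : ι (b k v) ∈ convexHull ℝ (Set.range (ι ∘ v)) := by
  rw [hι, Finset.smul_sum]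
  refine (convex_convexHull ℝ _).sum_mem (fun _ _ => by positivity) ?_
    (fun i _ => subset_convexHull ℝ _ ⟨i, rfl⟩)
  simp
  field_simp

lemma bary_dist (k : ℕ) (v : Fin (k+1) → K) (D : ℝ) (hD : ∀ i j, dist (ι (v i)) (ι (v j)) ≤ D)
    (p : E) (hp : p ∈ convexHull ℝ (Set.range (ι ∘ v))) :
    dist p (ι (b k v)) ≤ k / (k+1) * D := by
  have : convexHull ℝ (Set.range (ι ∘ v)) ⊆ Metric.closedBall (ι (b k v)) (k / (k+1) * D) := by
    refine convexHull_min ?_ (convex_closedBall _ _)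
    rintro _ ⟨i, rfl⟩
    rw [Metric.mem_closedBall, dist_eq_norm, hι]
    have h1 : (ι ∘ v) i - ((k : ℝ) + 1)⁻¹ • ∑ j, ι (v j) =
      ((k : ℝ) + 1)⁻¹ • ∑ j, (ι (v i) - ι (v j)) := by
      rw [Finset.sum_sub_distrib, smul_sub]
      simp
      rw [← Nat.cast_smul_eq_nsmul ℝ, smul_smul]
      push_cast
      rw [inv_mul_cancel₀ (by positivity), one_smul]
    rw [h1, norm_smul]
    have h2 : ‖∑ j, (ι (v i) - ι (v j))‖ ≤ k * D := by
      rw [← Finset.sum_erase_add _ _ (Finset.mem_univ i), sub_self, add_zero]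
      refine (norm_sum_le_of_le _ (fun j _ => (dist_eq_norm (ι (v i)) (ι (v j))) ▸ hD i j)).trans ?_
      simp
    rw [norm_inv, Real.norm_of_nonneg (by positivity)]
    calc _ ≤ ((k:ℝ)+1)⁻¹ * (k * D) := by gcongr
      _ = _ := by field_simp
  exact this hp

lemma mesh_sd (N : ℕ) (D : ℝ) (hD0 : 0 ≤ D) (k : ℕ) (hk : k ≤ N + 1) (v : Fin k → K)
    (hD : ∀ i j, dist (ι (v i)) (ι (v j)) ≤ D) :
    sd b k (Finsupp.single v 1) ∈ Finsupp.supported ℚ ℚ {w : Fin k → K |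
      (∀ i, ι (w i) ∈ convexHull ℝ (Set.range (ι ∘ v))) ∧
      ∀ i j, dist (ι (w i)) (ι (w j)) ≤ (N / (N+1) : ℝ) * D} := by
  induction k with
  | zero =>
    intro w _
    exact ⟨fun i => i.elim0, fun i => i.elim0⟩
  | succ k ih =>
    rw [sd_single, dA_single, map_sum, map_sum]
    refine Submodule.sum_mem _ fun i _ => ?_
    rw [map_smul, map_smul]
    refine Submodule.smul_mem _ _ ?_
    have h := ih (by omega) (v ∘ i.succAbove) (fun _ _ => hD _ _)
    have hsub : convexHull ℝ (Set.range (ι ∘ v ∘ i.succAbove)) ⊆ convexHull ℝ (Set.range (ι ∘ v)) :=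
      convexHull_mono (by rintro _ ⟨j, rfl⟩; exact ⟨_, rfl⟩)
    have hb : ∀ p ∈ convexHull ℝ (Set.range (ι ∘ v)), dist p (ι (b k v)) ≤ (N / (N+1) : ℝ) * D := by
      intro p hp
      refine (bary_dist b ι hι k v D hD p hp).trans ?_
      have : (k:ℝ) ≤ N := by exact_mod_cast (by omega : k ≤ N)
      refine mul_le_mul_of_nonneg_right ?_ hD0
      rw [div_le_div_iff₀ (by positivity) (by positivity)]
      nlinarith
    have hb0 := bary_mem b ι hι k v
    unfold cone
    rw [Finsupp.mem_supported] at h ⊢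
    intro w hw
    classical
    have hw' := Finsupp.mapDomain_support hw
    rw [Finset.mem_image] at hw'
    obtain ⟨u, hu, rfl⟩ := hw'
    obtain ⟨h1, h2⟩ := h hu
    refine ⟨fun j => ?_, fun j l => ?_⟩
    · refine Fin.cases ?_ (fun j => ?_) j
      · simpa using hb0
      · simpa using hsub (h1 j)
    · refine Fin.cases ?_ (fun j => ?_) j <;> refine Fin.cases ?_ (fun l => ?_) l
      · simp; positivity
      · simp only [Fin.cons_zero, Fin.cons_succ]
        rw [dist_comm]
        exact hb _ (hsub (h1 l))
      · simp only [Fin.cons_zero, Fin.cons_succ]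
        exact hb _ (hsub (h1 j))
      · simpa using h2 j l

lemma mesh_sdm (N : ℕ) (D : ℝ) (hD0 : 0 ≤ D) (k : ℕ) (hk : k ≤ N + 1) (v : Fin k → K)
    (hD : ∀ i j, dist (ι (v i)) (ι (v j)) ≤ D) (m : ℕ) :
    sdm b m k (Finsupp.single v 1) ∈ Finsupp.supported ℚ ℚ {w : Fin k → K |
      ∀ i j, dist (ι (w i)) (ι (w j)) ≤ (N / (N+1) : ℝ) ^ m * D} := by
  induction m with
  | zero =>
    refine Finsupp.single_mem_supported _ _ ?_
    simpa using hD
  | succ m ih =>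
    rw [Finsupp.supported_eq_span_single] at ih
    have : Submodule.span ℚ ((fun w => Finsupp.single w (1:ℚ)) '' {w : Fin k → K |
      ∀ i j, dist (ι (w i)) (ι (w j)) ≤ (N / (N+1) : ℝ) ^ m * D}) ≤
      (Finsupp.supported ℚ ℚ {w : Fin k → K |
      ∀ i j, dist (ι (w i)) (ι (w j)) ≤ (N / (N+1) : ℝ) ^ (m+1) * D}).comap (sd b k) := by
      rw [Submodule.span_le]
      rintro _ ⟨w, hw, rfl⟩
      have := mesh_sd b ι hι N ((N / (N+1) : ℝ) ^ m * D) (by positivity) k hk w hw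
      refine Finsupp.supported_mono ?_ this
      rintro u ⟨_, hu⟩ i j
      refine (hu i j).trans (le_of_eq ?_)
      ring
    exact this ih

end mesh

end Sol

open CategoryTheory AlgebraicTopology

namespace Sol

noncomputable def bary (n k : ℕ) (v : Fin (k+1) → Δ n) : Δ n :=
  ⟨((k : ℝ) + 1)⁻¹ • ∑ i, (v i : Fin (n+1) → ℝ), by
    rw [Finset.smul_sum]
    refine (convex_stdSimplex ℝ _).sum_mem (fun _ _ => by positivity) ?_ (fun i _ => (v i).2)
    simp
    field_simp⟩

noncomputable def aff {m n : ℕ} (v : Fin (m+1) → Δ n) : C(Δ m, Δ n) where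
  toFun t := ⟨∑ i, (t.1 i) • (v i : Fin (n+1) → ℝ),
    (convex_stdSimplex ℝ _).sum_mem (fun i _ => t.2.1 i) t.2.2 (fun i _ => (v i).2)⟩
  continuous_toFun := by
    refine Continuous.subtype_mk ?_ _
    refine continuous_finsetSum _ fun i _ => ?_
    exact ((continuous_apply i).comp continuous_subtype_val).smul continuous_const

noncomputable def vert (m : ℕ) (i : Fin (m+1)) : Δ m := ⟨Pi.single i 1, single_mem_stdSimplex ℝ i⟩

lemma aff_coe {m n : ℕ} (v : Fin (m+1) → Δ n) (t : Δ m) :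
    (aff v t : Fin (n+1) → ℝ) = ∑ i, (t.1 i) • (v i : Fin (n+1) → ℝ) := rfl

lemma aff_pt {m n : ℕ} (v : Fin (m+1) → Δ n) (t : Δ m) (j) :
    (aff v t).1 j = ∑ i, t.1 i * (v i).1 j := by
  refine (Finset.sum_apply j Finset.univ (fun i => (t.1 i) • ((v i).1 : Fin (n+1) → ℝ))).trans ?_
  rfl

lemma vert_pt (m : ℕ) (i j : Fin (m+1)) : (vert m i).1 j = if j = i then 1 else 0 := by
  simp only [vert, Pi.single_apply]

lemma bary_pt (n k : ℕ) (v : Fin (k+1) → Δ n) (j) :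
    (bary n k v).1 j = ((k : ℝ) + 1)⁻¹ * ∑ i, (v i).1 j := by
  refine congrArg (((k : ℝ) + 1)⁻¹ * ·)
    (Finset.sum_apply j Finset.univ (fun i => ((v i).1 : Fin (n+1) → ℝ)))

lemma Δ_ext {n : ℕ} {s t : Δ n} (h : ∀ j, s.1 j = t.1 j) : s = t := Subtype.ext (funext h)

lemma aff_vert {m n : ℕ} (v : Fin (m+1) → Δ n) (i) : aff v (vert m i) = v i := by
  refine Δ_ext fun j => ?_
  rw [aff_pt]
  simp [vert_pt]

lemma aff_id (m : ℕ) : aff (vert m) = ContinuousMap.id _ := by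
  refine ContinuousMap.ext fun t => Δ_ext fun j => ?_
  rw [aff_pt]
  simp [vert_pt]

lemma aff_aff {l m n : ℕ} (v : Fin (m+1) → Δ n) (w : Fin (l+1) → Δ m) :
    (aff v).comp (aff w) = aff (aff v ∘ w) := by
  refine ContinuousMap.ext fun t => Δ_ext fun j => ?_
  rw [ContinuousMap.comp_apply]
  simp only [aff_pt, Function.comp_apply, Finset.mul_sum, Finset.sum_mul]
  rw [Finset.sum_comm]
  simp only [mul_assoc]

lemma aff_bary {m n : ℕ} (v : Fin (m+1) → Δ n) (k : ℕ) (w : Fin (k+1) → Δ m) :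
    aff v (bary m k w) = bary n k (aff v ∘ w) := by
  refine Δ_ext fun j => ?_
  simp only [aff_pt, bary_pt, Function.comp_apply, Finset.mul_sum, Finset.sum_mul]
  rw [Finset.sum_comm]
  simp only [mul_assoc]

lemma face_eq {n : ℕ} (i : Fin (n+2)) : face i = aff (vert (n+1) ∘ i.succAbove) := by
  refine ContinuousMap.ext fun t => Δ_ext fun j => ?_
  rw [aff_pt]
  simp only [Function.comp_apply, vert_pt, mul_ite, mul_one, mul_zero]
  simp only [face, ContinuousMap.coe_mk]
  refine (congrFun (stdSimplex.map_coe _ t) j).trans ?_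
  rw [FunOnFinite.linearMap_apply_apply, Finset.sum_filter]
  refine Finset.sum_congr rfl fun l _ => ?_
  simp only [eq_comm]
  rfl

lemma aff_face {m n : ℕ} (v : Fin (m+2) → Δ n) (i : Fin (m+2)) :
    (aff v).comp (face i) = aff (v ∘ i.succAbove) := by
  rw [face_eq, aff_aff]
  congr 1
  funext j
  simp [aff_vert]

lemma face_vert {n : ℕ} (i : Fin (n+2)) : face i ∘ vert n = vert (n+1) ∘ i.succAbove := by
  rw [face_eq]
  funext j
  simp [aff_vert]

lemma face_bary {n : ℕ} (i : Fin (n+2)) (k : ℕ) (w : Fin (k+1) → Δ n) :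
    face i (bary n k w) = bary (n+1) k (face i ∘ w) := by
  rw [face_eq]
  exact aff_bary _ _ _

variable {X : Type} [TopologicalSpace X]

noncomputable def act {m n : ℕ} (σ : C(Δ n, X)) : A (m+1) (Δ n) →ₗ[ℚ] Ch m X :=
  Finsupp.lmapDomain ℚ ℚ (fun w => σ.comp (aff w))

lemma act_single {m n : ℕ} (σ : C(Δ n, X)) (w : Fin (m+1) → Δ n) (r : ℚ) :
    act σ (Finsupp.single w r) = Finsupp.single (σ.comp (aff w)) r := by
  simp [act, Finsupp.mapDomain_single]

lemma dC_single {n : ℕ} (σ : C(Δ (n+1), X)) :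
    dC n X (Finsupp.single σ 1) = ∑ i : Fin (n + 2), ((-1 : ℚ) ^ (i : ℕ)) •
      Finsupp.single (σ.comp (face i)) 1 := by
  simp [dC, LinearMap.sum_apply, Finsupp.mapDomain_single]

lemma dC_act {m n : ℕ} (σ : C(Δ n, X)) (c : A (m+2) (Δ n)) :
    dC m X (act σ c) = act σ (dA (m+1) (Δ n) c) := by
  have : dC m X ∘ₗ act σ = act σ ∘ₗ dA (m+1) (Δ n) := by
    refine Finsupp.lhom_ext' fun v => LinearMap.ext_ring ?_
    simp only [LinearMap.comp_apply, Finsupp.lsingle_apply]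
    rw [dA_single, act_single, dC_single, map_sum]
    simp only [map_smul, act_single, ContinuousMap.comp_assoc, aff_face]
  exact LinearMap.congr_fun this c

lemma act_face {m n : ℕ} (σ : C(Δ (n+1), X)) (i : Fin (n+2)) (c : A (m+1) (Δ n)) :
    act (σ.comp (face i)) c = act σ (mA (face i) _ c) := by
  have : act (σ.comp (face i)) = act (m := m) σ ∘ₗ mA (face i) _ := by
    refine Finsupp.lhom_ext' fun v => LinearMap.ext_ring ?_
    simp only [LinearMap.comp_apply, Finsupp.lsingle_apply]
    rw [mA_single, act_single, act_single, ContinuousMap.comp_assoc, face_eq, aff_aff]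
  exact LinearMap.congr_fun this c

noncomputable def SS (m n : ℕ) : Ch n X →ₗ[ℚ] Ch n X :=
  Finsupp.lift (Ch n X) ℚ _ (fun σ => act σ (sdm (bary n) m (n+1) (Finsupp.single (vert n) 1)))

noncomputable def TT (m n : ℕ) : Ch n X →ₗ[ℚ] Ch (n+1) X :=
  Finsupp.lift (Ch (n+1) X) ℚ _
    (fun σ => act σ (htm (bary n) m (n+1) (Finsupp.single (vert n) 1)))

lemma SS_single (m n : ℕ) (σ : C(Δ n, X)) : SS m n (Finsupp.single σ 1) =
    act σ (sdm (bary n) m (n+1) (Finsupp.single (vert n) 1)) := by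
  simp [SS, Finsupp.lift_apply]

lemma TT_single (m n : ℕ) (σ : C(Δ n, X)) : TT m n (Finsupp.single σ 1) =
    act σ (htm (bary n) m (n+1) (Finsupp.single (vert n) 1)) := by
  simp [TT, Finsupp.lift_apply]

lemma TT_zero (m : ℕ) (c : Ch 0 X) : dC 0 X (TT m 0 c) = c - SS m 0 c := by
  have : dC 0 X ∘ₗ TT m 0 = LinearMap.id - SS m 0 := by
    refine Finsupp.lhom_ext' fun σ => LinearMap.ext_ring ?_
    simp only [LinearMap.comp_apply, Finsupp.lsingle_apply, LinearMap.sub_apply, LinearMap.id_apply]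
    rw [TT_single, dC_act, SS_single]
    have := htm_succ (bary 0) m 0 (Finsupp.single (vert 0) 1)
    rw [htm_zero, add_zero] at this
    rw [this, map_sub, act_single, aff_id, ContinuousMap.comp_id]
  exact LinearMap.congr_fun this c

lemma TT_succ (m n : ℕ) (c : Ch (n+1) X) :
    dC (n+1) X (TT m (n+1) c) + TT m n (dC n X c) = c - SS m (n+1) c := by
  have : dC (n+1) X ∘ₗ TT m (n+1) + TT m n ∘ₗ dC n X = LinearMap.id - SS m (n+1) := by
    refine Finsupp.lhom_ext' fun σ => LinearMap.ext_ring ?_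
    simp only [LinearMap.comp_apply, Finsupp.lsingle_apply, LinearMap.sub_apply,
      LinearMap.add_apply, LinearMap.id_apply]
    rw [TT_single, dC_act, SS_single]
    have h := htm_succ (bary (n+1)) m (n+1) (Finsupp.single (vert (n+1)) 1)
    have h2 : TT m n (dC n X (Finsupp.single σ 1)) = act σ (htm (bary (n+1)) m (n+1)
        (dA (n+1) (Δ (n+1)) (Finsupp.single (vert (n+1)) 1))) := by
      rw [dC_single, dA_single, map_sum, map_sum, map_sum]
      refine Finset.sum_congr rfl fun i _ => ?_
      rw [map_smul, map_smul, map_smul, TT_single, act_face,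
        mA_htm (bary n) (bary (n+1)) (face i) (face_bary i), mA_single, face_vert]
    rw [h2, ← map_add, h, map_sub, act_single, aff_id, ContinuousMap.comp_id]
  exact LinearMap.congr_fun this c

/-- simplices small wrt U, V -/
def smallS (U V : Set X) (n : ℕ) : Set C(Δ n, X) := {σ | Set.range σ ⊆ U ∨ Set.range σ ⊆ V}

lemma lift_mem_supported {α β : Type} (f : α → β →₀ ℚ) (s : Set α) (t : Set β)
    (h : ∀ a ∈ s, f a ∈ Finsupp.supported ℚ ℚ t) (c : α →₀ ℚ) (hc : c ∈ Finsupp.supported ℚ ℚ s) :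
    Finsupp.lift (β →₀ ℚ) ℚ α f c ∈ Finsupp.supported ℚ ℚ t := by
  rw [Finsupp.lift_apply]
  exact Submodule.sum_mem _ fun a ha => Submodule.smul_mem _ _ (h a (hc ha))

lemma act_mem {m n : ℕ} (σ : C(Δ n, X)) (s : Set (Fin (m+1) → Δ n)) (t : Set C(Δ m, X))
    (h : ∀ w ∈ s, σ.comp (aff w) ∈ t) (c) (hc : c ∈ Finsupp.supported ℚ ℚ s) :
    act σ c ∈ Finsupp.supported ℚ ℚ t := by
  classical
  intro τ hτ
  have hw' := Finsupp.mapDomain_support hτ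
  rw [Finset.mem_image] at hw'
  obtain ⟨u, hu, rfl⟩ := hw'
  exact h u (hc hu)

lemma TT_small (U V : Set X) (m n : ℕ) (c : Ch n X)
    (hc : c ∈ Finsupp.supported ℚ ℚ (smallS U V n)) :
    TT m n c ∈ Finsupp.supported ℚ ℚ (smallS U V (n+1)) := by
  refine lift_mem_supported _ _ _ (fun σ hσ => ?_) c hc
  refine act_mem σ Set.univ _ (fun w _ => ?_) _ (by simp)
  have : Set.range (σ.comp (aff w)) ⊆ Set.range σ := by
    rintro _ ⟨t, rfl⟩; exact ⟨_, rfl⟩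
  exact hσ.imp this.trans this.trans

lemma aff_dist {m n : ℕ} (w : Fin (m+1) → Δ n) (ρ : ℝ) (h : ∀ i j, dist (w i) (w j) ≤ ρ) (t : Δ m) :
    dist (aff w t) (w 0) ≤ ρ := by
  have : (aff w t : Fin (n+1) → ℝ) ∈ Metric.closedBall ((w 0 : Δ n) : Fin (n+1) → ℝ) ρ := by
    rw [aff_coe]
    exact (convex_closedBall _ _).sum_mem (fun i _ => t.2.1 i) t.2.2 (fun i _ => h i 0)
  exact this

instance (n : ℕ) : CompactSpace (Δ n) := isCompact_iff_compactSpace.1 (isCompact_stdSimplex ℝ _)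

lemma SS_small1 (U V : Set X) (hU : IsOpen U) (hV : IsOpen V) (hUV : U ∪ V = Set.univ) (n : ℕ)
    (σ : C(Δ n, X)) : ∃ m₀, ∀ m ≥ m₀,
      SS m n (Finsupp.single σ 1) ∈ Finsupp.supported ℚ ℚ (smallS U V n) := by
  obtain ⟨δ, hδ, hL⟩ := lebesgue_number_lemma_of_metric (s := (Set.univ : Set (Δ n)))
    (c := fun i : Bool => cond i (σ ⁻¹' U) (σ ⁻¹' V)) isCompact_univ
    (by rintro (_|_); exacts [hV.preimage σ.continuous, hU.preimage σ.continuous])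
    (by
      intro t _
      have : σ t ∈ U ∪ V := hUV ▸ Set.mem_univ _
      rcases this with h | h
      · exact Set.mem_iUnion.2 ⟨true, h⟩
      · exact Set.mem_iUnion.2 ⟨false, h⟩)
  set r : ℝ := n / (n+1) with hr
  have hr0 : 0 ≤ r := by positivity
  have hr1 : r < 1 := by rw [hr, div_lt_one (by positivity)]; linarith
  obtain ⟨m₀, hm₀⟩ := exists_pow_lt_of_lt_one hδ hr1
  refine ⟨m₀, fun m hm => ?_⟩
  have hmesh := mesh_sdm (bary n) (fun t : Δ n => (t : Fin (n+1) → ℝ)) (fun _ _ => rfl) n 1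
    zero_le_one (n+1) le_rfl (vert n) (fun i j => by
      refine (dist_pi_le_iff zero_le_one).2 fun l => ?_
      have h1 := mem_Icc_of_mem_stdSimplex (vert n i).2 l
      have h2 := mem_Icc_of_mem_stdSimplex (vert n j).2 l
      rw [Real.dist_eq]
      change |(vert n i).1 l - (vert n j).1 l| ≤ 1
      rw [abs_le]
      constructor <;> linarith [h1.1, h1.2, h2.1, h2.2]) m
  rw [SS_single]
  refine act_mem σ _ _ (fun w hw => ?_) _ hmesh
  have hlt : r ^ m * 1 < δ := by
    rw [mul_one]
    exact (pow_le_pow_of_le_one hr0 hr1.le hm).trans_lt hm₀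
  obtain ⟨i, hi⟩ := hL (w 0) (Set.mem_univ _)
  have key : ∀ t, aff w t ∈ Metric.ball (w 0) δ := fun t =>
    (aff_dist w _ hw t).trans_lt hlt
  cases i
  · right
    rintro _ ⟨t, rfl⟩
    exact hi (key t)
  · left
    rintro _ ⟨t, rfl⟩
    exact hi (key t)

lemma SS_small (U V : Set X) (hU : IsOpen U) (hV : IsOpen V) (hUV : U ∪ V = Set.univ) (n : ℕ)
    (c : Ch n X) : ∃ m₀, ∀ m ≥ m₀, SS m n c ∈ Finsupp.supported ℚ ℚ (smallS U V n) := by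
  induction c using Finsupp.induction_linear with
  | zero => exact ⟨0, fun m _ => by rw [map_zero]; exact Submodule.zero_mem _⟩
  | add f g hf hg =>
    obtain ⟨m1, h1⟩ := hf
    obtain ⟨m2, h2⟩ := hg
    refine ⟨max m1 m2, fun m hm => ?_⟩
    rw [map_add]
    exact Submodule.add_mem _ (h1 m (le_of_max_le_left hm)) (h2 m (le_of_max_le_right hm))
  | single σ r =>
    obtain ⟨m1, h1⟩ := SS_small1 U V hU hV hUV n σ
    refine ⟨m1, fun m hm => ?_⟩
    have : Finsupp.single σ r = r • Finsupp.single σ (1:ℚ) := by simp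
    rw [this, map_smul]
    exact Submodule.smul_mem _ _ (h1 m hm)

end Sol

open CategoryTheory AlgebraicTopology

namespace Sol
open Limits

abbrev CC := ChainComplex (ModuleCat.{0} ℚ) ℕ

lemma exists_cycle (K : CC) (i : ℕ) (z : K.X i) (hz : ∀ j, K.d i j z = 0) :
    ∃ c : K.cycles i, K.iCycles i c = z := by
  have h := ShortComplex.exact_of_f_is_kernel (ShortComplex.mk _ _ (K.iCycles_d i _))
    (K.cyclesIsKernel i _ rfl)
  exact (ShortComplex.moduleCat_exact_iff _).1 h z (hz _)

lemma bdry_of_zero (K : CC) (i : ℕ) (c : K.cycles i) (hc : K.homologyπ i c = 0) :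
    ∃ y : K.X (i+1), K.d (i+1) i y = K.iCycles i c := by
  have h := ShortComplex.exact_of_g_is_cokernel
    (ShortComplex.mk _ _ (K.toCycles_comp_homologyπ (i+1) i))
    (K.homologyIsCokernel (i+1) i (by simp))
  obtain ⟨y, hy⟩ := (ShortComplex.moduleCat_exact_iff _).1 h c hc
  refine ⟨y, ?_⟩
  have h2 := ConcreteCategory.congr_hom (K.toCycles_i (i+1) i) y
  rw [← h2]
  exact congrArg (K.iCycles i) hy

lemma zero_of_bdry (K : CC) (i : ℕ) (c : K.cycles i) (y : K.X (i+1))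
    (hy : K.d (i+1) i y = K.iCycles i c) : K.homologyπ i c = 0 := by
  have h2 := ConcreteCategory.congr_hom (K.toCycles_i (i+1) i) y
  have h3 : K.toCycles (i+1) i y = c :=
    (ModuleCat.mono_iff_injective (K.iCycles i)).1 inferInstance (h2.trans hy)
  rw [← h3]
  exact ConcreteCategory.congr_hom (K.toCycles_comp_homologyπ (i+1) i) y

lemma homologyπ_surj (K : CC) (i : ℕ) (x : K.homology i) : ∃ c, K.homologyπ i c = x :=
  (ModuleCat.epi_iff_surjective (K.homologyπ i)).1 inferInstance x

lemma hmap_π {K L : CC} (φ : K ⟶ L) (i : ℕ) (c : K.cycles i) :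
    HomologicalComplex.homologyMap φ i (K.homologyπ i c) =
      L.homologyπ i (HomologicalComplex.cyclesMap φ i c) :=
  ConcreteCategory.congr_hom (HomologicalComplex.homologyπ_naturality φ i) c

lemma cmap_i {K L : CC} (φ : K ⟶ L) (i : ℕ) (c : K.cycles i) :
    L.iCycles i (HomologicalComplex.cyclesMap φ i c) = φ.f i (K.iCycles i c) :=
  ConcreteCategory.congr_hom (HomologicalComplex.cyclesMap_i φ i) c

lemma hom_comm {K L : CC} (φ : K ⟶ L) (i j : ℕ) (x : K.X i) :
    L.d i j (φ.f i x) = φ.f j (K.d i j x) :=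
  ConcreteCategory.congr_hom (φ.comm i j) x

lemma cyc_d (K : CC) (i j : ℕ) (c : K.cycles i) : K.d i j (K.iCycles i c) = 0 :=
  ConcreteCategory.congr_hom (K.iCycles_d i j) c

lemma qi_surj {K L : CC} (φ : K ⟶ L) (i : ℕ)
    (hinj : ∀ j, Function.Injective (φ.f j))
    (h : ∀ z : L.X i, (∀ j, L.d i j z = 0) → ∃ (k : K.X i) (y : L.X (i+1)),
      z = φ.f i k + L.d (i+1) i y) :
    Function.Surjective (HomologicalComplex.homologyMap φ i) := by
  intro x
  obtain ⟨c, rfl⟩ := homologyπ_surj L i x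
  obtain ⟨k, y, hky⟩ := h _ (fun j => cyc_d L i j c)
  have hk : ∀ j, K.d i j k = 0 := by
    intro j
    apply hinj
    rw [← hom_comm, map_zero]
    have h1 : φ.f i k = L.iCycles i c - L.d (i+1) i y := by rw [hky]; abel
    rw [h1, map_sub, cyc_d, zero_sub, neg_eq_zero]
    exact ConcreteCategory.congr_hom (L.d_comp_d (i+1) i j) y
  obtain ⟨c', rfl⟩ := exists_cycle K i k hk
  refine ⟨K.homologyπ i c', ?_⟩
  rw [hmap_π, ← sub_eq_zero, ← map_sub]
  refine zero_of_bdry L i _ (-y) ?_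
  rw [map_sub, cmap_i, hky, map_neg]
  abel

lemma qi_inj {K L : CC} (φ : K ⟶ L) (i : ℕ)
    (h : ∀ (k : K.X i) (y : L.X (i+1)), L.d (i+1) i y = φ.f i k → (∀ j, K.d i j k = 0) →
      ∃ w : K.X (i+1), K.d (i+1) i w = k) :
    Function.Injective (HomologicalComplex.homologyMap φ i) := by
  rw [injective_iff_map_eq_zero]
  intro x hx
  obtain ⟨c, rfl⟩ := homologyπ_surj K i x
  rw [hmap_π] at hx
  obtain ⟨y, hy⟩ := bdry_of_zero L i _ hx
  rw [cmap_i] at hy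
  obtain ⟨w, hw⟩ := h _ y hy (fun j => cyc_d K i j c)
  exact zero_of_bdry K i c w hw

section MV
variable {P A B X : CC} (p : P ⟶ A) (q : P ⟶ B) (f : A ⟶ X) (g : B ⟶ X)

noncomputable abbrev hm {K L : CC} (φ : K ⟶ L) (i : ℕ) := HomologicalComplex.homologyMap φ i

lemma hm_comp {K L M : CC} (φ : K ⟶ L) (ψ : L ⟶ M) (i : ℕ) (x) : hm (φ ≫ ψ) i x = hm ψ i (hm φ i x) :=
  ConcreteCategory.congr_hom (HomologicalComplex.homologyMap_comp φ ψ i) x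

lemma f_comp {K L M : CC} (φ : K ⟶ L) (ψ : L ⟶ M) (i : ℕ) (x) : (φ ≫ ψ).f i x = ψ.f i (φ.f i x) :=
  ConcreteCategory.congr_hom (HomologicalComplex.comp_f φ ψ i) x

lemma biprod_el {K L : CC} (i : ℕ) (x : (K ⊞ L).X i) :
    x = (biprod.inl : K ⟶ K ⊞ L).f i ((biprod.fst : K ⊞ L ⟶ K).f i x) +
      (biprod.inr : L ⟶ K ⊞ L).f i ((biprod.snd : K ⊞ L ⟶ L).f i x) := by
  have h := congrArg (fun t : (K ⊞ L ⟶ K ⊞ L) => t.f i x) (biprod.total (X := K) (Y := L))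
  exact h.symm

lemma biprod_hm {K L : CC} (i : ℕ) (x : (K ⊞ L).homology i) :
    x = hm (biprod.inl : K ⟶ K ⊞ L) i (hm (biprod.fst : K ⊞ L ⟶ K) i x) +
      hm (biprod.inr : L ⟶ K ⊞ L) i (hm (biprod.snd : K ⊞ L ⟶ L) i x) := by
  have h := congrArg (fun t : (K ⊞ L ⟶ K ⊞ L) => hm t i x) (biprod.total (X := K) (Y := L))
  rw [← hm_comp, ← hm_comp]
  refine Eq.trans ?_ (h.symm.trans ?_)
  · exact (ConcreteCategory.congr_hom (HomologicalComplex.homologyMap_id (K ⊞ L) i) x).symm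
  · exact ConcreteCategory.congr_hom (HomologicalComplex.homologyMap_add _ _ i) x

structure MVData : Prop where
  comm : p ≫ f = q ≫ g
  inj : ∀ n, Function.Injective (p.f n)
  ex : ∀ n a b, f.f n a = g.f n b → ∃ c, p.f n c = a ∧ q.f n c = b
  surj : ∀ n (z : X.X n), (∀ j, X.d n j z = 0) → ∃ a b y, z = f.f n a + g.f n b + X.d (n+1) n y
  bd : ∀ n a b y, X.d (n+1) n y = f.f n a + g.f n b → (∀ j, X.d n j (f.f n a + g.f n b) = 0) →
    ∃ a' b', f.f n a + g.f n b = X.d (n+1) n (f.f (n+1) a' + g.f (n+1) b')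

variable {p q f g}

noncomputable abbrev mvφ (f : A ⟶ X) (g : B ⟶ X) : A ⊞ B ⟶ X := biprod.desc f g

noncomputable def mvS (h : MVData p q f g) : ShortComplex CC :=
  ShortComplex.mk (biprod.lift p (-q)) (factorThruImage (mvφ f g)) (by
    rw [← cancel_mono (image.ι (mvφ f g))]
    simp [biprod.lift_desc, h.comm])

lemma mvφ_inl (f : A ⟶ X) (g : B ⟶ X) (n : ℕ) (a) :
    (mvφ f g).f n ((biprod.inl : A ⟶ A ⊞ B).f n a) = f.f n a := by
  rw [← f_comp, biprod.inl_desc]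

lemma mvφ_inr (f : A ⟶ X) (g : B ⟶ X) (n : ℕ) (a) :
    (mvφ f g).f n ((biprod.inr : B ⟶ A ⊞ B).f n a) = g.f n a := by
  rw [← f_comp, biprod.inr_desc]

lemma mvφ_el (f : A ⟶ X) (g : B ⟶ X) (n : ℕ) (x) : (mvφ f g).f n x =
    f.f n ((biprod.fst : A ⊞ B ⟶ A).f n x) + g.f n ((biprod.snd : A ⊞ B ⟶ B).f n x) := by
  conv_lhs => rw [biprod_el n x]
  rw [map_add, mvφ_inl, mvφ_inr]

lemma mvφ_fac (f : A ⟶ X) (g : B ⟶ X) (n : ℕ) (x) :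
    (image.ι (mvφ f g)).f n ((factorThruImage (mvφ f g)).f n x) = (mvφ f g).f n x := by
  rw [← f_comp, image.fac]

lemma ι_inj (f : A ⟶ X) (g : B ⟶ X) (n : ℕ) : Function.Injective ((image.ι (mvφ f g)).f n) :=
  (ModuleCat.mono_iff_injective _).1
    (inferInstanceAs (Mono ((HomologicalComplex.eval _ _ n).map (image.ι (mvφ f g)))))

lemma e_surj (f : A ⟶ X) (g : B ⟶ X) (n : ℕ) : Function.Surjective ((factorThruImage (mvφ f g)).f n) :=
  (ModuleCat.epi_iff_surjective _).1
    (inferInstanceAs (Epi ((HomologicalComplex.eval _ _ n).map (factorThruImage (mvφ f g)))))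

lemma mvS_exact (h : MVData p q f g) : (mvS h).ShortExact := by
  refine HomologicalComplex.shortExact_of_degreewise_shortExact _ fun n => ?_
  have h1 : Function.Injective ((biprod.lift p (-q)).f n) := by
    intro x y hxy
    have := congrArg ((biprod.fst : A ⊞ B ⟶ A).f n) hxy
    rw [← f_comp, ← f_comp, biprod.lift_fst] at this
    exact h.inj n this
  have m1 : Mono ((mvS h).map (HomologicalComplex.eval _ _ n)).f :=
    (ModuleCat.mono_iff_injective _).2 h1
  have m2 : Epi ((mvS h).map (HomologicalComplex.eval _ _ n)).g :=
    (ModuleCat.epi_iff_surjective _).2 (e_surj f g n)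
  refine ShortComplex.ShortExact.mk ?_
  rw [ShortComplex.moduleCat_exact_iff]
  change ∀ x : (A ⊞ B).X n, (factorThruImage (mvφ f g)).f n x = 0 →
    ∃ c : P.X n, (biprod.lift p (-q)).f n c = x
  intro x hx
  have hx' : (mvφ f g).f n x = 0 := by
    rw [← mvφ_fac]
    exact (congrArg _ hx).trans (map_zero _)
  rw [mvφ_el] at hx'
  obtain ⟨c, h1, h2⟩ := h.ex n ((biprod.fst : A ⊞ B ⟶ A).f n x) (-((biprod.snd : A ⊞ B ⟶ B).f n x))
    (by rw [map_neg]; exact eq_neg_of_add_eq_zero_left hx')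
  refine ⟨c, ?_⟩
  rw [biprod_el n x, biprod_el n ((biprod.lift p (-q)).f n c), ← f_comp _ biprod.fst, 
    ← f_comp _ biprod.snd, biprod.lift_fst, biprod.lift_snd, h1]
  congr 2
  exact (congrArg Neg.neg h2).trans (neg_neg _)

lemma ι_bij (h : MVData p q f g) (n : ℕ) : Function.Bijective (hm (image.ι (mvφ f g)) n) := by
  constructor
  · refine qi_inj _ _ fun k y hy hk => ?_
    obtain ⟨x, rfl⟩ := e_surj f g n k
    rw [mvφ_fac, mvφ_el] at hy
    have hz : ∀ j, X.d n j (f.f n ((biprod.fst : A ⊞ B ⟶ A).f n x) +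
        g.f n ((biprod.snd : A ⊞ B ⟶ B).f n x)) = 0 := fun j => by
      rw [← hy]; exact ConcreteCategory.congr_hom (X.d_comp_d (n+1) n j) y
    obtain ⟨a', b', h'⟩ := h.bd n _ _ y hy hz
    refine ⟨(factorThruImage (mvφ f g)).f (n+1) ((biprod.inl : A ⟶ A ⊞ B).f (n+1) a' +
      (biprod.inr : B ⟶ A ⊞ B).f (n+1) b'), ι_inj f g n ?_⟩
    rw [← hom_comm, mvφ_fac, mvφ_fac, map_add, mvφ_inl, mvφ_inr, ← h', mvφ_el]
  · refine qi_surj _ _ (ι_inj f g) fun z hz => ?_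
    obtain ⟨a, b, y, h'⟩ := h.surj n z hz
    refine ⟨(factorThruImage (mvφ f g)).f n ((biprod.inl : A ⟶ A ⊞ B).f n a +
      (biprod.inr : B ⟶ A ⊞ B).f n b), y, ?_⟩
    rw [mvφ_fac, map_add, mvφ_inl, mvφ_inr, h']

lemma hmφ_inl (f : A ⟶ X) (g : B ⟶ X) (n : ℕ) (a) :
    hm (mvφ f g) n (hm (biprod.inl : A ⟶ A ⊞ B) n a) = hm f n a := by
  rw [← hm_comp, biprod.inl_desc]

lemma hmφ_inr (f : A ⟶ X) (g : B ⟶ X) (n : ℕ) (a) :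
    hm (mvφ f g) n (hm (biprod.inr : B ⟶ A ⊞ B) n a) = hm g n a := by
  rw [← hm_comp, biprod.inr_desc]

lemma hmφ_el (f : A ⟶ X) (g : B ⟶ X) (n : ℕ) (x) : hm (mvφ f g) n x =
    hm f n (hm (biprod.fst : A ⊞ B ⟶ A) n x) + hm g n (hm (biprod.snd : A ⊞ B ⟶ B) n x) := by
  conv_lhs => rw [biprod_hm n x]
  rw [map_add, hmφ_inl, hmφ_inr]

lemma hmφ_fac (f : A ⟶ X) (g : B ⟶ X) (n : ℕ) (x) :
    hm (image.ι (mvφ f g)) n (hm (factorThruImage (mvφ f g)) n x) = hm (mvφ f g) n x := by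
  rw [← hm_comp, image.fac]

theorem mv_zero (h : MVData p q f g) (x : X.homology 0) : ∃ α β, x = hm f 0 α + hm g 0 β := by
  obtain ⟨y, rfl⟩ := (ι_bij h 0).2 x
  have : Epi (hm (factorThruImage (mvφ f g)) 0) := 
    HomologicalComplex.epi_homologyMap_of_epi_of_not_rel _ _ (by simp)
  obtain ⟨w, rfl⟩ := (ModuleCat.epi_iff_surjective _).1 this y
  rw [hmφ_fac, hmφ_el]
  exact ⟨_, _, rfl⟩

theorem mv_E2 (h : MVData p q f g) (i : ℕ) (α : A.homology i) (β : B.homology i)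
    (hab : hm f i α = hm g i β) : ∃ γ, hm p i γ = α ∧ hm q i γ = β := by
  have hex : ∀ x : (A ⊞ B).homology i, hm (factorThruImage (mvφ f g)) i x = 0 →
      ∃ γ : P.homology i, hm (biprod.lift p (-q)) i γ = x :=
    (ShortComplex.moduleCat_exact_iff _).1 ((mvS_exact h).homology_exact₂ i)
  obtain ⟨γ, hγ⟩ := hex (hm biprod.inl i α - hm biprod.inr i β) (by
    apply (ι_bij h i).1
    rw [map_zero]
    refine (hmφ_fac f g i _).trans ?_
    rw [map_sub, hmφ_inl, hmφ_inr, hab, sub_self])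
  refine ⟨γ, ?_, ?_⟩
  · have := congrArg (hm (biprod.fst : A ⊞ B ⟶ A) i) hγ
    rw [← hm_comp, biprod.lift_fst, map_sub, ← hm_comp, ← hm_comp, biprod.inl_fst, biprod.inr_fst] at this
    rw [this]
    simp [hm]
  · have := congrArg (hm (biprod.snd : A ⊞ B ⟶ B) i) hγ
    rw [← hm_comp, biprod.lift_snd, map_sub, ← hm_comp, ← hm_comp, biprod.inl_snd, biprod.inr_snd] at this
    simpa [hm] using this

theorem mv_E1 (h : MVData p q f g) (i : ℕ) : ∃ δ : X.homology (i+1) →ₗ[ℚ] P.homology i,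
    (∀ x, δ x = 0 → ∃ α β, x = hm f (i+1) α + hm g (i+1) β) ∧
    (∀ x, hm p i (δ x) = 0) ∧ (∀ x, hm q i (δ x) = 0) := by
  have hS := mvS_exact h
  let e := LinearEquiv.ofBijective (hm (image.ι (mvφ f g)) (i+1)).hom (ι_bij h (i+1))
  let δ : (image (mvφ f g)).homology (i+1) ⟶ P.homology i := hS.δ (i+1) i (by simp)
  have key : ∀ x, hm (biprod.lift p (-q)) i (δ x) = 0 := fun x =>
    ConcreteCategory.congr_hom (hS.δ_comp (i+1) i (by simp)) x
  refine ⟨δ.hom ∘ₗ e.symm.toLinearMap, ?_, ?_, ?_⟩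
  · intro x hx
    obtain ⟨y, rfl⟩ := e.surjective x
    have hx' : δ y = 0 := by
      have : δ.hom (e.symm (e y)) = 0 := hx
      rwa [e.symm_apply_apply] at this
    have hex : ∀ y : (image (mvφ f g)).homology (i+1), δ y = 0 → ∃ w : (A ⊞ B).homology (i+1),
        hm (factorThruImage (mvφ f g)) (i+1) w = y :=
      (ShortComplex.moduleCat_exact_iff _).1 (hS.homology_exact₃ (i+1) i (by simp))
    obtain ⟨w, hw⟩ := hex y hx'
    refine ⟨hm biprod.fst _ w, hm biprod.snd _ w, ?_⟩
    rw [← hmφ_el, ← hmφ_fac, hw]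
    rfl
  · intro x
    have := congrArg (hm (biprod.fst : A ⊞ B ⟶ A) i) (key (e.symm x))
    rw [← hm_comp, biprod.lift_fst, map_zero] at this
    exact this
  · intro x
    have := congrArg (hm (biprod.snd : A ⊞ B ⟶ B) i) (key (e.symm x))
    rw [← hm_comp, biprod.lift_snd, map_zero] at this
    have h2 : hm (-q) i (δ (e.symm x)) = - hm q i (δ (e.symm x)) := by simp [hm]
    rw [h2, neg_eq_zero] at this
    exact this

end MV
end Sol

open CategoryTheory AlgebraicTopology

namespace Sol
open Limits

noncomputable abbrev H (i : ℕ) (X : Type) [TopologicalSpace X] : ModuleCat.{0} ℚ :=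
  (singularHomologyFunctor i).obj (TopCat.of X)

section
variable {P A B X Y Z : Type} [TopologicalSpace P] [TopologicalSpace A] [TopologicalSpace B]
  [TopologicalSpace X] [TopologicalSpace Y] [TopologicalSpace Z]

noncomputable def Hm (i : ℕ) (f : C(X, Y)) : H i X →ₗ[ℚ] H i Y :=
  ((singularHomologyFunctor i).map (TopCat.ofHom f)).hom

lemma Hm_comp (i : ℕ) (f : C(X, Y)) (g : C(Y, Z)) (x) : Hm i (g.comp f) x = Hm i g (Hm i f x) :=
  ConcreteCategory.congr_hom ((singularHomologyFunctor i).map_comp (TopCat.ofHom f) (TopCat.ofHom g)) x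

lemma Hm_id (i : ℕ) (x) : Hm i (ContinuousMap.id X) x = x :=
  ConcreteCategory.congr_hom ((singularHomologyFunctor i).map_id (TopCat.of X)) x

lemma Hm_homotopic (i : ℕ) {f g : C(X, Y)} (h : f.Homotopic g) : Hm i f = Hm i g :=
  congrArg ModuleCat.Hom.hom (map_eq_of_homotopic (TopCat.ofHom f) (TopCat.ofHom g) h i)

lemma Hm_inv (i : ℕ) (f : C(X, Y)) (g : C(Y, X)) (h : (g.comp f).Homotopic (ContinuousMap.id X)) (x) :
    Hm i g (Hm i f x) = x := by
  rw [← Hm_comp, Hm_homotopic i h, Hm_id]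

noncomputable def Hequiv (i : ℕ) (e : ContinuousMap.HomotopyEquiv X Y) : H i X ≃ₗ[ℚ] H i Y :=
  LinearEquiv.ofLinearMap (Hm i e.toFun) (Hm i e.invFun)
    (LinearMap.ext fun x => Hm_inv i e.invFun e.toFun e.right_inv x)
    (LinearMap.ext fun x => Hm_inv i e.toFun e.invFun e.left_inv x)

structure TopMV (p : C(P, A)) (q : C(P, B)) (f : C(A, X)) (g : C(B, X)) : Prop where
  comm : ∀ x, f (p x) = g (q x)
  hf : Topology.IsOpenEmbedding f
  hg : Topology.IsOpenEmbedding g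
  cover : Set.range f ∪ Set.range g = Set.univ
  hp : Topology.IsEmbedding p
  pull : ∀ a b, f a = g b → ∃ c, p c = a ∧ q c = b

lemma exists_lift {W : Type} [TopologicalSpace W] (f : C(A, X)) (hf : Topology.IsEmbedding f)
    (σ : C(W, X)) (h : Set.range σ ⊆ Set.range f) : ∃ τ : C(W, A), f.comp τ = σ := by
  choose t ht using fun w => h ⟨w, rfl⟩
  refine ⟨⟨t, hf.isInducing.continuous_iff.2 ?_⟩, ContinuousMap.ext ht⟩
  have : f ∘ t = σ := funext ht
  rw [this]; exact σ.continuous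

lemma comp_inj {W : Type} [TopologicalSpace W] (f : C(A, X)) (hf : Function.Injective f) :
    Function.Injective (fun σ : C(W, A) => f.comp σ) := by
  intro σ τ h
  ext w
  exact hf (DFunLike.congr_fun h w)

lemma finsupp_ex {S T U V : Type} (p : S → T) (q : S → U) (f : T → V) (g : U → V)
    (hc : ∀ s, f (p s) = g (q s)) (hf : Function.Injective f) (hg : Function.Injective g)
    (hpull : ∀ t u, f t = g u → ∃ s, p s = t ∧ q s = u) (α : T →₀ ℚ) (β : U →₀ ℚ)
    (h : Finsupp.mapDomain f α = Finsupp.mapDomain g β) :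
    ∃ γ, Finsupp.mapDomain p γ = α ∧ Finsupp.mapDomain q γ = β := by
  have hs : ∀ t ∈ α.support, ∃ s, p s = t := by
    intro t ht
    by_contra hcon
    have h1 : Finsupp.mapDomain f α (f t) = α t := Finsupp.mapDomain_apply hf _ _
    rw [h, Finsupp.mapDomain_of_notMem_range] at h1
    · exact (Finsupp.mem_support_iff.1 ht) h1.symm
    · rintro ⟨u, hu⟩
      obtain ⟨s, hs, _⟩ := hpull t u hu.symm
      exact hcon ⟨s, hs⟩
  have : ∃ γ, Finsupp.mapDomain p γ = α := by
    have hα : α ∈ Finsupp.supported ℚ ℚ (Set.range p) := fun t ht => hs t ht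
    rw [Finsupp.supported_eq_span_single, ← Set.range_comp] at hα
    have : Submodule.span ℚ (Set.range ((fun i => Finsupp.single i (1:ℚ)) ∘ p)) ≤
        LinearMap.range (Finsupp.lmapDomain ℚ ℚ p) := by
      rw [Submodule.span_le]
      rintro _ ⟨s, rfl⟩
      exact ⟨Finsupp.single s 1, by simp [Finsupp.mapDomain_single]⟩
    exact this hα
  obtain ⟨γ, rfl⟩ := this
  refine ⟨γ, rfl, Finsupp.mapDomain_injective hg ?_⟩
  rw [← h, ← Finsupp.mapDomain_comp, ← Finsupp.mapDomain_comp]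
  congr 1
  exact (funext hc).symm

lemma dC_dC (n : ℕ) (c : Ch (n+2) X) : dC n X (dC (n+1) X c) = 0 := by
  obtain ⟨x, rfl⟩ := (eC (n+2) (TopCat.of X)).surjective c
  refine (congrArg (dC n X) (eC_d (n+1) (TopCat.of X) x).symm).trans ?_
  refine (eC_d n (TopCat.of X) _).symm.trans ?_
  have := ConcreteCategory.congr_hom ((chainsF.obj (TopCat.of X)).d_comp_d (n+2) (n+1) n) x
  exact (congrArg (eC n (TopCat.of X)) this).trans (map_zero _)

noncomputable abbrev KK (X : Type) [TopologicalSpace X] : CC := chainsF.obj (TopCat.of X)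
noncomputable abbrev kk (f : C(X, Y)) : KK X ⟶ KK Y := chainsF.map (TopCat.ofHom f)
noncomputable abbrev ee (n : ℕ) (X : Type) [TopologicalSpace X] : (KK X).X n ≃ₗ[ℚ] Ch n X := eC n (TopCat.of X)

lemma ee_kk (n : ℕ) (f : C(X, Y)) (x) : ee n Y ((kk f).f n x) =
    Finsupp.mapDomain (fun σ => f.comp σ) (ee n X x) := eC_map n (TopCat.ofHom f) x

lemma ee_d (n : ℕ) (x) : ee n X ((KK X).d (n+1) n x) = dC n X (ee (n+1) X x) := eC_d n _ x

lemma small_of (f : C(A, X)) (g : C(B, X)) (n : ℕ) (a : (KK A).X n) (b : (KK B).X n) :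
    ee n X ((kk f).f n a + (kk g).f n b) ∈
      Finsupp.supported ℚ ℚ (smallS (Set.range f) (Set.range g) n) := by
  classical
  rw [map_add, ee_kk, ee_kk]
  refine Submodule.add_mem _ ?_ ?_
  · intro τ hτ
    have hw' := Finsupp.mapDomain_support hτ
    rw [Finset.mem_image] at hw'
    obtain ⟨u, hu, rfl⟩ := hw'
    left; rintro _ ⟨t, rfl⟩; exact ⟨u t, rfl⟩
  · intro τ hτ
    have hw' := Finsupp.mapDomain_support hτ
    rw [Finset.mem_image] at hw'
    obtain ⟨u, hu, rfl⟩ := hw'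
    right; rintro _ ⟨t, rfl⟩; exact ⟨u t, rfl⟩

lemma of_small (f : C(A, X)) (g : C(B, X)) (hf : Topology.IsEmbedding f) (hg : Topology.IsEmbedding g)
    (n : ℕ) (c : Ch n X)
    (hc : c ∈ Finsupp.supported ℚ ℚ (smallS (Set.range f) (Set.range g) n)) :
    ∃ (a : (KK A).X n) (b : (KK B).X n), ee n X ((kk f).f n a + (kk g).f n b) = c := by
  rw [Finsupp.supported_eq_span_single] at hc
  induction hc using Submodule.span_induction with
  | mem x hx =>
    obtain ⟨σ, hσ, rfl⟩ := hx
    rcases hσ with h | h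
    · obtain ⟨τ, rfl⟩ := exists_lift f hf σ h
      refine ⟨(ee n A).symm (Finsupp.single τ 1), 0, ?_⟩
      rw [map_zero, add_zero, ee_kk, LinearEquiv.apply_symm_apply, Finsupp.mapDomain_single]
    · obtain ⟨τ, rfl⟩ := exists_lift g hg σ h
      refine ⟨0, (ee n B).symm (Finsupp.single τ 1), ?_⟩
      rw [map_zero, zero_add, ee_kk, LinearEquiv.apply_symm_apply, Finsupp.mapDomain_single]
  | zero => exact ⟨0, 0, by simp⟩
  | add x y _ _ hx hy =>
    obtain ⟨a, b, rfl⟩ := hx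
    obtain ⟨a', b', rfl⟩ := hy
    refine ⟨a + a', b + b', ?_⟩
    rw [← (ee n X).map_add, (kk f |>.f n).hom.map_add, (kk g |>.f n).hom.map_add]
    exact congrArg (ee n X) (add_add_add_comm _ _ _ _)
  | smul r x _ hx =>
    obtain ⟨a, b, rfl⟩ := hx
    refine ⟨r • a, r • b, ?_⟩
    rw [← map_smul, map_smul, map_smul, smul_add]

variable {p : C(P, A)} {q : C(P, B)} {f : C(A, X)} {g : C(B, X)}

lemma TopMV.mv (h : TopMV p q f g) : MVData (kk p) (kk q) (kk f) (kk g) where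
  comm := by
    rw [← chainsF.map_comp, ← chainsF.map_comp]
    congr 1
    ext x
    exact h.comm x
  inj n x y hxy := by
    apply (ee n P).injective
    apply Finsupp.mapDomain_injective (comp_inj p h.hp.injective)
    have := congrArg (ee n A) hxy
    rwa [ee_kk, ee_kk] at this
  ex n a b hab := by
    have := congrArg (ee n X) hab
    rw [ee_kk, ee_kk] at this
    obtain ⟨γ, h1, h2⟩ := finsupp_ex (fun σ => p.comp σ) (fun σ => q.comp σ) _ _
      (fun σ => by ext t; exact h.comm (σ t))
      (comp_inj f h.hf.injective) (comp_inj g h.hg.injective)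
      (fun σ τ hστ => by
        have h0 : ∀ t, ∃ c, p c = σ t ∧ q c = τ t := fun t => h.pull _ _ (DFunLike.congr_fun hστ t)
        obtain ⟨ρ, hρ⟩ := exists_lift p h.hp σ (by
          rintro _ ⟨t, rfl⟩
          obtain ⟨c, hc, _⟩ := h0 t
          exact ⟨c, hc⟩)
        refine ⟨ρ, hρ, ?_⟩
        ext t
        apply h.hg.injective
        have e1 : f (σ t) = g (τ t) := DFunLike.congr_fun hστ t
        have e2 : p (ρ t) = σ t := DFunLike.congr_fun hρ t
        change g (q (ρ t)) = g (τ t)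
        rw [← h.comm, e2, e1])
      _ _ this
    refine ⟨(ee n P).symm γ, ?_, ?_⟩
    · apply (ee n A).injective
      rw [ee_kk, LinearEquiv.apply_symm_apply, h1]
    · apply (ee n B).injective
      rw [ee_kk, LinearEquiv.apply_symm_apply, h2]
  surj n z hz := by
    obtain ⟨m, hm⟩ := SS_small (Set.range f) (Set.range g) h.hf.isOpen_range h.hg.isOpen_range
      h.cover n (ee n X z)
    obtain ⟨a, b, hab⟩ := of_small f g h.hf.isEmbedding h.hg.isEmbedding n _ (hm m le_rfl)
    refine ⟨a, b, (ee (n+1) X).symm (TT m n (ee n X z)), ?_⟩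
    apply (ee n X).injective
    rw [map_add, hab, ee_d, LinearEquiv.apply_symm_apply]
    cases n with
    | zero => rw [TT_zero]; abel
    | succ n =>
      have h1 := TT_succ m n (ee (n+1) X z)
      have h2 : dC n X (ee (n+1) X z) = 0 := by rw [← ee_d, hz, map_zero]
      rw [h2, map_zero, add_zero] at h1
      rw [h1]; abel
  bd n a b y hy hz := by
    obtain ⟨m, hm⟩ := SS_small (Set.range f) (Set.range g) h.hf.isOpen_range h.hg.isOpen_range
      h.cover (n+1) (ee (n+1) X y)
    obtain ⟨a', b', hab⟩ := of_small f g h.hf.isEmbedding h.hg.isEmbedding (n+1)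
      (SS m (n+1) (ee (n+1) X y) + TT m n (ee n X ((kk f).f n a + (kk g).f n b)))
      (Submodule.add_mem _ (hm m le_rfl) (TT_small _ _ _ _ _ (small_of f g n a b)))
    refine ⟨a', b', ?_⟩
    apply (ee n X).injective
    rw [ee_d, hab]
    have h1 := TT_succ m n (ee (n+1) X y)
    rw [← ee_d, hy] at h1
    have h2 : SS m (n+1) (ee (n+1) X y) + TT m n (ee n X ((kk f).f n a + (kk g).f n b)) =
      ee (n+1) X y - dC (n+1) X (TT m (n+1) (ee (n+1) X y)) := by
      rw [eq_sub_iff_add_eq, add_assoc, add_comm (TT m n _), h1]; abel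
    rw [h2, map_sub, dC_dC, sub_zero, ← ee_d, hy]

theorem TopMV.zero (h : TopMV p q f g) (x : H 0 X) : ∃ α β, x = Hm 0 f α + Hm 0 g β :=
  mv_zero h.mv x

theorem TopMV.E2 (h : TopMV p q f g) (i : ℕ) (α : H i A) (β : H i B)
    (hab : Hm i f α = Hm i g β) : ∃ γ, Hm i p γ = α ∧ Hm i q γ = β :=
  mv_E2 h.mv i α β hab

theorem TopMV.E1 (h : TopMV p q f g) (i : ℕ) : ∃ δ : H (i+1) X →ₗ[ℚ] H i P,
    (∀ x, δ x = 0 → ∃ α β, x = Hm (i+1) f α + Hm (i+1) g β) ∧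
    (∀ x, Hm i p (δ x) = 0) ∧ (∀ x, Hm i q (δ x) = 0) :=
  mv_E1 h.mv i

end
end Sol

open CategoryTheory AlgebraicTopology

namespace Sol

section
variable {P A B X Y Z : Type} [TopologicalSpace P] [TopologicalSpace A] [TopologicalSpace B]
  [TopologicalSpace X] [TopologicalSpace Y] [TopologicalSpace Z]

lemma fin_of_finite (n : ℕ) [Finite C(Δ n, X)] : Module.Finite ℚ (H n X) := by
  have h1 : Module.Finite ℚ (Ch n X) := inferInstance
  have h2 : Module.Finite ℚ ((KK X).X n) := Module.Finite.equiv (ee n X).symm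
  have h3 : Module.Finite ℚ ((KK X).cycles n) :=
    Module.Finite.of_injective ((KK X).iCycles n).hom
      ((ModuleCat.mono_iff_injective ((KK X).iCycles n)).1 inferInstance)
  exact Module.Finite.of_surjective ((KK X).homologyπ n).hom (homologyπ_surj (KK X) n)

lemma H_empty (n : ℕ) [IsEmpty X] (x : H n X) : x = 0 := by
  obtain ⟨c, rfl⟩ := homologyπ_surj (KK X) n x
  have : IsEmpty C(Δ n, X) := ⟨fun σ => IsEmpty.false (σ (vert n 0))⟩
  have h : c = 0 := by
    apply (ModuleCat.mono_iff_injective ((KK X).iCycles n)).1 inferInstance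
    apply (ee n X).injective
    exact Subsingleton.elim (α := Ch n X) _ _
  rw [h]
  exact map_zero ((KK X).homologyπ n).hom

def FD (X : Type) [TopologicalSpace X] : Prop := ∀ i, Module.Finite ℚ (H i X)

lemma FD_equiv (e : ContinuousMap.HomotopyEquiv X Y) (h : FD X) : FD Y := fun i =>
  have := h i
  Module.Finite.equiv (Hequiv i e)

lemma FD_unique [Unique X] : FD X := fun i =>
  have : Subsingleton C(Δ i, X) := ⟨fun σ τ => ContinuousMap.ext fun _ => Subsingleton.elim _ _⟩
  fin_of_finite i

lemma FD_empty [IsEmpty X] : FD X := fun i =>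
  have : IsEmpty C(Δ i, X) := ⟨fun σ => IsEmpty.false (σ (vert i 0))⟩
  fin_of_finite i

lemma FD_contractible [ContractibleSpace X] : FD X :=
  FD_equiv (ContractibleSpace.hequiv_unit X).some.symm FD_unique

lemma TopMV.prod {p : C(P, A)} {q : C(P, B)} {f : C(A, X)} {g : C(B, X)} (h : TopMV p q f g)
    (Z : Type) [TopologicalSpace Z] :
    TopMV ((ContinuousMap.id Z).prodMap p) ((ContinuousMap.id Z).prodMap q)
      ((ContinuousMap.id Z).prodMap f) ((ContinuousMap.id Z).prodMap g) where
  comm x := Prod.ext rfl (h.comm x.2)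
  hf := Topology.IsOpenEmbedding.id.prodMap h.hf
  hg := Topology.IsOpenEmbedding.id.prodMap h.hg
  cover := by
    ext ⟨z, x⟩
    have : x ∈ Set.range f ∪ Set.range g := h.cover ▸ Set.mem_univ x
    rcases this with ⟨a, rfl⟩ | ⟨a, rfl⟩
    · exact iff_of_true (Or.inl ⟨(z, a), rfl⟩) trivial
    · exact iff_of_true (Or.inr ⟨(z, a), rfl⟩) trivial
  hp := Topology.IsEmbedding.id.prodMap h.hp
  pull := by
    rintro ⟨z, a⟩ ⟨z', b⟩ hab
    have h1 : z = z' := congrArg Prod.fst hab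
    subst h1
    obtain ⟨c, h1, h2⟩ := h.pull a b (congrArg Prod.snd hab)
    exact ⟨(z, c), Prod.ext rfl h1, Prod.ext rfl h2⟩

def incl {E : Type} [TopologicalSpace E] {S T : Set E} (h : S ⊆ T) : C(S, T) :=
  ⟨Set.inclusion h, continuous_inclusion h⟩

lemma subMV {E : Type} [TopologicalSpace E] {I S T U : Set E} (hS : IsOpen S) (hT : IsOpen T)
    (hI : S ∩ T = I) (hU : S ∪ T = U) :
    TopMV (incl (hI ▸ Set.inter_subset_left : I ⊆ S)) (incl (hI ▸ Set.inter_subset_right : I ⊆ T))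
      (incl (hU ▸ Set.subset_union_left : S ⊆ U)) (incl (hU ▸ Set.subset_union_right : T ⊆ U)) where
  comm x := rfl
  hf := .inclusion (hU ▸ Set.subset_union_left) (hS.preimage continuous_subtype_val)
  hg := .inclusion (hU ▸ Set.subset_union_right) (hT.preimage continuous_subtype_val)
  cover := by
    ext ⟨x, hx⟩
    have hx' := hx
    rw [← hU] at hx'
    rcases hx' with h | h
    · exact iff_of_true (Or.inl ⟨⟨x, h⟩, rfl⟩) trivial
    · exact iff_of_true (Or.inr ⟨⟨x, h⟩, rfl⟩) trivial
  hp := Topology.IsEmbedding.inclusion (hI ▸ Set.inter_subset_left)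
  pull := by
    rintro ⟨a, ha⟩ ⟨b, hb⟩ hab
    have h1 : a = b := congrArg Subtype.val hab
    subst h1
    exact ⟨⟨a, hI ▸ ⟨ha, hb⟩⟩, rfl, rfl⟩

lemma homotopic_of_contractible {T : Type} [TopologicalSpace T] [ContractibleSpace T] (f g : C(Y, T)) :
    f.Homotopic g := by
  obtain ⟨t, ht⟩ := id_nullhomotopic T
  have h1 : ∀ f : C(Y, T), f.Homotopic (ContinuousMap.const Y t) := fun f =>
    ContinuousMap.Homotopic.comp ht (ContinuousMap.Homotopic.refl f)
  exact (h1 f).trans (h1 g).symm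

abbrev pr (Z T : Type) [TopologicalSpace Z] [TopologicalSpace T] : C(Z × T, Z) := ContinuousMap.fst
abbrev sec (Z : Type) {T : Type} [TopologicalSpace Z] [TopologicalSpace T] (t : T) : C(Z, Z × T) :=
  (ContinuousMap.id Z).prodMk (ContinuousMap.const Z t)

lemma sec_pr {T : Type} [TopologicalSpace T] [ContractibleSpace T] (t : T) (i : ℕ) (x : H i (Z × T)) :
    Hm i (sec Z t) (Hm i (pr Z T) x) = x := by
  refine Hm_inv i (pr Z T) (sec Z t) ?_ x
  have : (sec Z t).comp (pr Z T) =
    (ContinuousMap.fst).prodMk (ContinuousMap.const (Z × T) t) := rfl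
  rw [this]
  have h2 : ContinuousMap.id (Z × T) = (ContinuousMap.fst).prodMk ContinuousMap.snd := rfl
  rw [h2]
  exact ContinuousMap.Homotopic.prodMk (ContinuousMap.Homotopic.refl _) (homotopic_of_contractible _ _)

lemma pr_sec {T : Type} [TopologicalSpace T] (t : T) (i : ℕ) (x : H i Z) :
    Hm i (pr Z T) (Hm i (sec Z t) x) = x :=
  Hm_inv i (sec Z t) (pr Z T) (ContinuousMap.Homotopic.refl (ContinuousMap.id Z)) x

/-! sets in the plane -/
def sA : Set ℂ := Complex.slitPlane
def sB : Set ℂ := {z | -z ∈ Complex.slitPlane}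
def sU : Set ℂ := {z | z ≠ 0}
def sI : Set ℂ := {z | z.im ≠ 0}
def sP : Set ℂ := {z | 0 < z.im}
def sN : Set ℂ := {z | z.im < 0}

lemma sA_open : IsOpen sA := Complex.isOpen_slitPlane
lemma sB_open : IsOpen sB := Complex.isOpen_slitPlane.preimage continuous_neg
lemma sP_open : IsOpen sP := isOpen_lt continuous_const Complex.continuous_im
lemma sN_open : IsOpen sN := isOpen_lt Complex.continuous_im continuous_const
lemma sAB : sA ∩ sB = sI := by
  ext z
  simp only [sA, sB, sI, Set.mem_inter_iff, Complex.mem_slitPlane_iff, Set.mem_ofPred_eq,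
    Complex.neg_re, Complex.neg_im]
  constructor
  · rintro ⟨h1 | h1, h2 | h2⟩
    · linarith
    · simpa using h2
    · exact h1
    · exact h1
  · intro h; exact ⟨Or.inr h, Or.inr (by simpa using h)⟩
lemma sAuB : sA ∪ sB = sU := by
  ext z
  constructor
  · rintro (h | h)
    · exact Complex.slitPlane_ne_zero h
    · have : -z ≠ 0 := Complex.slitPlane_ne_zero h
      exact neg_ne_zero.1 this
  · exact fun h => Complex.mem_slitPlane_or_neg_mem_slitPlane h
lemma sPN : sP ∩ sN = ∅ := by
  ext z
  simp only [sP, sN, Set.mem_inter_iff, Set.mem_ofPred_eq, Set.mem_empty_iff_false, iff_false]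
  intro h; linarith [h.1, h.2]
lemma sPuN : sP ∪ sN = sI := by
  ext z
  simp only [sP, sN, sI, Set.mem_union, Set.mem_ofPred_eq]
  rw [ne_iff_lt_or_gt, or_comm]
lemma I_A : Complex.I ∈ sA := Or.inr (by simp)
lemma I_B : Complex.I ∈ sB := Or.inr (by simp)
lemma I_P : Complex.I ∈ sP := by simp [sP]
lemma I_N : -Complex.I ∈ sN := by simp [sN]
lemma I_U : Complex.I ∈ sU := Complex.I_ne_zero

instance : ContractibleSpace sA :=
  Complex.starConvex_one_slitPlane.contractibleSpace ⟨_, I_A⟩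
instance : ContractibleSpace sB := by
  have : StarConvex ℝ (-1 : ℂ) sB := by
    intro y hy a b ha hb hab
    have := Complex.starConvex_one_slitPlane hy ha hb hab
    change -(a • (-1 : ℂ) + b • y) ∈ Complex.slitPlane
    convert this using 1
    simp only [smul_neg, neg_add, neg_neg]
  exact this.contractibleSpace ⟨_, I_B⟩
instance : ContractibleSpace sP := (convex_halfSpace_im_gt 0).contractibleSpace ⟨_, I_P⟩
instance : ContractibleSpace sN := (convex_halfSpace_im_lt 0).contractibleSpace ⟨_, I_N⟩

lemma incl_sec {S T : Set ℂ} (h : S ⊆ T) {z : ℂ} (hs : z ∈ S) (ht : z ∈ T) (i : ℕ) (y : H i Z) :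
    Hm i ((ContinuousMap.id Z).prodMap (incl h)) (Hm i (sec Z (⟨z, hs⟩ : S)) y) =
      Hm i (sec Z (⟨z, ht⟩ : T)) y :=
  (Hm_comp i (sec Z (⟨z, hs⟩ : S)) ((ContinuousMap.id Z).prodMap (incl h)) y).symm

lemma AB_decomp (i : ℕ) (x : H i (Z × sU)) (h0 : Hm i (pr Z sU) x = 0)
    (α : H i (Z × sA)) (β : H i (Z × sB))
    (hx : x = Hm i ((ContinuousMap.id Z).prodMap (incl (sAuB ▸ Set.subset_union_left : sA ⊆ sU))) α +
      Hm i ((ContinuousMap.id Z).prodMap (incl (sAuB ▸ Set.subset_union_right : sB ⊆ sU))) β) : x = 0 := by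
  rw [← sec_pr ⟨_, I_A⟩ i α, ← sec_pr ⟨_, I_B⟩ i β] at hx
  have hx2 : x = Hm i (sec Z (⟨_, I_U⟩ : sU)) (Hm i (pr Z sA) α) +
    Hm i (sec Z (⟨_, I_U⟩ : sU)) (Hm i (pr Z sB) β) :=
    hx.trans (congrArg₂ (· + ·) (incl_sec _ _ _ _ _) (incl_sec _ _ _ _ _))
  rw [← map_add] at hx2
  rw [hx2, pr_sec] at h0
  rw [hx2, h0, map_zero]

lemma PN_surj (i : ℕ) (x : H i (Z × sI)) : ∃ α β, x =
    Hm i ((ContinuousMap.id Z).prodMap (incl (sPuN ▸ Set.subset_union_left : sP ⊆ sI))) α +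
      Hm i ((ContinuousMap.id Z).prodMap (incl (sPuN ▸ Set.subset_union_right : sN ⊆ sI))) β := by
  have h := (subMV sP_open sN_open sPN sPuN).prod Z
  cases i with
  | zero => exact h.zero x
  | succ i =>
    obtain ⟨δ, h1, -⟩ := h.E1 i
    exact h1 x (H_empty i _)

lemma PN_ker (i : ℕ) (x : H i (Z × sI)) (h0 : Hm i (pr Z sI) x = 0) :
    x ∈ LinearMap.range (Hm i (sec Z (⟨Complex.I, by simp [sI]⟩ : sI)) -
      Hm i (sec Z (⟨-Complex.I, by simp [sI]⟩ : sI))) := by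
  obtain ⟨α, β, hx⟩ := PN_surj i x
  rw [← sec_pr ⟨_, I_P⟩ i α, ← sec_pr ⟨_, I_N⟩ i β] at hx
  have hx2 : x = Hm i (sec Z (⟨Complex.I, by simp [sI]⟩ : sI)) (Hm i (pr Z sP) α) +
    Hm i (sec Z (⟨-Complex.I, by simp [sI]⟩ : sI)) (Hm i (pr Z sN) β) :=
    hx.trans (congrArg₂ (· + ·) (incl_sec _ _ _ _ _) (incl_sec _ _ _ _ _))
  rw [hx2, map_add, pr_sec, pr_sec] at h0
  refine ⟨Hm i (pr Z sP) α, ?_⟩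
  rw [hx2, LinearMap.sub_apply, eq_neg_of_add_eq_zero_right h0, map_neg, sub_eq_add_neg]

theorem circle_zero (x : H 0 (Z × sU)) (h0 : Hm 0 (pr Z sU) x = 0) : x = 0 := by
  obtain ⟨α, β, hx⟩ := ((subMV sA_open sB_open sAB sAuB).prod Z).zero x
  exact AB_decomp 0 x h0 α β hx

theorem circle_succ (i : ℕ) :
    Module.rank ℚ (LinearMap.ker (Hm (i+1) (pr Z sU))) ≤ Module.rank ℚ (H i Z) := by
  obtain ⟨δ, h1, h2, -⟩ := ((subMV sA_open sB_open sAB sAuB).prod Z).E1 i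
  set R := LinearMap.range (Hm i (sec Z (⟨Complex.I, by simp [sI]⟩ : sI)) -
      Hm i (sec Z (⟨-Complex.I, by simp [sI]⟩ : sI))) with hR
  have hδ : ∀ x, δ x ∈ R := fun x => by
    refine PN_ker i _ ?_
    have := congrArg (Hm i (pr Z sA)) (h2 x)
    rw [← Hm_comp, map_zero] at this
    exact this
  refine (LinearMap.rank_le_of_injective
    ((δ.codRestrict R hδ).domRestrict (LinearMap.ker (Hm (i+1) (pr Z sU)))) ?_).trans
    (rank_range_le _)
  rw [injective_iff_map_eq_zero]
  rintro ⟨x, hx⟩ h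
  have h3 : δ x = 0 := congrArg Subtype.val h
  obtain ⟨α, β, hab⟩ := h1 x h3
  exact Subtype.ext (AB_decomp _ x hx α β hab)

/-- Hypotheses for Gysin. -/
structure GysinData (f : C(Y, X)) (g : C(Z × ℂ, X)) : Prop where
  hf : Topology.IsOpenEmbedding f
  hg : Topology.IsOpenEmbedding g
  cover : Set.range f ∪ Set.range g = Set.univ
  iff : ∀ z w, g (z, w) ∈ Set.range f ↔ w ≠ 0

variable {f : C(Y, X)} {g : C(Z × ℂ, X)}

lemma gysin_mv (h : GysinData f g) : ∃ p : C(Z × sU, Y),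
    TopMV p ((ContinuousMap.id Z).prodMap ⟨Subtype.val, continuous_subtype_val⟩) f g := by
  set q : C(Z × sU, Z × ℂ) := (ContinuousMap.id Z).prodMap ⟨Subtype.val, continuous_subtype_val⟩ with hq
  have hqe : Topology.IsEmbedding q := Topology.IsEmbedding.id.prodMap Topology.IsEmbedding.subtypeVal
  obtain ⟨p, hp⟩ := exists_lift f h.hf.isEmbedding (g.comp q) (by
    rintro _ ⟨⟨z, w⟩, rfl⟩
    exact (h.iff z w).2 w.2)
  refine ⟨p, ⟨fun x => DFunLike.congr_fun hp x, h.hf, h.hg, h.cover, ?_, ?_⟩⟩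
  · have : Topology.IsEmbedding (f ∘ p) := by
      have e : f ∘ p = g ∘ q := congrArg DFunLike.coe hp
      rw [e]
      exact h.hg.isEmbedding.comp hqe
    exact Topology.IsEmbedding.of_comp p.continuous f.continuous this
  · rintro y ⟨z, w⟩ hyw
    have hw : w ≠ 0 := (h.iff z w).1 ⟨y, hyw⟩
    refine ⟨(z, ⟨w, hw⟩), h.hf.injective ?_, rfl⟩
    exact (DFunLike.congr_fun hp (z, (⟨w, hw⟩ : sU))).trans hyw.symm

lemma gysin_ker (h : GysinData f g) (i : ℕ) : ∃ p : C(Z × sU, Y), LinearMap.ker (Hm i f) ≤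
    (LinearMap.ker (Hm i (pr Z sU))).map (Hm i p) := by
  obtain ⟨p, hp⟩ := gysin_mv h
  refine ⟨p, fun α hα => ?_⟩
  obtain ⟨γ, h1, h2⟩ := hp.E2 i α 0 (by rw [map_zero]; exact hα)
  refine ⟨γ, ?_, h1⟩
  have := congrArg (Hm i (pr Z ℂ)) h2
  rw [← Hm_comp, map_zero] at this
  exact this

theorem gysin_zero (h : GysinData f g) : Module.rank ℚ (H 0 Y) ≤ Module.rank ℚ (H 0 X) := by
  refine LinearMap.rank_le_of_injective (Hm 0 f) ?_
  rw [injective_iff_map_eq_zero]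
  intro x hx
  obtain ⟨p, hp⟩ := gysin_ker h 0
  obtain ⟨γ, h1, rfl⟩ := hp hx
  rw [circle_zero γ h1, map_zero]

theorem gysin_succ (h : GysinData f g) (i : ℕ) :
    Module.rank ℚ (H (i+1) Y) ≤ Module.rank ℚ (H (i+1) X) + Module.rank ℚ (H i Z) := by
  rw [← LinearMap.rank_range_add_rank_ker (Hm (i+1) f)]
  refine add_le_add (Submodule.rank_le _) ?_
  obtain ⟨p, hp⟩ := gysin_ker h (i+1)
  exact (Submodule.rank_mono hp).trans ((rank_map_le _ _).trans (circle_succ i))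

lemma finite_of_ker_range {V W : Type} [AddCommGroup V] [Module ℚ V] [AddCommGroup W] [Module ℚ W]
    [Module.Finite ℚ W] (φ : V →ₗ[ℚ] W) (h : Module.Finite ℚ (LinearMap.ker φ)) : Module.Finite ℚ V := by
  rw [← Module.rank_lt_aleph0_iff] at h ⊢
  rw [← LinearMap.rank_range_add_rank_ker φ]
  refine Cardinal.add_lt_aleph0 ?_ h
  exact Module.rank_lt_aleph0_iff.2 inferInstance

lemma TopMV.FD {p : C(P, A)} {q : C(P, B)} {f : C(A, X)} {g : C(B, X)} (h : TopMV p q f g)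
    (hP : FD P) (hA : FD A) (hB : FD B) : FD X := by
  intro i
  have hA' := hA i
  have hB' := hB i
  cases i with
  | zero =>
    refine Module.Finite.of_surjective ((Hm 0 f).coprod (Hm 0 g)) fun x => ?_
    obtain ⟨a, b, rfl⟩ := h.zero x
    exact ⟨(a, b), by simp⟩
  | succ i =>
    have hP' := hP i
    obtain ⟨δ, h1, -⟩ := h.E1 i
    refine finite_of_ker_range δ ?_
    have hle : LinearMap.ker δ ≤ LinearMap.range ((Hm (i+1) f).coprod (Hm (i+1) g)) := by
      intro x hx
      obtain ⟨a, b, rfl⟩ := h1 x hx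
      exact ⟨(a, b), by simp⟩
    exact Submodule.finiteDimensional_of_le hle

end
end Sol

open CategoryTheory AlgebraicTopology

namespace Sol

lemma punctures_succ (b : ℕ) : punctures (b+1) = insert ((b+1 : ℕ) : ℂ) (punctures b) := by
  ext z
  constructor
  · rintro ⟨k, h1, h2, rfl⟩
    rcases Nat.lt_or_ge b k with h | h
    · left; congr 1; omega
    · right; exact ⟨k, h1, h, rfl⟩
  · rintro (rfl | ⟨k, h1, h2, rfl⟩)
    · exact ⟨b+1, by omega, le_rfl, rfl⟩
    · exact ⟨k, h1, by omega, rfl⟩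

lemma punct_of {b : ℕ} {z : ℂ} (h : z ∈ punctures b) : z ∈ punctures (b+1) := by
  rw [punctures_succ]; exact Or.inr h

lemma punct_top {b : ℕ} {z : ℂ} (h : z = ((b+1 : ℕ) : ℂ)) : z ∈ punctures (b+1) := by
  rw [punctures_succ]; exact Or.inl h

lemma punctures_finite (b : ℕ) : (punctures b).Finite := by
  induction b with
  | zero =>
    convert Set.finite_empty
    ext z
    constructor
    · rintro ⟨k, h1, h2, -⟩; omega
    · rintro ⟨⟩
  | succ b ih => rw [punctures_succ]; exact ih.insert _

abbrev confSet (n a : ℕ) : Set (Fin n → ℂ) :=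
  {x | Function.Injective x ∧ ∀ k, x k ∉ punctures a}

lemma confSet_open (n a : ℕ) : IsOpen (confSet n a) := by
  have h1 : confSet n a = (⋂ i : Fin n, ⋂ j : Fin n, {x | i ≠ j → x i ≠ x j}) ∩
      ⋂ k : Fin n, {x | x k ∈ (punctures a)ᶜ} := by
    ext x
    simp only [confSet, Set.mem_inter_iff, Set.mem_iInter, Set.mem_ofPred_eq, Set.mem_compl_iff]
    refine and_congr_left fun _ => ⟨fun h i j hij e => hij (h e), fun h i j e => ?_⟩
    by_contra hij
    exact h i j hij e
  rw [h1]
  refine IsOpen.inter (isOpen_iInter_of_finite fun i => isOpen_iInter_of_finite fun j => ?_)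
    (isOpen_iInter_of_finite fun k => ?_)
  · by_cases hij : i = j
    · convert isOpen_univ
      ext x; simp [hij]
    · have : {x : Fin n → ℂ | i ≠ j → x i ≠ x j} = {x | x i ≠ x j} := by
        ext x; simp [hij]
      rw [this]
      exact isOpen_ne_fun (continuous_apply i) (continuous_apply j)
  · exact (punctures_finite a).isClosed.isOpen_compl.preimage (continuous_apply k)

def cval {n a : ℕ} (x : ConfSp n a) : Fin n → ℂ := x.1

lemma cval_open (n a : ℕ) : Topology.IsOpenEmbedding (cval : ConfSp n a → (Fin n → ℂ)) :=
  (confSet_open n a).isOpenEmbedding_subtypeVal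

lemma cval_inj {n a : ℕ} (x : ConfSp n a) : Function.Injective (cval x) := x.2.1

def um (n a : ℕ) : ConfSp n a → UConfSp n a := Quotient.mk (confSetoid n a)

lemma um_surj (n a : ℕ) : Function.Surjective (um n a) := Quotient.mk_surjective

lemma um_cont (n a : ℕ) : Continuous (um n a) := continuous_quot_mk

lemma perm_of_range {n : ℕ} {x y : Fin n → ℂ} (hx : Function.Injective x) (hy : Function.Injective y)
    (h : Set.range x = Set.range y) : ∃ σ : Equiv.Perm (Fin n), x ∘ σ = y := by
  refine ⟨((Equiv.ofInjective y hy).trans (Equiv.setCongr h.symm)).trans (Equiv.ofInjective x hx).symm, ?_⟩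
  funext i
  simp only [Function.comp_apply, Equiv.trans_apply]
  rw [Equiv.apply_ofInjective_symm hx]
  rfl

lemma um_eq {n a : ℕ} {x y : ConfSp n a} : um n a x = um n a y ↔ Set.range (cval x) = Set.range (cval y) := by
  constructor
  · intro h
    obtain ⟨σ, hσ⟩ : ∃ σ : Equiv.Perm (Fin n), x.1 ∘ σ = y.1 := Quotient.exact h
    change Set.range x.1 = Set.range y.1
    rw [← hσ, σ.surjective.range_comp]
  · intro h
    exact Quotient.sound (perm_of_range x.2.1 y.2.1 h)

def cperm {n a : ℕ} (σ : Equiv.Perm (Fin n)) (x : ConfSp n a) : ConfSp n a :=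
  ⟨x.1 ∘ σ, x.2.1.comp σ.injective, fun k => x.2.2 (σ k)⟩

lemma cperm_cont {n a : ℕ} (σ : Equiv.Perm (Fin n)) : Continuous (cperm σ : ConfSp n a → ConfSp n a) := by
  rw [(cval_open n a).isEmbedding.continuous_iff]
  exact continuous_pi fun k => (continuous_apply (σ k)).comp (cval_open n a).continuous

lemma um_open (n a : ℕ) : IsOpenMap (um n a) := by
  intro W hW
  have : um n a ⁻¹' (um n a '' W) = ⋃ σ : Equiv.Perm (Fin n), cperm σ ⁻¹' W := by
    ext x
    simp only [Set.mem_preimage, Set.mem_image, Set.mem_iUnion]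
    constructor
    · rintro ⟨y, hy, h⟩
      obtain ⟨σ, hσ⟩ : ∃ σ : Equiv.Perm (Fin n), x.1 ∘ σ = y.1 := Quotient.exact h.symm
      have : cperm σ x = y := Subtype.ext hσ
      exact ⟨σ, this ▸ hy⟩
    · rintro ⟨σ, h⟩
      refine ⟨_, h, um_eq.2 ?_⟩
      exact σ.surjective.range_comp _
  refine isOpen_coinduced.2 (?_ : IsOpen (um n a ⁻¹' (um n a '' W)))
  rw [this]
  exact isOpen_iUnion fun σ => hW.preimage (cperm_cont σ)

lemma um_oq (n a : ℕ) : IsOpenQuotientMap (um n a) := ⟨um_surj n a, um_cont n a, um_open n a⟩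

/-! forgetting a puncture -/
def fc (n b : ℕ) (x : ConfSp n (b+1)) : ConfSp n b :=
  ⟨x.1, x.2.1, fun k h => x.2.2 k (punct_of h)⟩

lemma fc_cont (n b : ℕ) : Continuous (fc n b) :=
  ((cval_open n b).isEmbedding.continuous_iff).2 (cval_open n (b+1)).continuous

lemma fc_open (n b : ℕ) : IsOpenMap (fc n b) := by
  have h : Topology.IsOpenEmbedding (cval ∘ fc n b) := cval_open n (b+1)
  exact (Topology.IsOpenEmbedding.of_comp (fc n b) (cval_open n b) h).isOpenMap

def fu0 (n b : ℕ) : UConfSp n (b+1) → UConfSp n b :=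
  Quotient.lift (fun x => um n b (fc n b x)) fun _ _ h => Quotient.sound h

lemma fu0_mk (n b : ℕ) (x : ConfSp n (b+1)) : fu0 n b (um n (b+1) x) = um n b (fc n b x) := rfl

lemma fu0_cont (n b : ℕ) : Continuous (fu0 n b) :=
  (um_oq n (b+1)).isQuotientMap.continuous_iff.2 ((um_cont n b).comp (fc_cont n b))

def fu (n b : ℕ) : C(UConfSp n (b+1), UConfSp n b) := ⟨fu0 n b, fu0_cont n b⟩

lemma isOpenMap_desc {A B C : Type} [TopologicalSpace A] [TopologicalSpace B] [TopologicalSpace C]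
    {p : A → B} {g : B → C} (hp : Continuous p) (hs : Function.Surjective p)
    (h : IsOpenMap (g ∘ p)) : IsOpenMap g := by
  intro W hW
  have := h _ (hW.preimage hp)
  rwa [Set.image_comp, Set.image_preimage_eq _ hs] at this

lemma fu_emb (n b : ℕ) : Topology.IsOpenEmbedding (fu n b) := by
  refine .of_continuous_injective_isOpenMap (fu0_cont n b) ?_ ?_
  · intro p q h
    obtain ⟨x, rfl⟩ := um_surj _ _ p
    obtain ⟨y, rfl⟩ := um_surj _ _ q
    have h' : um n b (fc n b x) = um n b (fc n b y) := h
    exact um_eq.2 (um_eq.1 h' :)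
  · exact isOpenMap_desc (um_cont n (b+1)) (um_surj n (b+1)) ((um_open n b).comp (fc_open n b))

lemma mem_range_fu (n b : ℕ) (x : ConfSp n b) :
    um n b x ∈ Set.range (fu n b) ↔ ((b+1 : ℕ) : ℂ) ∉ Set.range (cval x) := by
  constructor
  · rintro ⟨q, hq⟩
    obtain ⟨y, rfl⟩ := um_surj _ _ q
    have h1 : Set.range (cval y) = Set.range (cval x) := um_eq.1 (hq : um n b (fc n b y) = um n b x)
    rw [← h1]
    rintro ⟨k, hk⟩
    exact y.2.2 k (punct_top hk)
  · intro h
    refine ⟨um n (b+1) ⟨x.1, x.2.1, fun k hk => ?_⟩, rfl⟩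
    rw [punctures_succ] at hk
    rcases hk with hk | hk
    · exact h ⟨k, hk⟩
    · exact x.2.2 k hk

/-! adding a point -/
noncomputable def eps (m : ℕ) (c : ℂ) (z : Fin m → ℂ) : ℝ :=
  Finset.univ.inf' Finset.univ_nonempty (fun o : Option (Fin m) => o.elim 1 fun k => ‖z k - c‖)

lemma lt_eps {m : ℕ} {c : ℂ} {z : Fin m → ℂ} {r : ℝ} :
    r < eps m c z ↔ r < 1 ∧ ∀ k, r < ‖z k - c‖ := by
  unfold eps
  rw [Finset.lt_inf'_iff]
  constructor
  · exact fun h => ⟨h none (Finset.mem_univ _), fun k => h (some k) (Finset.mem_univ _)⟩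
  · rintro ⟨h1, h2⟩ (_ | k) -
    · exact h1
    · exact h2 k

lemma eps_cont (m : ℕ) (c : ℂ) : Continuous (eps m c) := by
  unfold eps
  refine Continuous.finset_inf'_apply _ fun o _ => ?_
  cases o with
  | none => exact continuous_const
  | some k => exact ((continuous_apply k).sub continuous_const).norm

lemma eps_range {m : ℕ} {c : ℂ} {z w : Fin m → ℂ} (h : Set.range z = Set.range w) :
    eps m c z = eps m c w := by
  refine eq_of_forall_lt_iff fun r => ?_
  rw [lt_eps, lt_eps, ← Set.forall_mem_range (p := fun t => r < ‖t - c‖), h,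
    Set.forall_mem_range]

lemma eps_pos {m b : ℕ} (z : ConfSp m (b+1)) : 0 < eps m ((b+1 : ℕ) : ℂ) (cval z) := by
  rw [lt_eps]
  refine ⟨one_pos, fun k => norm_pos_iff.2 (sub_ne_zero.2 fun h => z.2.2 k (punct_top h))⟩

noncomputable def ub : OpenPartialHomeomorph ℂ ℂ := OpenPartialHomeomorph.univUnitBall

lemma ub_source (s : ℂ) : s ∈ ub.source := Set.mem_univ s
lemma ub_lt (s : ℂ) : ‖ub s‖ < 1 := by
  have h : ub s ∈ Metric.ball (0 : ℂ) 1 := ub.map_source (ub_source s)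
  exact mem_ball_zero_iff.1 h
lemma ub_mem {w : ℂ} (h : ‖w‖ < 1) : w ∈ ub.target := mem_ball_zero_iff.2 h
lemma ub_zero : ub 0 = 0 := OpenPartialHomeomorph.univUnitBall_apply_zero
lemma ub_cont : Continuous ub := by
  have := ub.continuousOn
  rwa [(Set.eq_univ_of_forall ub_source), continuousOn_univ] at this
lemma ub_inj : Function.Injective ub := fun s t h => ub.injOn (ub_source s) (ub_source t) h

noncomputable def addP (m : ℕ) (c : ℂ) : OpenPartialHomeomorph ((Fin m → ℂ) × ℂ) (Fin (m+1) → ℂ) where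
  toFun p := Fin.cons (c + (eps m c p.1 : ℂ) * ub p.2) p.1
  invFun x := (Fin.tail x, ub.symm ((x 0 - c) / (eps m c (Fin.tail x) : ℂ)))
  source := {p | 0 < eps m c p.1}
  target := {x | ‖x 0 - c‖ < eps m c (Fin.tail x)}
  map_source' := by
    rintro ⟨z, s⟩ h
    have h : 0 < eps m c z := h
    simp only [Set.mem_ofPred_eq, Fin.cons_zero, Fin.tail_cons, add_sub_cancel_left, norm_mul,
      Complex.norm_real, Real.norm_of_nonneg h.le]
    nlinarith [ub_lt s]
  map_target' := by
    intro x h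
    exact (norm_nonneg _).trans_lt h
  left_inv' := by
    rintro ⟨z, s⟩ h
    have h : 0 < eps m c z := h
    have h' : (eps m c z : ℂ) ≠ 0 := by exact_mod_cast h.ne'
    refine Prod.ext ?_ ?_
    · simp
    · simp only [Fin.cons_zero, Fin.tail_cons, add_sub_cancel_left, mul_div_cancel_left₀ _ h']
      exact ub.left_inv (ub_source s)
  right_inv' := by
    intro x h
    have h : ‖x 0 - c‖ < eps m c (Fin.tail x) := h
    have h0 := (norm_nonneg _).trans_lt h
    have h' : (eps m c (Fin.tail x) : ℂ) ≠ 0 := by exact_mod_cast h0.ne'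
    have h2 : ‖(x 0 - c) / (eps m c (Fin.tail x) : ℂ)‖ < 1 := by
      rw [norm_div, Complex.norm_real, Real.norm_of_nonneg h0.le, div_lt_one h0]
      exact h
    simp only [ub.right_inv (ub_mem h2), mul_div_cancel₀ _ h']
    rw [add_sub_cancel]
    exact Fin.cons_self_tail x
  open_source := isOpen_lt continuous_const ((eps_cont m c).comp continuous_fst)
  open_target := isOpen_lt (((continuous_apply 0).sub continuous_const).norm)
    ((eps_cont m c).comp (continuous_pi fun k => continuous_apply k.succ))
  continuousOn_toFun := by
    refine Continuous.continuousOn (continuous_pi fun k => ?_)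
    refine Fin.cases ?_ (fun k => ?_) k
    · exact continuous_const.add ((Complex.continuous_ofReal.comp
        ((eps_cont m c).comp continuous_fst)).mul (ub_cont.comp continuous_snd))
    · exact (continuous_apply k).comp continuous_fst
  continuousOn_invFun := by
    have ht : Continuous (fun x : Fin (m+1) → ℂ => Fin.tail x) :=
      continuous_pi fun k => continuous_apply k.succ
    refine ht.continuousOn.prodMk ?_
    refine ub.symm.continuousOn.comp (ContinuousOn.div ?_ ?_ ?_) ?_
    · exact ((continuous_apply 0).sub continuous_const).continuousOn
    · exact (Complex.continuous_ofReal.comp ((eps_cont m c).comp ht)).continuousOn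
    · intro x h
      have h : ‖x 0 - c‖ < eps m c (Fin.tail x) := h
      have h0 := (norm_nonneg _).trans_lt h
      exact_mod_cast h0.ne'
    · intro x h
      have h : ‖x 0 - c‖ < eps m c (Fin.tail x) := h
      have h0 := (norm_nonneg _).trans_lt h
      refine ub_mem ?_
      rw [norm_div, Complex.norm_real, Real.norm_of_nonneg h0.le, div_lt_one h0]
      exact h

lemma norm_natCast_sub {b k : ℕ} (h : k ≤ b) : 1 ≤ ‖(k : ℂ) - ((b+1 : ℕ) : ℂ)‖ := by
  rw [norm_sub_rev, ← Nat.cast_sub (by omega), Complex.norm_natCast]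
  exact_mod_cast (by omega : 1 ≤ b + 1 - k)

/-- the new point -/
noncomputable def np {m b : ℕ} (z : ConfSp m (b+1)) (s : ℂ) : ℂ :=
  ((b+1 : ℕ) : ℂ) + (eps m ((b+1 : ℕ) : ℂ) (cval z) : ℂ) * ub s

lemma np_lt {m b : ℕ} (z : ConfSp m (b+1)) (s : ℂ) :
    ‖np z s - ((b+1 : ℕ) : ℂ)‖ < eps m ((b+1 : ℕ) : ℂ) (cval z) := by
  have h := eps_pos z
  rw [np, add_sub_cancel_left, norm_mul, Complex.norm_real, Real.norm_of_nonneg h.le]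
  nlinarith [ub_lt s]

lemma np_notMem {m b : ℕ} (z : ConfSp m (b+1)) (s : ℂ) : np z s ∉ Set.range (cval z) := by
  rintro ⟨k, hk⟩
  have := (lt_eps.1 (np_lt z s)).2 k
  rw [hk] at this
  exact lt_irrefl _ this

noncomputable def gc (m b : ℕ) (p : ConfSp m (b+1) × ℂ) : ConfSp (m+1) b :=
  ⟨Fin.cons (np p.1 p.2) (cval p.1), by
    refine Fin.cons_injective_iff.2 ⟨np_notMem _ _, p.1.2.1⟩, by
    intro k
    refine Fin.cases ?_ (fun k => ?_) k
    · rintro ⟨k, h1, h2, h3⟩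
      have h4 := (lt_eps.1 (np_lt p.1 p.2)).1
      rw [Fin.cons_zero] at h3
      rw [h3] at h4
      exact absurd h4 (not_lt.2 (norm_natCast_sub h2))
    · intro h
      rw [Fin.cons_succ] at h
      exact p.1.2.2 k (punct_of h)⟩

lemma range_gc (m b : ℕ) (z : ConfSp m (b+1)) (s : ℂ) :
    Set.range (cval (gc m b (z, s))) = insert (np z s) (Set.range (cval z)) := Fin.range_cons _ _

lemma cval_gc (m b : ℕ) : (fun p => cval (gc m b p)) =
    fun p => addP m ((b+1 : ℕ) : ℂ) (cval p.1, p.2) := rfl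

lemma gc_open (m b : ℕ) : Topology.IsOpenEmbedding (gc m b) := by
  refine Topology.IsOpenEmbedding.of_comp _ (cval_open (m+1) b) ?_
  change Topology.IsOpenEmbedding (fun p => cval (gc m b p))
  rw [cval_gc]
  generalize hc : ((b+1 : ℕ) : ℂ) = c
  have h1 : Topology.IsOpenEmbedding (fun p : ConfSp m (b+1) × ℂ => (cval p.1, p.2)) :=
    (cval_open m (b+1)).prodMap Topology.IsOpenEmbedding.id
  have h2 : ∀ p : ConfSp m (b+1) × ℂ, (cval p.1, p.2) ∈ (addP m c).source := by
    rw [← hc]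
    exact fun p => eps_pos p.1
  refine .of_continuous_injective_isOpenMap ?_ ?_ ?_
  · exact (addP m c).continuousOn.comp_continuous h1.continuous h2
  · intro p q h
    exact h1.injective ((addP m c).injOn (h2 p) (h2 q) h)
  · intro W hW
    have h3 := (addP m c).isOpen_image_of_subset_source (h1.isOpenMap W hW) (by
      rintro _ ⟨p, -, rfl⟩; exact h2 p)
    rwa [Set.image_image] at h3

lemma np_range {m b : ℕ} {z w : ConfSp m (b+1)} (h : Set.range (cval z) = Set.range (cval w)) (s : ℂ) :
    np z s = np w s := by
  rw [np, np, eps_range h]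

noncomputable def gu0 (m b : ℕ) (p : UConfSp m (b+1) × ℂ) : UConfSp (m+1) b :=
  Quotient.lift (fun z => um (m+1) b (gc m b (z, p.2))) (fun z w h => by
    have h' : Set.range (cval z) = Set.range (cval w) := um_eq.1 (Quotient.sound h)
    refine um_eq.2 ?_
    rw [range_gc, range_gc, h', np_range h']) p.1

lemma gu0_comp (m b : ℕ) : gu0 m b ∘ Prod.map (um m (b+1)) id = um (m+1) b ∘ gc m b := rfl

lemma gu_oq (m b : ℕ) : IsOpenQuotientMap (Prod.map (um m (b+1)) (id : ℂ → ℂ)) :=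
  (um_oq m (b+1)).prodMap IsOpenQuotientMap.id

lemma gu0_cont (m b : ℕ) : Continuous (gu0 m b) :=
  (gu_oq m b).isQuotientMap.continuous_iff.2 ((um_cont _ _).comp (gc_open m b).continuous)

noncomputable def gu (m b : ℕ) : C(UConfSp m (b+1) × ℂ, UConfSp (m+1) b) := ⟨gu0 m b, gu0_cont m b⟩

lemma gu_mk (m b : ℕ) (z : ConfSp m (b+1)) (s : ℂ) : gu m b (um _ _ z, s) = um _ _ (gc m b (z, s)) := rfl

lemma mem_of_insert {α : Type} {x y : α} {S T : Set α} (h : insert x S = insert y T)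
    (hy : x ≠ y) : x ∈ T ∧ y ∈ S := by
  have h1 : x ∈ insert y T := h ▸ Set.mem_insert x S
  have h2 : y ∈ insert x S := h ▸ Set.mem_insert y T
  exact ⟨h1.resolve_left hy, h2.resolve_left hy.symm⟩

lemma gu_inj (m b : ℕ) : Function.Injective (gu m b) := by
  rintro ⟨p, s⟩ ⟨q, t⟩ h
  obtain ⟨z, rfl⟩ := um_surj _ _ p
  obtain ⟨w, rfl⟩ := um_surj _ _ q
  rw [gu_mk, gu_mk, um_eq, range_gc, range_gc] at h
  have h1 : np z s = np w t := by
    by_contra hne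
    obtain ⟨⟨k, hk⟩, ⟨l, hl⟩⟩ := mem_of_insert h hne
    have h2 := (lt_eps.1 (np_lt z s)).2 l
    have h3 := (lt_eps.1 (np_lt w t)).2 k
    rw [hl] at h2
    rw [hk] at h3
    exact lt_asymm h2 h3
  have h2 : Set.range (cval z) = Set.range (cval w) := by
    rw [← Set.insert_sdiff_self_of_notMem (np_notMem z s), h, h1,
      Set.insert_sdiff_self_of_notMem (np_notMem w t)]
  refine Prod.ext (um_eq.2 h2) ?_
  rw [np, np, ← eps_range h2, add_right_inj] at h1
  exact ub_inj (mul_left_cancel₀ (by exact_mod_cast (eps_pos z).ne') h1)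

lemma gu_emb (m b : ℕ) : Topology.IsOpenEmbedding (gu m b) := by
  refine .of_continuous_injective_isOpenMap (gu0_cont m b) (gu_inj m b) ?_
  exact isOpenMap_desc (gu_oq m b).continuous (gu_oq m b).surjective
    ((um_open (m+1) b).comp (gc_open m b).isOpenMap)

theorem gysinData (m b : ℕ) : GysinData (fu (m+1) b) (gu m b) where
  hf := fu_emb _ _
  hg := gu_emb _ _
  cover := by
    refine Set.eq_univ_of_forall fun p => ?_
    obtain ⟨x, rfl⟩ := um_surj _ _ p
    by_cases h : ((b+1 : ℕ) : ℂ) ∈ Set.range (cval x)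
    · right
      obtain ⟨k, hk⟩ := h
      let z : ConfSp m (b+1) := ⟨fun j => x.1 (k.succAbove j),
        x.2.1.comp Fin.succAbove_right_injective, fun j hj => by
          rw [punctures_succ] at hj
          rcases hj with hj | hj
          · exact Fin.succAbove_ne k j (x.2.1 (hj.trans hk.symm))
          · exact x.2.2 _ hj⟩
      refine ⟨(um _ _ z, 0), ?_⟩
      rw [gu_mk, um_eq, range_gc, np, ub_zero, mul_zero, add_zero, ← hk]
      ext w
      constructor
      · rintro (rfl | ⟨j, rfl⟩)
        · exact ⟨k, rfl⟩
        · exact ⟨k.succAbove j, rfl⟩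
      · rintro ⟨j, rfl⟩
        rcases Fin.eq_self_or_eq_succAbove k j with rfl | ⟨i, rfl⟩
        · exact Or.inl rfl
        · exact Or.inr ⟨i, rfl⟩
    · left
      exact (mem_range_fu _ _ x).2 h
  iff := by
    intro p w
    obtain ⟨z, rfl⟩ := um_surj _ _ p
    rw [gu_mk, mem_range_fu, range_gc, not_iff_not]
    constructor
    · rintro (h | ⟨k, hk⟩)
      · rw [np, left_eq_add] at h
        have h2 := (mul_eq_zero.1 h).resolve_left (by exact_mod_cast (eps_pos z).ne')
        exact ub_inj (h2.trans ub_zero.symm)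
      · exact absurd (punct_top hk) (z.2.2 k)
    · rintro rfl
      left
      rw [np, ub_zero, mul_zero, add_zero]

end Sol

open CategoryTheory AlgebraicTopology

namespace Sol

lemma FD_homeo {X Y : Type} [TopologicalSpace X] [TopologicalSpace Y] (e : X ≃ₜ Y) (h : FD X) : FD Y :=
  FD_equiv e.toHomotopyEquiv h

lemma FD_set {X : Type} [TopologicalSpace X] {S T : Set X} (e : S = T) (h : FD S) : FD T := by
  subst e; exact h

lemma FD_union {X : Type} [TopologicalSpace X] {S T : Set X} (hS : IsOpen S) (hT : IsOpen T)
    (h1 : FD (S ∩ T : Set X)) (h2 : FD S) (h3 : FD T) : FD (S ∪ T : Set X) :=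
  (subMV hS hT rfl rfl).FD h1 h2 h3

lemma FD_convex {E : Type} [NormedAddCommGroup E] [NormedSpace ℝ E] {S : Set E} (h : Convex ℝ S) :
    FD S := by
  rcases S.eq_empty_or_nonempty with rfl | hne
  · exact FD_empty
  · have := h.contractibleSpace hne
    exact FD_contractible

lemma FD_biUnion_convex {E ι : Type} [DecidableEq ι] [NormedAddCommGroup E] [NormedSpace ℝ E]
    (s : Finset ι) :
    ∀ C : ι → Set E, (∀ i, IsOpen (C i)) → (∀ i, Convex ℝ (C i)) → FD (⋃ i ∈ s, C i : Set E) := by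
  induction s using Finset.induction_on with
  | empty =>
    intro C _ _
    refine FD_set (S := ∅) (by simp) FD_empty
  | insert k s _ ih =>
    intro C ho hc
    rw [Finset.set_biUnion_insert]
    refine FD_union (ho k) (isOpen_biUnion fun i _ => ho i) ?_ (FD_convex (hc k)) (ih C ho hc)
    rw [Set.inter_iUnion₂]
    exact ih _ (fun i => (ho k).inter (ho i)) fun i => (hc k).inter (hc i)

section
variable (n : ℕ)

def Q (W : Set (Fin n → ℂ)) : Set (UConfSp n 0) := um n 0 '' (cval ⁻¹' W)

lemma Q_open {W : Set (Fin n → ℂ)} (h : IsOpen W) : IsOpen (Q n W) :=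
  um_open n 0 _ (h.preimage (cval_open n 0).continuous)

lemma Q_FD {W : Set (Fin n → ℂ)} (ho : IsOpen W) (hW : W ⊆ confSet n 0)
    (hinj : ∀ x ∈ W, ∀ y ∈ W, Set.range x = Set.range y → x = y) (h : FD W) : FD (Q n W) := by
  let φ : W → ConfSp n 0 := fun x => ⟨x.1, hW x.2⟩
  have hφ : Topology.IsOpenEmbedding φ :=
    Topology.IsOpenEmbedding.of_comp _ (cval_open n 0) ho.isOpenEmbedding_subtypeVal
  let ψ : W → UConfSp n 0 := fun x => um n 0 (φ x)
  have hψ : Topology.IsOpenEmbedding ψ := by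
    refine .of_continuous_injective_isOpenMap ((um_cont n 0).comp hφ.continuous) ?_
      ((um_open n 0).comp hφ.isOpenMap)
    intro x y hxy
    exact Subtype.ext (hinj _ x.2 _ y.2 (um_eq.1 hxy))
  have hr : Set.range ψ = Q n W := by
    ext u
    constructor
    · rintro ⟨x, rfl⟩
      exact ⟨φ x, x.2, rfl⟩
    · rintro ⟨x, hx, rfl⟩
      exact ⟨⟨cval x, hx⟩, rfl⟩
  exact FD_set hr (FD_homeo hψ.isEmbedding.toHomeomorph h)

noncomputable def ell (j : ℕ) : ℂ →L[ℝ] ℝ := Complex.reCLM + (j : ℝ) • Complex.imCLM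

lemma ell_apply (j : ℕ) (z : ℂ) : ell j z = z.re + j * z.im := rfl

def Us (σ : Equiv.Perm (Fin n)) (j : ℕ) : Set (Fin n → ℂ) := {x | StrictMono fun i => ell j (x (σ i))}

lemma Us_eq (σ : Equiv.Perm (Fin n)) (j : ℕ) : Us n σ j =
    ⋂ i : Fin n, ⋂ k : Fin n, ⋂ _ : i < k, {x | 0 < ell j (x (σ k) - x (σ i))} := by
  ext x
  simp only [Us, Set.mem_ofPred_eq, Set.mem_iInter, map_sub, sub_pos]
  exact Iff.rfl

lemma Us_open (σ : Equiv.Perm (Fin n)) (j : ℕ) : IsOpen (Us n σ j) := by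
  rw [Us_eq]
  refine isOpen_iInter_of_finite fun i => isOpen_iInter_of_finite fun k =>
    isOpen_iInter_of_finite fun _ => ?_
  exact isOpen_lt continuous_const
    ((ell j).continuous.comp ((continuous_apply (σ k)).sub (continuous_apply (σ i))))

lemma Us_convex (σ : Equiv.Perm (Fin n)) (j : ℕ) : Convex ℝ (Us n σ j) := by
  rw [Us_eq]
  refine convex_iInter fun i => convex_iInter fun k => convex_iInter fun _ => ?_
  exact (convex_Ioi (0 : ℝ)).linear_preimage ((ell j).toLinearMap ∘ₗ
    ((LinearMap.proj (σ k) : (Fin n → ℂ) →ₗ[ℝ] ℂ) - (LinearMap.proj (σ i) : (Fin n → ℂ) →ₗ[ℝ] ℂ)))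

lemma Us_sub (j : ℕ) : Us n 1 j ⊆ confSet n 0 := by
  intro x hx
  refine ⟨fun i k h => ?_, ?_⟩
  · have hx : StrictMono fun i => ell j (x i) := hx
    exact hx.injective (congrArg (ell j) h)
  · rintro k ⟨l, h1, h2, -⟩
    omega

lemma Us_inj (j : ℕ) (x) (hx : x ∈ Us n 1 j) (y) (hy : y ∈ Us n 1 j)
    (h : Set.range x = Set.range y) : x = y := by
  have hx : StrictMono fun i => ell j (x i) := hx
  have hy : StrictMono fun i => ell j (y i) := hy
  have h1 : (fun i => ell j (x i)) = fun i => ell j (y i) := by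
    refine (StrictMono.range_inj hx hy).1 ?_
    change Set.range (ell j ∘ x) = Set.range (ell j ∘ y)
    rw [Set.range_comp, Set.range_comp, h]
  funext i
  obtain ⟨k, hk⟩ : y i ∈ Set.range x := h ▸ Set.mem_range_self i
  have h2 : ell j (x k) = ell j (x i) := by rw [hk]; exact (congrFun h1 i).symm
  have h3 : k = i := hx.injective h2
  rw [← hk, h3]

lemma exists_ell (x : Fin n → ℂ) (hx : Function.Injective x) :
    ∃ j ∈ Finset.range (n * n + 1), Function.Injective fun i => ell j (x i) := by
  by_contra! hcon
  have h1 : ∀ j, ∃ p : Fin n × Fin n, j ∈ Finset.range (n * n + 1) →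
      p.1 ≠ p.2 ∧ ell j (x p.1) = ell j (x p.2) := by
    intro j
    by_cases hj : j ∈ Finset.range (n * n + 1)
    · have := hcon j hj
      unfold Function.Injective at this
      push Not at this
      obtain ⟨i, k, h, h'⟩ := this
      exact ⟨(i, k), fun _ => ⟨h', h⟩⟩
    · have := hcon 0 (by simp)
      unfold Function.Injective at this
      push Not at this
      obtain ⟨i, k, h, h'⟩ := this
      exact ⟨(i, k), fun h => absurd h hj⟩
  choose p hp using h1
  obtain ⟨j, hj, j', hj', hne, he⟩ := Finset.exists_ne_map_eq_of_card_lt_of_maps_to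
    (s := Finset.range (n * n + 1)) (t := Finset.univ) (f := p) (by simp) (by simp)
  have a1 := hp j hj
  have a2 := hp j' hj'
  rw [← he] at a2
  have e1 := a1.2
  have e2 := a2.2
  rw [ell_apply, ell_apply] at e1 e2
  have hne' : (j : ℝ) - j' ≠ 0 := sub_ne_zero.2 (by exact_mod_cast hne)
  have h3 : ((j : ℝ) - j') * ((x (p j).1).im - (x (p j).2).im) = 0 := by linear_combination e1 - e2
  have h4 : (x (p j).1).im = (x (p j).2).im := sub_eq_zero.1 ((mul_eq_zero.1 h3).resolve_left hne')
  refine a1.1 (hx (Complex.ext ?_ h4))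
  rw [h4] at e1
  linarith

lemma Q_cover : (⋃ j ∈ Finset.range (n * n + 1), Q n (Us n 1 j)) = Set.univ := by
  refine Set.eq_univ_of_forall fun u => ?_
  obtain ⟨x, rfl⟩ := um_surj _ _ u
  obtain ⟨j, hj, h⟩ := exists_ell n (cval x) (cval_inj x)
  refine Set.mem_biUnion hj ?_
  let f : Fin n → ℝ := fun i => ell j (cval x i)
  refine ⟨cperm (Tuple.sort f) x, ?_, um_eq.2 ((Tuple.sort f).surjective.range_comp _)⟩
  exact (Tuple.monotone_sort f).strictMono_of_injective (h.comp (Tuple.sort f).injective)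

lemma Q_inter (k : ℕ) (s : Finset ℕ) :
    Q n (⋃ p ∈ (s ×ˢ (Finset.univ : Finset (Equiv.Perm (Fin n)))), (Us n 1 k ∩ Us n p.2 p.1)) =
    Q n (Us n 1 k) ∩ ⋃ j ∈ s, Q n (Us n 1 j) := by
  ext u
  constructor
  · rintro ⟨x, hx, rfl⟩
    obtain ⟨⟨j, σ⟩, hp, h1, h2⟩ := Set.mem_iUnion₂.1 hx
    refine ⟨⟨x, h1, rfl⟩, Set.mem_biUnion (Finset.mem_product.1 hp).1 ?_⟩
    exact ⟨cperm σ x, h2, um_eq.2 (σ.surjective.range_comp _)⟩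
  · rintro ⟨⟨x, hx, rfl⟩, hu⟩
    obtain ⟨j, hj, y, hy, hxy⟩ := Set.mem_iUnion₂.1 hu
    obtain ⟨σ, hσ⟩ := perm_of_range (cval_inj x) (cval_inj y) (um_eq.1 hxy).symm
    refine ⟨x, Set.mem_biUnion (x := (j, σ)) (by simpa using hj) ⟨hx, ?_⟩, rfl⟩
    have hy : StrictMono fun i => ell j (cval y i) := hy
    rw [← hσ] at hy
    exact hy

lemma FD_biUnion_Q (s : Finset ℕ) : FD (⋃ j ∈ s, Q n (Us n 1 j) : Set (UConfSp n 0)) := by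
  induction s using Finset.induction_on with
  | empty => exact FD_set (S := ∅) (by simp) FD_empty
  | insert k s _ ih =>
    rw [Finset.set_biUnion_insert]
    refine FD_union (Q_open n (Us_open n 1 k)) (isOpen_biUnion fun j _ => Q_open n (Us_open n 1 j))
      ?_ ?_ ih
    · rw [← Q_inter]
      have hsub : (⋃ p ∈ (s ×ˢ (Finset.univ : Finset (Equiv.Perm (Fin n)))),
          (Us n 1 k ∩ Us n p.2 p.1)) ⊆ Us n 1 k :=
        Set.iUnion₂_subset fun p _ => Set.inter_subset_left
      refine Q_FD n (isOpen_biUnion fun p _ => (Us_open n 1 k).inter (Us_open n p.2 p.1))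
        (hsub.trans (Us_sub n k)) (fun x hx y hy => Us_inj n k x (hsub hx) y (hsub hy)) ?_
      exact FD_biUnion_convex _ _ (fun p => (Us_open n 1 k).inter (Us_open n p.2 p.1))
        (fun p => (Us_convex n 1 k).inter (Us_convex n p.2 p.1))
    · exact Q_FD n (Us_open n 1 k) (Us_sub n k) (Us_inj n k) (FD_convex (Us_convex n 1 k))

lemma FD_zero_punct : FD (UConfSp n 0) :=
  FD_homeo (Homeomorph.Set.univ _) (FD_set (Q_cover n) (FD_biUnion_Q n _))

end

lemma FD_zero_pts (a : ℕ) : FD (UConfSp 0 a) := by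
  let x : ConfSp 0 a := ⟨Fin.elim0, fun i => i.elim0, fun i => i.elim0⟩
  have : Unique (UConfSp 0 a) :=
    { default := um 0 a x
      uniq := fun u => by
        obtain ⟨y, rfl⟩ := um_surj _ _ u
        exact um_eq.2 (congrArg Set.range (Subsingleton.elim _ _)) }
  exact FD_unique

lemma FD_gysin {X Y Z : Type} [TopologicalSpace X] [TopologicalSpace Y] [TopologicalSpace Z]
    {f : C(Y, X)} {g : C(Z × ℂ, X)} (h : GysinData f g) (hX : FD X) (hZ : FD Z) : FD Y := by
  intro i
  rw [← Module.rank_lt_aleph0_iff]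
  cases i with
  | zero => exact (gysin_zero h).trans_lt (Module.rank_lt_aleph0_iff.2 (hX 0))
  | succ i => exact (gysin_succ h i).trans_lt (Cardinal.add_lt_aleph0
      (Module.rank_lt_aleph0_iff.2 (hX _)) (Module.rank_lt_aleph0_iff.2 (hZ _)))

theorem FD_UConf (n : ℕ) : ∀ a, FD (UConfSp n a) := by
  induction n with
  | zero => exact FD_zero_pts
  | succ m ihm =>
    intro a
    induction a with
    | zero => exact FD_zero_punct _
    | succ b ihb => exact FD_gysin (gysinData m b) ihb (ihm (b+1))

theorem main (m b j : ℕ) : Module.finrank ℚ (H (j+1) (UConfSp (m+1) (b+1))) ≤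
    Module.finrank ℚ (H (j+1) (UConfSp (m+1) b)) + Module.finrank ℚ (H j (UConfSp m (b+1))) := by
  have h := gysin_succ (gysinData m b) j
  have h1 := FD_UConf (m+1) (b+1) (j+1)
  have h2 := FD_UConf (m+1) b (j+1)
  have h3 := FD_UConf m (b+1) j
  rw [← Module.finrank_eq_rank, ← Module.finrank_eq_rank, ← Module.finrank_eq_rank] at h
  exact_mod_cast h

end Sol

/-- For all `n ≥ 1`, `a ≥ 1` and `i ≥ 1`,
`dim H_i(UConf_n(ℂ ∖ {1,…,a})) ≤ dim H_i(UConf_n(ℂ ∖ {1,…,a−1}))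
  + dim H_{i−1}(UConf_{n−1}(ℂ ∖ {1,…,a}))`. -/
theorem stmt_4 (n a i : ℕ) (hn : 1 ≤ n) (ha : 1 ≤ a) (hi : 1 ≤ i) :
    bettiNumber i (TopCat.of (UConfSp n a)) ≤
      bettiNumber i (TopCat.of (UConfSp n (a - 1))) +
        bettiNumber (i - 1) (TopCat.of (UConfSp (n - 1) a)) := by
  obtain ⟨m, rfl⟩ := Nat.exists_eq_add_of_le' hn
  obtain ⟨b, rfl⟩ := Nat.exists_eq_add_of_le' ha
  obtain ⟨j, rfl⟩ := Nat.exists_eq_add_of_le' hi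
  exact Sol.main m b j
end

section
/- Let G be a finite group and for each n let W_n = (Fin n → G) ⋊ Equiv.Perm (Fin n). For all n, i ∈ ℕ let V^i_n be a finite-dimensional complex representation of W_n (for instance, the graded pieces of a graded FI_G-module). Then the following are equivalent: (1) for every FI_G character polynomial P there is a subexponential function F : ℕ → ℝ such that |⟨P_n, χ_{V^i_n}⟩_{W_n}| ≤ F(i) for all n and all i; (2) for every a ∈ ℕ there is a subexponential function F : ℕ → ℝ such that dim_ℂ (V^i_n)^{W_{n−a}} ≤ F(i) for all n ≥ a and all i, where W_{n−a} ⊆ W_n denotes the subgroup of pairs (g⃗, σ) with g⃗ k = 1 and σ k = k for all k ≥ n − a, and (V^i_n)^{W_{n−a}} is the subspace of vectors fixed by this subgroup. -/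
open scoped Classical

section WreathProduct

variable (G : Type*) [Group G]

/-- The permutation action of `Equiv.Perm (Fin n)` on labels `Fin n → G`,
`σ • g⃗ = g⃗ ∘ σ⁻¹`. -/
def wnPhi (n : ℕ) : Equiv.Perm (Fin n) →* MulAut (Fin n → G) where
  toFun σ :=
    { toFun := fun g => g ∘ ⇑σ⁻¹
      invFun := fun g => g ∘ ⇑σ
      left_inv := fun g => by ext i; simp
      right_inv := fun g => by ext i; simp
      map_mul' := fun g h => rfl }
  map_one' := by ext g i; simp
  map_mul' σ τ := by ext g i; rfl

/-- The wreath product `W_n = (Fin n → G) ⋊ Equiv.Perm (Fin n)`. -/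
abbrev Wn (n : ℕ) := SemidirectProduct (Fin n → G) (Equiv.Perm (Fin n)) (wnPhi G n)

noncomputable instance (n : ℕ) [Fintype G] : Fintype (Wn G n) :=
  Fintype.ofEquiv ((Fin n → G) × Equiv.Perm (Fin n))
    { toFun := fun p => ⟨p.1, p.2⟩
      invFun := fun w => (w.left, w.right)
      left_inv := fun p => rfl
      right_inv := fun w => rfl }

variable {G}

/-- The cycle product of `w = (g⃗, σ)` at the cycle of `σ` through `j`:
`g⃗(σ^{i−1} j) ⋯ g⃗(σ j) · g⃗(j)` where `i` is the length of the cycle of `j`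
(fixed points count as `1`-cycles). -/
noncomputable def cycleProd {n : ℕ} (g : Fin n → G) (σ : Equiv.Perm (Fin n)) (j : Fin n) : G :=
  (((List.range (Function.minimalPeriod (⇑σ) j)).map (fun k => g ((σ ^ k) j))).reverse).prod

/-- The cycle-counting class function `X_i^C` on `W_n`: the number of cycles of
`w.right` of length `i` whose cycle product lies in the conjugacy class `C`. Each such
cycle has exactly `i` points in its support, whence the division by `i`. -/
noncomputable def Xcyc {n : ℕ} (i : ℕ) (C : ConjClasses G) (w : Wn G n) : ℂ :=
  ((Finset.univ.filter (fun j : Fin n =>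
      Function.minimalPeriod (⇑w.right) j = i ∧
        ConjClasses.mk (cycleProd w.left w.right j) = C)).card : ℂ) / (i : ℂ)

/-- An `FI_G` character polynomial: a polynomial in the variables `X_i^C`
for `i ≥ 1` and `C ∈ c(G)`. -/
abbrev FIGCharPoly (G : Type*) [Group G] :=
  MvPolynomial ({i : ℕ // 0 < i} × ConjClasses G) ℂ

/-- Evaluation of an `FI_G` character polynomial as a class function on `W_n`. -/
noncomputable def evalCharPoly {n : ℕ} (P : FIGCharPoly G) (w : Wn G n) : ℂ :=
  MvPolynomial.eval (fun v => Xcyc v.1.1 v.2 w) P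

/-- The inner product of two class functions on the finite group `W_n`. -/
noncomputable def innerWn {n : ℕ} [Fintype G] (φ ψ : Wn G n → ℂ) : ℂ :=
  (Fintype.card (Wn G n) : ℂ)⁻¹ * ∑ w : Wn G n, φ w * (starRingEnd ℂ) (ψ w)

/-- A function `F : ℕ → ℝ` is subexponential if for every real `c > 1`,
`F(i)/c^i → 0` as `i → ∞`. -/
def Subexponential (F : ℕ → ℝ) : Prop :=
  ∀ c : ℝ, 1 < c → Filter.Tendsto (fun i : ℕ => F i / c ^ i) Filter.atTop (nhds 0)

end WreathProduct

namespace FIGAux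

variable {G : Type*} [Group G]

lemma mul_left_apply {n : ℕ} (w h : Wn G n) (k : Fin n) :
    (w * h).left k = w.left k * h.left (w.right⁻¹ k) := rfl

lemma mul_right_apply {n : ℕ} (w h : Wn G n) (k : Fin n) :
    (w * h).right k = w.right (h.right k) := rfl

lemma inv_left_apply {n : ℕ} (w : Wn G n) (k : Fin n) :
    (w⁻¹).left k = (w.left (w.right k))⁻¹ := by
  rfl

/-- elements fixing `S` pointwise with trivial labels on `S` -/
def Hsub {n : ℕ} (S : Finset (Fin n)) : Subgroup (Wn G n) where
  carrier := {w | ∀ k ∈ S, w.left k = 1 ∧ w.right k = k}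
  one_mem' := fun k _ => ⟨rfl, rfl⟩
  mul_mem' := by
    intro w h hw hh k hk
    have h1 := hw k hk
    have h2 := hh k hk
    have h3 : w.right⁻¹ k = k := by
      rw [Equiv.Perm.inv_eq_iff_eq]; exact h1.2.symm
    rw [mul_left_apply, mul_right_apply, h3, h1.1, h2.1, h2.2, h1.2]
    simp
  inv_mem' := by
    intro w hw k hk
    have h1 := hw k hk
    rw [inv_left_apply, h1.2, h1.1]
    refine ⟨by simp, ?_⟩
    rw [SemidirectProduct.inv_right, Equiv.Perm.inv_eq_iff_eq]
    exact h1.2.symm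

lemma mem_Hsub {n : ℕ} (S : Finset (Fin n)) (w : Wn G n) :
    w ∈ Hsub S ↔ ∀ k ∈ S, w.left k = 1 ∧ w.right k = k := Iff.rfl

lemma Hsub_anti {n : ℕ} {S T : Finset (Fin n)} (h : S ⊆ T) :
    (Hsub T : Subgroup (Wn G n)) ≤ Hsub S := fun _ hw k hk => hw k (h hk)

section rep

variable {n : ℕ} {V : Type*} [AddCommGroup V] [Module ℂ V]
  (ρ : Representation ℂ (Wn G n) V)

/-- invariants of `Hsub S` -/
noncomputable def Inv (S : Finset (Fin n)) : Submodule ℂ V :=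
  Representation.invariants (ρ.comp (Hsub S).subtype)

lemma mem_Inv (S : Finset (Fin n)) (v : V) :
    v ∈ Inv ρ S ↔ ∀ w ∈ Hsub S, ρ w v = v := by
  unfold Inv
  rw [Representation.mem_invariants]
  simp

lemma Inv_mono {S T : Finset (Fin n)} (h : S ⊆ T) : Inv ρ S ≤ Inv ρ T := by
  intro v hv
  rw [mem_Inv] at *
  exact fun w hw => hv w (Hsub_anti h hw)

lemma conj_mem (w h : Wn G n) (S : Finset (Fin n)) (hh : h ∈ Hsub (S.image w.right)) :
    w⁻¹ * h * w ∈ Hsub S := by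
  intro k hk
  have h1 := hh (w.right k) (Finset.mem_image_of_mem _ hk)
  have e1 : (h.right)⁻¹ (w.right k) = w.right k := by
    rw [Equiv.Perm.inv_eq_iff_eq]; exact h1.2.symm
  constructor
  · rw [mul_left_apply, mul_left_apply, inv_left_apply]
    rw [SemidirectProduct.inv_right, inv_inv, h1.1, SemidirectProduct.mul_right,
      SemidirectProduct.inv_right, mul_inv_rev, inv_inv, Equiv.Perm.mul_apply, e1]
    simp
  · rw [mul_right_apply, mul_right_apply, h1.2]
    simp

lemma map_mem_Inv (w : Wn G n) (S : Finset (Fin n)) (v : V) (hv : v ∈ Inv ρ S) :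
    ρ w v ∈ Inv ρ (S.image w.right) := by
  rw [mem_Inv] at *
  intro h hh
  have := hv _ (conj_mem w h S hh)
  rw [map_mul, map_mul] at this
  have h2 := congrArg (ρ w) this
  simp only [Module.End.mul_apply] at h2
  rw [← Module.End.mul_apply, ← map_mul] at h2
  simpa using h2

lemma finrank_Inv_le [FiniteDimensional ℂ V] (w : Wn G n) (S : Finset (Fin n)) :
    Module.finrank ℂ (Inv ρ S) ≤ Module.finrank ℂ (Inv ρ (S.image w.right)) := by
  refine LinearMap.finrank_le_finrank_of_injective
    (f := (ρ w).restrict (fun v hv => map_mem_Inv ρ w S v hv)) ?_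
  intro x y hxy
  have h1 : ρ w x = ρ w y := congrArg Subtype.val hxy
  have h2 := congrArg (ρ w⁻¹) h1
  simpa using h2

lemma image_inv_image (w : Wn G n) (S : Finset (Fin n)) :
    (S.image w.right).image (w⁻¹).right = S := by
  rw [Finset.image_image]
  have : (⇑(w⁻¹).right ∘ ⇑w.right) = id := by
    funext x; simp
  rw [this, Finset.image_id]

lemma finrank_Inv_image [FiniteDimensional ℂ V] (w : Wn G n) (S : Finset (Fin n)) :
    Module.finrank ℂ (Inv ρ (S.image w.right)) = Module.finrank ℂ (Inv ρ S) := by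
  refine le_antisymm ?_ (finrank_Inv_le ρ w S)
  have := finrank_Inv_le ρ w⁻¹ (S.image w.right)
  rwa [image_inv_image] at this

lemma card_Hsub_le [Fintype G] (w : Wn G n) (S : Finset (Fin n)) :
    Fintype.card (Hsub S : Subgroup (Wn G n)) ≤ Fintype.card (Hsub (S.image w.right) : Subgroup (Wn G n)) := by
  refine Fintype.card_le_of_injective
    (fun h => ⟨w * h.1 * w⁻¹, ?_⟩) ?_
  · have := conj_mem w⁻¹ h.1 (S.image w.right) (by rw [image_inv_image]; exact h.2)
    simpa using this
  · intro x y hxy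
    simpa using hxy

/-- The averaging projector. -/
noncomputable def Av [Fintype G] (S : Finset (Fin n)) : V →ₗ[ℂ] V :=
  (Fintype.card (Hsub S : Subgroup (Wn G n)) : ℂ)⁻¹ •
    ∑ h : (Hsub S : Subgroup (Wn G n)), ρ h.1

lemma cardH_ne [Fintype G] (S : Finset (Fin n)) :
    (Fintype.card (Hsub S : Subgroup (Wn G n)) : ℂ) ≠ 0 := by
  exact_mod_cast Fintype.card_ne_zero

lemma Av_isProj [Fintype G] (S : Finset (Fin n)) : LinearMap.IsProj (Inv ρ S) (Av ρ S) := by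
  constructor
  · intro v
    rw [mem_Inv]
    intro w hw
    unfold Av
    simp only [LinearMap.smul_apply, LinearMap.sum_apply, map_smul, map_sum]
    congr 1
    rw [← Equiv.sum_comp (Equiv.mulLeft (⟨w, hw⟩ : (Hsub S : Subgroup (Wn G n))))
      (fun h => ρ h.1 v)]
    simp
  · intro v hv
    rw [mem_Inv] at hv
    unfold Av
    simp only [LinearMap.smul_apply, LinearMap.sum_apply]
    rw [Finset.sum_congr rfl (fun h _ => hv h.1 h.2)]
    rw [Finset.sum_const, Finset.card_univ, ← Nat.cast_smul_eq_nsmul ℂ, smul_smul,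
      inv_mul_cancel₀ (cardH_ne S), one_smul]

lemma sum_trace [Fintype G] [FiniteDimensional ℂ V] (S : Finset (Fin n)) :
    ∑ h : (Hsub S : Subgroup (Wn G n)), LinearMap.trace ℂ V (ρ h.1) =
      (Fintype.card (Hsub S : Subgroup (Wn G n)) : ℂ) * Module.finrank ℂ (Inv ρ S) := by
  have h1 := (Av_isProj ρ S).trace
  rw [← h1]
  unfold Av
  rw [map_smul, map_sum, smul_eq_mul, ← mul_assoc, mul_inv_cancel₀ (cardH_ne S), one_mul]

lemma norm_trace_le {U : Type*} [AddCommGroup U] [Module ℂ U] [FiniteDimensional ℂ U]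
    (f : Module.End ℂ U) (N : ℕ) (hN : N ≠ 0) (hf : f ^ N = 1) :
    ‖LinearMap.trace ℂ U f‖ ≤ Module.finrank ℂ U := by
  have hs : f.charpoly.Splits := IsAlgClosed.splits _
  rw [Module.End.trace_eq_sum_roots_charpoly_of_splits hs]
  have hr : ∀ μ ∈ f.charpoly.roots, ‖μ‖ = 1 := by
    intro μ hμ
    have h1 : f.HasEigenvalue μ := by
      rw [Module.End.hasEigenvalue_iff_isRoot_charpoly]
      exact Polynomial.isRoot_of_mem_roots hμ
    obtain ⟨v, hv⟩ := h1.exists_hasEigenvector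
    have h2 := hv.pow_apply N
    rw [hf, Module.End.one_apply] at h2
    have h3 : μ ^ N = 1 := by
      have : (μ ^ N - 1) • v = 0 := by rw [sub_smul, one_smul, ← h2, sub_self]
      rcases smul_eq_zero.1 this with h | h
      · exact sub_eq_zero.1 h
      · exact absurd h hv.2
    exact Complex.norm_eq_one_of_pow_eq_one h3 hN
  calc ‖f.charpoly.roots.sum‖ ≤ (f.charpoly.roots.map norm).sum := norm_multiset_sum_le _
    _ = (f.charpoly.roots.map (fun _ => (1:ℝ))).sum := by
        congr 1; exact Multiset.map_congr rfl hr
    _ = f.charpoly.roots.card := by simp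
    _ ≤ f.charpoly.natDegree := by exact_mod_cast Polynomial.card_roots' _
    _ = Module.finrank ℂ U := by rw [LinearMap.charpoly_natDegree]

lemma norm_trace_Av [Fintype G] [FiniteDimensional ℂ V] (S : Finset (Fin n)) (w : Wn G n)
    (hw : S.image w.right = S) :
    ‖LinearMap.trace ℂ V (ρ w * Av ρ S)‖ ≤ Module.finrank ℂ (Inv ρ S) := by
  have hm : ∀ v ∈ Inv ρ S, ρ w v ∈ Inv ρ S := by
    intro v hv
    have := map_mem_Inv ρ w S v hv
    rwa [hw] at this
  have hA : ∀ v, (ρ w * Av ρ S) v ∈ Inv ρ S := fun v => hm _ ((Av_isProj ρ S).map_mem v)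
  have h1 := LinearMap.trace_restrict_eq_of_forall_mem (Inv ρ S) (ρ w * Av ρ S) hA
  rw [← h1]
  refine norm_trace_le _ (Fintype.card (Wn G n)) Fintype.card_ne_zero ?_
  have h2 : (ρ w * Av ρ S).restrict (fun x _ => hA x) = (ρ w).restrict hm := by
    ext x
    simp [LinearMap.restrict_apply, (Av_isProj ρ S).map_id x.1 x.2]
  rw [h2, Module.End.pow_restrict]
  ext x
  simp only [LinearMap.restrict_apply, ← map_pow, pow_card_eq_one, map_one]
  rfl

lemma trace_mul_Av [Fintype G] [FiniteDimensional ℂ V] (S : Finset (Fin n)) (w : Wn G n) :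
    LinearMap.trace ℂ V (ρ w * Av ρ S) = (Fintype.card (Hsub S : Subgroup (Wn G n)) : ℂ)⁻¹ *
      ∑ h : (Hsub S : Subgroup (Wn G n)), LinearMap.trace ℂ V (ρ (w * h.1)) := by
  unfold Av
  rw [mul_smul_comm, map_smul, Finset.mul_sum, map_sum, smul_eq_mul]
  simp

/-- the averaging trick -/
lemma sum_avg [Fintype G] [FiniteDimensional ℂ V] (S : Finset (Fin n)) (f : Wn G n → ℂ)
    (hf : ∀ w, ∀ h ∈ Hsub S, f (w * h) = f w) :
    ∑ w, f w * (starRingEnd ℂ) (LinearMap.trace ℂ V (ρ w)) =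
      ∑ w, f w * (starRingEnd ℂ) (LinearMap.trace ℂ V (ρ w * Av ρ S)) := by
  have key : ∀ h : (Hsub S : Subgroup (Wn G n)),
      ∑ w, f w * (starRingEnd ℂ) (LinearMap.trace ℂ V (ρ (w * h.1))) =
      ∑ w, f w * (starRingEnd ℂ) (LinearMap.trace ℂ V (ρ w)) := by
    intro h
    rw [← Equiv.sum_comp (Equiv.mulRight h.1)
      (fun w => f w * (starRingEnd ℂ) (LinearMap.trace ℂ V (ρ w)))]
    refine Finset.sum_congr rfl fun w _ => ?_
    simp [hf w h.1 h.2]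
  simp_rw [trace_mul_Av, map_mul, map_sum, Finset.mul_sum]
  rw [Finset.sum_comm]
  have : ∀ h : (Hsub S : Subgroup (Wn G n)), ∑ w, f w *
      ((starRingEnd ℂ) (Fintype.card (Hsub S : Subgroup (Wn G n)) : ℂ)⁻¹ *
        (starRingEnd ℂ) (LinearMap.trace ℂ V (ρ (w * h.1)))) =
      (Fintype.card (Hsub S : Subgroup (Wn G n)) : ℂ)⁻¹ *
        ∑ w, f w * (starRingEnd ℂ) (LinearMap.trace ℂ V (ρ w)) := by
    intro h
    rw [← key h, Finset.mul_sum]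
    refine Finset.sum_congr rfl fun w _ => ?_
    rw [map_inv₀, map_natCast]
    ring
  simp only [map_mul] at this
  rw [Finset.sum_congr rfl (fun h _ => this h), Finset.sum_const, Finset.card_univ,
    nsmul_eq_mul, ← mul_assoc, mul_inv_cancel₀ (cardH_ne S), one_mul]

end rep

lemma exists_perm {n : ℕ} (S T : Finset (Fin n)) (h : S.card = T.card) :
    ∃ σ : Equiv.Perm (Fin n), S.image σ = T := by
  have e : {x // x ∈ S} ≃ {x // x ∈ T} := Fintype.equivOfCardEq (by simpa using h)
  refine ⟨e.extendSubtype, Finset.eq_of_subset_of_card_le ?_ ?_⟩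
  · intro x hx
    obtain ⟨y, hy, rfl⟩ := Finset.mem_image.1 hx
    exact e.extendSubtype_mem y hy
  · rw [Finset.card_image_of_injective _ (Equiv.injective _), h]

/-- `S0` : last `a` points -/
def S0 (n a : ℕ) : Finset (Fin n) := Finset.univ.filter (fun k => n - a ≤ (k : ℕ))

lemma mem_S0 {n a : ℕ} (k : Fin n) : k ∈ S0 n a ↔ n - a ≤ (k : ℕ) := by simp [S0]

lemma card_S0 {n a : ℕ} (h : a ≤ n) : (S0 n a).card = a := by
  have : (S0 n a).map Fin.valEmbedding = Finset.Ico (n - a) n := by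
    ext x
    simp only [Finset.mem_map, mem_S0, Finset.mem_Ico, Fin.valEmbedding_apply]
    constructor
    · rintro ⟨k, hk, rfl⟩; exact ⟨hk, k.2⟩
    · rintro ⟨h1, h2⟩; exact ⟨⟨x, h2⟩, h1, rfl⟩
  have h2 := congrArg Finset.card this
  rw [Finset.card_map, Nat.card_Ico] at h2
  omega

lemma finrank_le_S0 {n b : ℕ} {V : Type*} [AddCommGroup V] [Module ℂ V] [FiniteDimensional ℂ V]
    (ρ : Representation ℂ (Wn G n) V) (hb : b ≤ n) (S : Finset (Fin n)) (hS : S.card ≤ b) :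
    Module.finrank ℂ (Inv ρ S) ≤ Module.finrank ℂ (Inv ρ (S0 n b)) := by
  obtain ⟨T, hST, hT⟩ := Finset.exists_superset_card_eq hS (by simpa using hb)
  obtain ⟨σ, hσ⟩ := exists_perm (S0 n b) T (by rw [card_S0 hb, hT])
  have h1 := finrank_Inv_image ρ (SemidirectProduct.inr σ) (S0 n b)
  rw [SemidirectProduct.right_inr, hσ] at h1
  rw [← h1]
  exact Submodule.finrank_mono (Inv_mono ρ hST)

lemma frozen_eq {n a : ℕ} {V : Type*} [AddCommGroup V] [Module ℂ V]
    (ρ : Representation ℂ (Wn G n) V) :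
    (⨅ (w : Wn G n) (_ : ∀ k : Fin n, n - a ≤ (k : ℕ) → w.left k = 1 ∧ w.right k = k),
              LinearMap.ker (ρ w - LinearMap.id)) = Inv ρ (S0 n a) := by
  ext v
  rw [mem_Inv]
  simp only [Submodule.mem_iInf, LinearMap.mem_ker, LinearMap.sub_apply, LinearMap.id_apply,
    sub_eq_zero, mem_Hsub, mem_S0]

/-- action on small subsets -/
noncomputable def act (n a : ℕ) : MulAction (Wn G n) {S : Finset (Fin n) // S.card ≤ a} where
  smul w S := ⟨S.1.image w.right, Finset.card_image_le.trans S.2⟩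
  one_smul S := by
    apply Subtype.ext
    change S.1.image (1 : Equiv.Perm (Fin n)) = S.1
    simp
  mul_smul w h S := by
    apply Subtype.ext
    change S.1.image (w.right * h.right) = (S.1.image h.right).image w.right
    rw [Finset.image_image]; rfl

lemma burnside [Fintype G] (n a : ℕ) :
    ∑ w : Wn G n, (Finset.univ.filter
      (fun S : Finset (Fin n) => S.card ≤ a ∧ S.image w.right = S)).card
      ≤ (a + 1) * Fintype.card (Wn G n) := by
  letI := act (G := G) n a
  have hs : ∀ (w : Wn G n) (S : {S : Finset (Fin n) // S.card ≤ a}),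
    (w • S).1 = S.1.image w.right := fun _ _ => rfl
  have hB := MulAction.sum_card_fixedBy_eq_card_orbits_mul_card_group (Wn G n)
    {S : Finset (Fin n) // S.card ≤ a}
  have h1 : Fintype.card (Quotient (MulAction.orbitRel (Wn G n)
      {S : Finset (Fin n) // S.card ≤ a})) ≤ a + 1 := by
    have : Function.Injective (fun q : Quotient (MulAction.orbitRel (Wn G n)
      {S : Finset (Fin n) // S.card ≤ a}) => (⟨q.out.1.card, by have := q.out.2; omega⟩ : Fin (a+1))) := by
      intro q r hqr
      simp only [Fin.mk.injEq] at hqr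
      rw [← q.out_eq, ← r.out_eq]
      apply Quotient.sound
      obtain ⟨σ, hσ⟩ := exists_perm _ _ hqr.symm
      refine ⟨SemidirectProduct.inr σ, ?_⟩
      apply Subtype.ext
      change (_ • _ : {S : Finset (Fin n) // S.card ≤ a}).1 = _
      rw [hs]; exact hσ
    simpa using Fintype.card_le_of_injective _ this
  calc _ = ∑ w : Wn G n, Fintype.card (MulAction.fixedBy {S : Finset (Fin n) // S.card ≤ a} w) := by
        refine Finset.sum_congr rfl fun w _ => ?_
        rw [← Fintype.card_coe]
        refine Fintype.card_congr
          { toFun := fun S => ⟨⟨S.1, (Finset.mem_filter.1 S.2).2.1⟩, ?_⟩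
            invFun := fun S => ⟨S.1.1, ?_⟩
            left_inv := fun _ => rfl
            right_inv := fun _ => rfl }
        · rw [MulAction.mem_fixedBy]
          apply Subtype.ext
          rw [hs]; exact (Finset.mem_filter.1 S.2).2.2
        · refine Finset.mem_filter.2 ⟨Finset.mem_univ _, S.1.2, ?_⟩
          have := S.2
          rw [MulAction.mem_fixedBy] at this
          rw [← hs, this]
    _ = _ := hB
    _ ≤ _ := Nat.mul_le_mul_right _ h1

lemma Xcyc_one {n : ℕ} (w : Wn G n) :
    Xcyc 1 (ConjClasses.mk 1) w =
      ((Finset.univ.filter (fun j : Fin n => w.left j = 1 ∧ w.right j = j)).card : ℂ) := by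
  unfold Xcyc
  rw [Nat.cast_one, div_one]
  congr 2
  ext j
  simp only [Finset.mem_filter, Finset.mem_univ, true_and]
  have hp : Function.minimalPeriod (⇑w.right) j = 1 ↔ w.right j = j :=
    Function.minimalPeriod_eq_one_iff_isFixedPt
  rw [hp]
  constructor
  · rintro ⟨h1, h2⟩
    refine ⟨?_, h1⟩
    unfold cycleProd at h2
    rw [hp.2 h1] at h2
    simp only [List.range_one, List.map_cons, List.map_nil, pow_zero, Equiv.Perm.coe_one, id_eq,
      List.reverse_singleton, List.prod_singleton] at h2
    rw [ConjClasses.mk_eq_mk_iff_isConj] at h2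
    exact isConj_one_left.1 h2
  · rintro ⟨h1, h2⟩
    refine ⟨h2, ?_⟩
    unfold cycleProd
    rw [hp.2 h2]
    simp [h1]

lemma sum_pow [Fintype G] {n a : ℕ} {V : Type*} [AddCommGroup V] [Module ℂ V]
    [FiniteDimensional ℂ V] (ρ : Representation ℂ (Wn G n) V) :
    ∑ w : Wn G n, evalCharPoly
        ((MvPolynomial.X (⟨1, one_pos⟩, ConjClasses.mk 1) : FIGCharPoly G) ^ a) w *
        (starRingEnd ℂ) (LinearMap.trace ℂ V (ρ w)) =
      ((∑ f : Fin a → Fin n, (Fintype.card (Hsub (Finset.univ.image f) : Subgroup (Wn G n)) *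
        Module.finrank ℂ (Inv ρ (Finset.univ.image f))) : ℕ) : ℂ) := by
  have h1 : ∀ w : Wn G n, evalCharPoly
        ((MvPolynomial.X (⟨1, one_pos⟩, ConjClasses.mk 1) : FIGCharPoly G) ^ a) w =
        ∑ f : Fin a → Fin n, if w ∈ Hsub (Finset.univ.image f) then (1:ℂ) else 0 := by
    intro w
    unfold evalCharPoly
    rw [map_pow, MvPolynomial.eval_X]
    simp only
    rw [Xcyc_one, ← Nat.cast_pow, ← Fintype.card_piFinset_const, Finset.sum_boole]
    congr 2
    ext f
    simp [mem_Hsub]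
  simp_rw [h1, Finset.sum_mul]
  rw [Finset.sum_comm]
  push_cast
  refine Finset.sum_congr rfl fun f _ => ?_
  rw [← sum_trace]
  have h2 := congrArg (starRingEnd ℂ) (sum_trace ρ (Finset.univ.image f))
  rw [map_mul, map_natCast, map_natCast, map_sum, ← sum_trace] at h2
  rw [← h2]
  simp only [ite_mul, one_mul, zero_mul]
  rw [← Finset.sum_filter]
  exact Finset.sum_subtype _ (by simp) _

/-- enumeration of last points -/
def f0 {n a : ℕ} (h : a ≤ n) : Fin a → Fin n := fun i => ⟨n - a + i, by omega⟩

lemma image_f0 {n a : ℕ} (h : a ≤ n) : Finset.univ.image (f0 h) = S0 n a := by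
  ext k
  simp only [Finset.mem_image, Finset.mem_univ, true_and, mem_S0]
  constructor
  · rintro ⟨i, rfl⟩; simp [f0]
  · intro hk
    refine ⟨⟨k - (n - a), by have := k.2; omega⟩, ?_⟩
    ext; simp [f0]; omega

lemma card_W_le [Fintype G] {n a : ℕ} (h : a ≤ n) :
    Fintype.card (Wn G n) ≤ Fintype.card (Hsub (S0 n a) : Subgroup (Wn G n)) *
      ((Finset.univ.image (fun w : Wn G n => (w.right ∘ f0 h : Fin a → Fin n))).card *
        Fintype.card G ^ a) := by
  have h1 := Finset.card_le_mul_card_image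
    (f := fun w : Wn G n => ((w.right ∘ f0 h : Fin a → Fin n),
      (w.left ∘ w.right ∘ f0 h : Fin a → G))) Finset.univ
    (Fintype.card (Hsub (S0 n a) : Subgroup (Wn G n))) ?_
  · rw [Finset.card_univ] at h1
    refine h1.trans (Nat.mul_le_mul_left _ ?_)
    rw [show Fintype.card G ^ a = (Finset.univ : Finset (Fin a → G)).card by simp,
      ← Finset.card_product]
    apply Finset.card_le_card
    intro x hx
    obtain ⟨w, -, rfl⟩ := Finset.mem_image.1 hx
    simp
  · intro b hb
    obtain ⟨w0, -, rfl⟩ := Finset.mem_image.1 hb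
    rw [← Fintype.card_coe]
    refine Fintype.card_le_of_injective (fun w => ⟨w0⁻¹ * w.1, ?_⟩) ?_
    · have hw := (Finset.mem_filter.1 w.2).2
      simp only [Prod.mk.injEq] at hw
      intro k hk
      rw [← image_f0 h] at hk
      obtain ⟨i, -, rfl⟩ := Finset.mem_image.1 hk
      have e1 := congrFun hw.1 i
      have e2 := congrFun hw.2 i
      simp only [Function.comp_apply] at e1 e2
      constructor
      · rw [mul_left_apply, inv_left_apply, SemidirectProduct.inv_right, inv_inv, ← e2, e1]
        simp
      · rw [mul_right_apply, e1]
        simp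
    · intro x y hxy
      exact Subtype.ext (mul_left_cancel (congrArg Subtype.val hxy))

lemma dir1 [Fintype G] {n a : ℕ} (h : a ≤ n) {V : Type*} [AddCommGroup V] [Module ℂ V]
    [FiniteDimensional ℂ V] (ρ : Representation ℂ (Wn G n) V) :
    (Module.finrank ℂ (Inv ρ (S0 n a)) : ℝ) ≤ (Fintype.card G : ℝ) ^ a *
      ‖innerWn (evalCharPoly
        ((MvPolynomial.X (⟨1, one_pos⟩, ConjClasses.mk 1) : FIGCharPoly G) ^ a))
        (fun w : Wn G n => LinearMap.trace ℂ V (ρ w))‖ := by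
  unfold innerWn
  rw [sum_pow, norm_mul, norm_inv, Complex.norm_natCast, Complex.norm_natCast]
  set D := Module.finrank ℂ (Inv ρ (S0 n a))
  set N := ∑ f : Fin a → Fin n, (Fintype.card (Hsub (Finset.univ.image f) : Subgroup (Wn G n)) *
        Module.finrank ℂ (Inv ρ (Finset.univ.image f))) with hN
  set I := Finset.univ.image (fun w : Wn G n => (w.right ∘ f0 h : Fin a → Fin n)) with hI
  set cH := Fintype.card (Hsub (S0 n a) : Subgroup (Wn G n))
  have h1 : I.card * (cH * D) ≤ N := by
    rw [hN]
    calc I.card * (cH * D) = ∑ f ∈ I, cH * D := by simp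
      _ ≤ ∑ f ∈ I, (Fintype.card (Hsub (Finset.univ.image f) : Subgroup (Wn G n)) *
        Module.finrank ℂ (Inv ρ (Finset.univ.image f))) := by
          refine Finset.sum_le_sum fun f hf => ?_
          obtain ⟨w, -, rfl⟩ := Finset.mem_image.1 hf
          rw [← Finset.image_image, image_f0, finrank_Inv_image]
          exact Nat.mul_le_mul_right _ (card_Hsub_le w _)
      _ ≤ _ := Finset.sum_le_univ_sum_of_nonneg (fun _ => Nat.zero_le _)
  have h2 := card_W_le (G := G) h
  rw [← hI] at h2
  have hW : 0 < Fintype.card (Wn G n) := Fintype.card_pos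
  have h3 : D * Fintype.card (Wn G n) ≤ Fintype.card G ^ a * N := by
    calc D * Fintype.card (Wn G n) ≤ D * (cH * (I.card * Fintype.card G ^ a)) :=
          Nat.mul_le_mul_left _ h2
      _ = Fintype.card G ^ a * (I.card * (cH * D)) := by ring
      _ ≤ _ := Nat.mul_le_mul_left _ h1
  have h4 : (D : ℝ) * Fintype.card (Wn G n) ≤ (Fintype.card G : ℝ) ^ a * N := by exact_mod_cast h3
  have hW' : (0:ℝ) < Fintype.card (Wn G n) := by exact_mod_cast hW
  calc (D : ℝ) = (D * Fintype.card (Wn G n)) * (Fintype.card (Wn G n) : ℝ)⁻¹ := by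
        field_simp
    _ ≤ ((Fintype.card G : ℝ) ^ a * N) * (Fintype.card (Wn G n) : ℝ)⁻¹ := by gcongr
    _ = _ := by ring

/-- decomposable functions -/
def Good (P : FIGCharPoly G) : Prop :=
  ∃ (a : ℕ) (M : ℝ), 0 ≤ M ∧ ∀ n : ℕ, ∃ f : Finset (Fin n) → Wn G n → ℂ,
    (∀ w, evalCharPoly P w = ∑ S, f S w) ∧
    (∀ S w, f S w ≠ 0 → S.card ≤ a) ∧
    (∀ S w, f S w ≠ 0 → S.image w.right = S) ∧
    (∀ S w, ‖f S w‖ ≤ M) ∧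
    (∀ S w, ∀ h ∈ Hsub S, f S (w * h) = f S w)

lemma good_C (c : ℂ) : Good (G := G) (MvPolynomial.C c) := by
  refine ⟨0, ‖c‖, norm_nonneg _, fun n => ⟨fun S _ => if S = ∅ then c else 0, ?_, ?_, ?_, ?_, ?_⟩⟩
  · intro w; simp [evalCharPoly]
  · intro S w h
    by_cases hS : S = ∅
    · simp [hS]
    · simp [hS] at h
  · intro S w h
    by_cases hS : S = ∅
    · simp [hS]
    · simp [hS] at h
  · intro S w
    dsimp only
    split_ifs <;> simp
  · intro S w h _; rfl

lemma good_add {P Q : FIGCharPoly G} (hP : Good P) (hQ : Good Q) : Good (P + Q) := by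
  obtain ⟨a, M, hM, hP⟩ := hP
  obtain ⟨b, L, hL, hQ⟩ := hQ
  refine ⟨max a b, M + L, add_nonneg hM hL, fun n => ?_⟩
  obtain ⟨f, f1, f2, f3, f4, f5⟩ := hP n
  obtain ⟨g, g1, g2, g3, g4, g5⟩ := hQ n
  have key : ∀ S w, f S w + g S w ≠ 0 → f S w ≠ 0 ∨ g S w ≠ 0 := by
    intro S w h
    by_contra hc
    push Not at hc
    exact h (by rw [hc.1, hc.2, add_zero])
  refine ⟨fun S w => f S w + g S w, ?_, ?_, ?_, ?_, ?_⟩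
  · intro w
    rw [Finset.sum_add_distrib, ← f1, ← g1]
    simp [evalCharPoly]
  · intro S w h
    rcases key S w h with h | h
    · exact (f2 S w h).trans (le_max_left _ _)
    · exact (g2 S w h).trans (le_max_right _ _)
  · intro S w h
    rcases key S w h with h | h
    · exact f3 S w h
    · exact g3 S w h
  · intro S w
    exact (norm_add_le _ _).trans (add_le_add (f4 S w) (g4 S w))
  · intro S w h hh
    simp only [f5 S w h hh, g5 S w h hh]

lemma good_mul {P Q : FIGCharPoly G} (hP : Good P) (hQ : Good Q) : Good (P * Q) := by
  obtain ⟨a, M, hM, hP⟩ := hP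
  obtain ⟨b, L, hL, hQ⟩ := hQ
  refine ⟨a + b, (2 ^ (a + b) * 2 ^ (a + b)) * (M * L), by positivity, fun n => ?_⟩
  obtain ⟨f, f1, f2, f3, f4, f5⟩ := hP n
  obtain ⟨g, g1, g2, g3, g4, g5⟩ := hQ n
  have key : ∀ T w, (∑ p ∈ Finset.univ.filter
      (fun p : Finset (Fin n) × Finset (Fin n) => p.1 ∪ p.2 = T), f p.1 w * g p.2 w) ≠ 0 →
      ∃ S S', S ∪ S' = T ∧ f S w ≠ 0 ∧ g S' w ≠ 0 := by
    intro T w h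
    obtain ⟨p, hp, hne⟩ := Finset.exists_ne_zero_of_sum_ne_zero h
    exact ⟨p.1, p.2, (Finset.mem_filter.1 hp).2, left_ne_zero_of_mul hne,
      right_ne_zero_of_mul hne⟩
  have key2 : ∀ T w, (∑ p ∈ Finset.univ.filter
      (fun p : Finset (Fin n) × Finset (Fin n) => p.1 ∪ p.2 = T), f p.1 w * g p.2 w) ≠ 0 →
      T.card ≤ a + b := by
    intro T w h
    obtain ⟨S, S', rfl, h1, h2⟩ := key T w h
    exact (Finset.card_union_le _ _).trans (add_le_add (f2 S w h1) (g2 S' w h2))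
  refine ⟨fun T w => ∑ p ∈ Finset.univ.filter
      (fun p : Finset (Fin n) × Finset (Fin n) => p.1 ∪ p.2 = T), f p.1 w * g p.2 w,
      ?_, key2, ?_, ?_, ?_⟩
  · intro w
    rw [Finset.sum_fiberwise, ← Finset.univ_product_univ, Finset.sum_product]
    dsimp only
    rw [← Finset.sum_mul_sum, ← f1, ← g1]
    simp [evalCharPoly]
  · intro T w h
    obtain ⟨S, S', rfl, h1, h2⟩ := key T w h
    rw [Finset.image_union, f3 S w h1, g3 S' w h2]
  · intro T w
    by_cases h0 : (∑ p ∈ Finset.univ.filter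
      (fun p : Finset (Fin n) × Finset (Fin n) => p.1 ∪ p.2 = T), f p.1 w * g p.2 w) = 0
    · simp only [h0, norm_zero]; positivity
    have hT := key2 T w h0
    have hc : (Finset.univ.filter
      (fun p : Finset (Fin n) × Finset (Fin n) => p.1 ∪ p.2 = T)).card
        ≤ 2 ^ (a + b) * 2 ^ (a + b) := by
      calc _ ≤ (T.powerset ×ˢ T.powerset).card := by
            apply Finset.card_le_card
            intro p hp
            have := (Finset.mem_filter.1 hp).2
            rw [Finset.mem_product, Finset.mem_powerset, Finset.mem_powerset, ← this]
            exact ⟨Finset.subset_union_left, Finset.subset_union_right⟩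
        _ = 2 ^ T.card * 2 ^ T.card := by simp
        _ ≤ _ := Nat.mul_le_mul (Nat.pow_le_pow_right (by norm_num) hT)
            (Nat.pow_le_pow_right (by norm_num) hT)
    calc _ ≤ ∑ p ∈ Finset.univ.filter
          (fun p : Finset (Fin n) × Finset (Fin n) => p.1 ∪ p.2 = T), M * L := by
          refine norm_sum_le_of_le _ fun p _ => ?_
          rw [norm_mul]
          exact mul_le_mul (f4 _ _) (g4 _ _) (norm_nonneg _) hM
      _ = ((Finset.univ.filter
          (fun p : Finset (Fin n) × Finset (Fin n) => p.1 ∪ p.2 = T)).card : ℝ) * (M * L) := by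
          simp
      _ ≤ _ := by
          refine mul_le_mul_of_nonneg_right ?_ (mul_nonneg hM hL)
          exact_mod_cast hc
  · intro T w h hh
    refine Finset.sum_congr rfl fun p hp => ?_
    have := (Finset.mem_filter.1 hp).2
    rw [f5 p.1 w h (Hsub_anti (this ▸ Finset.subset_union_left) hh),
      g5 p.2 w h (Hsub_anti (this ▸ Finset.subset_union_right) hh)]

/-- cycle conditions -/
def E {n : ℕ} (i : ℕ) (C : ConjClasses G) (S : Finset (Fin n)) (w : Wn G n) (j : Fin n) : Prop :=
  (Function.minimalPeriod (⇑w.right) j = i ∧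
        ConjClasses.mk (cycleProd w.left w.right j) = C) ∧
    (Finset.range i).image (fun k => (w.right ^ k) j) = S

lemma E_pow {n i : ℕ} {C : ConjClasses G} {S : Finset (Fin n)} {w : Wn G n} {j : Fin n}
    (hi : 0 < i) (h : E i C S w j) (k : ℕ) : (w.right ^ k) j ∈ S := by
  rw [← h.2]
  refine Finset.mem_image.2 ⟨k % i, Finset.mem_range.2 (Nat.mod_lt _ hi), ?_⟩
  rw [← h.1.1]
  simp only [← Equiv.Perm.iterate_eq_pow]
  exact Function.iterate_mod_minimalPeriod_eq

lemma E_image {n i : ℕ} {C : ConjClasses G} {S : Finset (Fin n)} {w : Wn G n} {j : Fin n}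
    (hi : 0 < i) (h : E i C S w j) : S.image w.right = S := by
  refine Finset.eq_of_subset_of_card_le ?_ ?_
  · intro x hx
    obtain ⟨y, hy, rfl⟩ := Finset.mem_image.1 hx
    rw [← h.2] at hy
    obtain ⟨k, -, rfl⟩ := Finset.mem_image.1 hy
    have := E_pow hi h (k + 1)
    rwa [pow_succ'] at this
  · rw [Finset.card_image_of_injective _ (Equiv.injective _)]

lemma E_mul {n i : ℕ} {C : ConjClasses G} {S : Finset (Fin n)} {w : Wn G n} {j : Fin n}
    (hi : 0 < i) (h : E i C S w j) (u : Wn G n) (hu : u ∈ Hsub S) : E i C S (w * u) j := by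
  have hp : ∀ k : ℕ, ((w * u).right ^ k) j = (w.right ^ k) j := by
    intro k
    induction k with
    | zero => rfl
    | succ k ih =>
      rw [pow_succ', pow_succ', Equiv.Perm.mul_apply, Equiv.Perm.mul_apply, ih, mul_right_apply,
        (hu _ (E_pow hi h k)).2]
  have hm : Function.minimalPeriod (⇑(w * u).right) j = Function.minimalPeriod (⇑w.right) j := by
    rw [Function.minimalPeriod_eq_minimalPeriod_iff]
    intro k
    unfold Function.IsPeriodicPt Function.IsFixedPt
    rw [Equiv.Perm.iterate_eq_pow, Equiv.Perm.iterate_eq_pow, hp]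
  have hl : ∀ k : ℕ, (w * u).left ((w.right ^ k) j) = w.left ((w.right ^ k) j) := by
    intro k
    rw [mul_left_apply]
    have h1 := E_pow hi h k
    rw [← E_image hi h] at h1
    obtain ⟨y, hy, hyk⟩ := Finset.mem_image.1 h1
    have : w.right⁻¹ ((w.right ^ k) j) = y := by
      rw [Equiv.Perm.inv_eq_iff_eq]; exact hyk.symm
    rw [this, (hu y hy).1, mul_one]
  refine ⟨⟨hm.trans h.1.1, ?_⟩, ?_⟩
  · rw [← h.1.2]
    unfold cycleProd
    rw [hm]
    simp only [hp, hl]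
  · simp only [hp]; exact h.2

lemma good_X (v : {i : ℕ // 0 < i} × ConjClasses G) : Good (MvPolynomial.X v) := by
  obtain ⟨⟨i, hi⟩, C⟩ := v
  refine ⟨i, i, by positivity, fun n => ?_⟩
  have key : ∀ (S : Finset (Fin n)) (w : Wn G n),
      ((Finset.univ.filter (fun j => E i C S w j)).card : ℂ) / (i : ℂ) ≠ 0 →
      ∃ j, E i C S w j := by
    intro S w h
    by_contra hc
    push Not at hc
    apply h
    simp [hc]
  refine ⟨fun S w => ((Finset.univ.filter (fun j => E i C S w j)).card : ℂ) / (i : ℂ),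
    ?_, ?_, ?_, ?_, ?_⟩
  · intro w
    unfold evalCharPoly
    rw [MvPolynomial.eval_X]
    unfold Xcyc
    rw [← Finset.sum_div]
    congr 1
    rw [← Nat.cast_sum, Finset.card_eq_sum_card_fiberwise
      (f := fun j => (Finset.range i).image (fun k => (w.right ^ k) j)) (t := Finset.univ)
      (by intro x _; simp)]
    congr 1
    refine Finset.sum_congr rfl fun S _ => ?_
    rw [Finset.filter_filter]
    congr 1
    ext j
    simp only [Finset.mem_filter, Finset.mem_univ, true_and]
    rfl
  · intro S w h
    obtain ⟨j, hj⟩ := key S w h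
    rw [← hj.2]
    exact Finset.card_image_le.trans (by simp)
  · intro S w h
    obtain ⟨j, hj⟩ := key S w h
    exact E_image hi hj
  · intro S w
    by_cases h0 : ((Finset.univ.filter (fun j => E i C S w j)).card : ℂ) / (i : ℂ) = 0
    · simp only [h0, norm_zero]; positivity
    obtain ⟨j, hj⟩ := key S w h0
    have hS : S.card ≤ i := by
      rw [← hj.2]
      exact Finset.card_image_le.trans (by simp)
    have hc : (Finset.univ.filter (fun j => E i C S w j)).card ≤ i := by
      refine le_trans (Finset.card_le_card ?_) hS
      intro x hx
      simpa using E_pow hi (Finset.mem_filter.1 hx).2 0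
    rw [norm_div, Complex.norm_natCast, Complex.norm_natCast]
    have hi' : (1:ℝ) ≤ i := by exact_mod_cast hi
    calc _ ≤ ((Finset.univ.filter (fun j => E i C S w j)).card : ℝ) :=
          div_le_self (by positivity) hi'
      _ ≤ i := by exact_mod_cast hc
  · intro S w h hh
    dsimp only
    congr 3
    ext j
    simp only [Finset.mem_filter, Finset.mem_univ, true_and]
    constructor
    · intro hE
      have := E_mul hi hE h⁻¹ (inv_mem hh)
      simpa using this
    · intro hE
      exact E_mul hi hE h hh

lemma good_all (P : FIGCharPoly G) : Good P :=
  MvPolynomial.induction_on P good_C (fun _ _ => good_add) (fun _ v h => good_mul h (good_X v))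

lemma dir2 [Fintype G] (P : FIGCharPoly G) : ∃ (a : ℕ) (M : ℝ), 0 ≤ M ∧
    ∀ (n : ℕ) (V : Type) [AddCommGroup V] [Module ℂ V] [FiniteDimensional ℂ V]
      (ρ : Representation ℂ (Wn G n) V),
      ‖innerWn (evalCharPoly P) (fun w : Wn G n => LinearMap.trace ℂ V (ρ w))‖ ≤
        M * Module.finrank ℂ (Inv ρ (S0 n (min a n))) := by
  obtain ⟨a, M, hM, hP⟩ := good_all P
  refine ⟨a, M * (a + 1), by positivity, ?_⟩
  intro n V _ _ _ ρ
  obtain ⟨f, f1, f2, f3, f4, f5⟩ := hP n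
  set D : ℝ := (Module.finrank ℂ (Inv ρ (S0 n (min a n))) : ℝ) with hD
  have hW' : (0:ℝ) < Fintype.card (Wn G n) := by exact_mod_cast Fintype.card_pos
  have hterm : ∀ S w, ‖f S w * (starRingEnd ℂ) (LinearMap.trace ℂ V (ρ w * Av ρ S))‖ ≤
      if S.card ≤ a ∧ S.image w.right = S then M * D else 0 := by
    intro S w
    by_cases h0 : f S w = 0
    · rw [h0, zero_mul, norm_zero]; split_ifs
      · positivity
      · exact le_rfl
    · rw [if_pos ⟨f2 S w h0, f3 S w h0⟩, norm_mul, RCLike.norm_conj]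
      refine mul_le_mul (f4 S w) ?_ (norm_nonneg _) hM
      refine (norm_trace_Av ρ S w (f3 S w h0)).trans ?_
      rw [hD]
      exact_mod_cast finrank_le_S0 ρ (min_le_right a n) S
        (le_min (f2 S w h0) (by simpa using Finset.card_le_univ S))
  have hsum : ‖∑ w : Wn G n, evalCharPoly P w * (starRingEnd ℂ) (LinearMap.trace ℂ V (ρ w))‖ ≤
      M * (a + 1) * D * Fintype.card (Wn G n) := by
    have e1 : ∑ w : Wn G n, evalCharPoly P w * (starRingEnd ℂ) (LinearMap.trace ℂ V (ρ w)) =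
        ∑ S, ∑ w, f S w * (starRingEnd ℂ) (LinearMap.trace ℂ V (ρ w * Av ρ S)) := by
      simp_rw [f1, Finset.sum_mul]
      rw [Finset.sum_comm]
      exact Finset.sum_congr rfl fun S _ => sum_avg ρ S (f S) (f5 S)
    rw [e1]
    calc _ ≤ ∑ S : Finset (Fin n), ∑ w : Wn G n,
          if S.card ≤ a ∧ S.image w.right = S then M * D else 0 :=
          norm_sum_le_of_le _ fun S _ => norm_sum_le_of_le _ fun w _ => hterm S w
      _ = (∑ w : Wn G n, ((Finset.univ.filter
        (fun S : Finset (Fin n) => S.card ≤ a ∧ S.image w.right = S)).card : ℝ)) * (M * D) := by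
          rw [Finset.sum_comm, Finset.sum_mul]
          refine Finset.sum_congr rfl fun w _ => ?_
          rw [← Finset.sum_filter, Finset.sum_const, nsmul_eq_mul]
      _ ≤ ((a + 1) * Fintype.card (Wn G n)) * (M * D) := by
          refine mul_le_mul_of_nonneg_right ?_ (by positivity)
          exact_mod_cast burnside (G := G) n a
      _ = _ := by ring
  unfold innerWn
  rw [norm_mul, norm_inv, Complex.norm_natCast, inv_mul_le_iff₀ hW']
  linarith

lemma subexp_const_mul {F : ℕ → ℝ} (h : Subexponential F) (c : ℝ) :
    Subexponential (fun i => c * F i) := by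
  intro b hb
  have := (h b hb).const_mul c
  simpa [mul_div_assoc] using this

lemma subexp_sum {F : ℕ → ℕ → ℝ} (h : ∀ b, Subexponential (F b)) (s : Finset ℕ) :
    Subexponential (fun i => ∑ b ∈ s, F b i) := by
  intro c hc
  have := tendsto_finsetSum s (fun b _ => h b c hc)
  simpa [Finset.sum_div] using this

end FIGAux

/-- Let `G` be a finite group and for each `n, i` let `V^i_n` be a
finite-dimensional complex representation of `W_n = (Fin n → G) ⋊ Equiv.Perm (Fin n)`.
The following are equivalent: (1) for every `FI_G` character polynomial `P` there is a
subexponential `F` with `|⟨P_n, χ_{V^i_n}⟩_{W_n}| ≤ F(i)` for all `n` and `i`;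
(2) for every `a` there is a subexponential `F` with
`dim (V^i_n)^{W_{n−a}} ≤ F(i)` for all `n ≥ a` and `i`, where `W_{n−a} ⊆ W_n` is the
subgroup of `(g⃗, σ)` with `g⃗ k = 1` and `σ k = k` for all `k ≥ n − a`. -/
theorem stmt_9 (G : Type*) [Group G] [Fintype G]
    (V : ℕ → ℕ → Type) [∀ n i, AddCommGroup (V n i)] [∀ n i, Module ℂ (V n i)]
    [∀ n i, FiniteDimensional ℂ (V n i)]
    (ρ : ∀ n i, Representation ℂ (Wn G n) (V n i)) :
    (∀ P : FIGCharPoly G, ∃ F : ℕ → ℝ, Subexponential F ∧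
      ∀ n i, norm
          (innerWn (evalCharPoly P)
            (fun w : Wn G n => LinearMap.trace ℂ (V n i) (ρ n i w))) ≤ F i) ↔
    (∀ a : ℕ, ∃ F : ℕ → ℝ, Subexponential F ∧
      ∀ n i, a ≤ n →
        (Module.finrank ℂ
          ↥(⨅ (w : Wn G n)
              (_ : ∀ k : Fin n, n - a ≤ (k : ℕ) → w.left k = 1 ∧ w.right k = k),
              LinearMap.ker (ρ n i w - LinearMap.id)) : ℝ) ≤ F i) := by
  constructor
  · intro h a
    obtain ⟨F, hF, hb⟩ := h ((MvPolynomial.X (⟨1, one_pos⟩, ConjClasses.mk 1) : FIGCharPoly G) ^ a)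
    refine ⟨fun i => (Fintype.card G : ℝ) ^ a * F i, FIGAux.subexp_const_mul hF _, ?_⟩
    intro n i han
    rw [FIGAux.frozen_eq]
    refine (FIGAux.dir1 han (ρ n i)).trans ?_
    exact mul_le_mul_of_nonneg_left (hb n i) (by positivity)
  · intro h P
    choose F hF hb using h
    obtain ⟨a, M, hM, hP⟩ := FIGAux.dir2 P
    refine ⟨fun i => M * ∑ b ∈ Finset.range (a + 1), F b i,
      FIGAux.subexp_const_mul (FIGAux.subexp_sum hF _) _, ?_⟩
    intro n i
    refine (hP n (V n i) (ρ n i)).trans ?_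
    refine mul_le_mul_of_nonneg_left ?_ hM
    have h1 := hb (min a n) n i (min_le_right a n)
    rw [FIGAux.frozen_eq] at h1
    refine h1.trans ?_
    refine Finset.single_le_sum (f := fun b => F b i) (fun b _ => ?_)
      (Finset.mem_range.2 (Nat.lt_succ_of_le (min_le_left a n)))
    exact le_trans (Nat.cast_nonneg _) (hb b b i le_rfl)
end

section
/- Let G be a finite group with at least two elements, and for each n let δ_n : W_n → ℂ be the indicator function of the set of elements (g⃗, σ) ∈ W_n all of whose cycle products are trivial, i.e. for every cycle of σ (including fixed points) the cycle product lies in the conjugacy class of the identity element of G. Then there is no FI_G character polynomial P such that P_n = δ_n as functions on W_n for all sufficiently large n. -/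
open scoped Classical

section WreathProduct

variable (G : Type*) [Group G]

variable {G}

/-- The indicator function `δ_n` of the set of elements of `W_n` all of whose cycle
products are trivial. -/
noncomputable def deltaWn {n : ℕ} (w : Wn G n) : ℂ :=
  if ∀ j : Fin n, ConjClasses.mk (cycleProd w.left w.right j) =
      ConjClasses.mk (1 : G) then 1 else 0

end WreathProduct

lemma aux_dvd (m : ℕ) (j : Fin (m+1)) :
    (m+1) ∣ Function.minimalPeriod (⇑(Equiv.addRight (1 : Fin (m+1)))) j := by
  have h := Function.iterate_minimalPeriod (f := ⇑(Equiv.addRight (1 : Fin (m+1)))) (x := j)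
  generalize Function.minimalPeriod (⇑(Equiv.addRight (1 : Fin (m+1)))) j = p at h
  rw [Equiv.coe_addRight, add_right_iterate] at h
  have h2 : p • (1 : Fin (m+1)) = 0 := by simpa using h
  have h3 : ((p : ℕ) : ZMod (m+1)) = 0 := by
    rw [← nsmul_one]
    exact h2
  exact (ZMod.natCast_eq_zero_iff p (m+1)).1 h3

lemma aux_X {G : Type*} [Group G] (m : ℕ) (g : Fin (m+1) → G) (i : ℕ) (hi : 0 < i)
    (him : i < m + 1) (C : ConjClasses G) :
    Xcyc i C (⟨g, Equiv.addRight (1 : Fin (m+1))⟩ : Wn G (m+1)) = 0 := by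
  unfold Xcyc
  rw [Finset.filter_eq_empty_iff.2]
  · simp
  · rintro j - ⟨h, -⟩
    have := aux_dvd m j
    simp only at h
    rw [h] at this
    exact absurd (Nat.le_of_dvd hi this) (by omega)

lemma aux_prod {G : Type*} [Group G] {n : ℕ} (σ : Equiv.Perm (Fin n)) (j : Fin n) (a : G) :
    cycleProd (Pi.mulSingle j a) σ j = a := by
  unfold cycleProd
  have hpos : 0 < Function.minimalPeriod (⇑σ) j :=
    Function.minimalPeriod_pos_of_mem_periodicPts
      (Function.Injective.mem_periodicPts σ.injective j)
  obtain ⟨p, hp⟩ := Nat.exists_eq_succ_of_ne_zero hpos.ne'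
  rw [hp, List.range_succ_eq_map, List.map_cons, List.reverse_cons, List.prod_append]
  rw [List.prod_eq_one]
  · simp only [List.prod_singleton, one_mul]
    exact Pi.mulSingle_eq_same (M := fun _ => G) j a
  · intro x hx
    simp only [List.mem_reverse, List.mem_map, List.mem_range, List.map_map] at hx
    obtain ⟨k, hk, rfl⟩ := hx
    apply Pi.mulSingle_eq_of_ne
    intro h
    have h' : Function.IsPeriodicPt (⇑σ) (k+1) j := by
      rw [← Equiv.Perm.iterate_eq_pow] at h
      exact h
    have := h'.minimalPeriod_le (Nat.succ_pos k)
    omega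

/-- If `G` is a finite group with at least two elements, then there is
no `FI_G` character polynomial `P` whose associated class function `P_n` on `W_n` equals
the indicator function `δ_n` of "all cycle products trivial" for all sufficiently
large `n`. -/
theorem stmt_10 (G : Type*) [Group G] [Fintype G] [Nontrivial G] :
    ¬ ∃ (P : FIGCharPoly G) (N : ℕ), ∀ n, N ≤ n →
        ∀ w : Wn G n, evalCharPoly P w = deltaWn w := by
  rintro ⟨P, N, h⟩
  obtain ⟨a, ha⟩ := exists_ne (1 : G)
  let m := N + P.vars.sup (fun v => v.1.1)
  have hE : ∀ g : Fin (m+1) → G,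
      evalCharPoly P (⟨g, Equiv.addRight (1 : Fin (m+1))⟩ : Wn G (m+1)) =
        MvPolynomial.eval (fun _ => 0) P := by
    intro g
    unfold evalCharPoly
    apply MvPolynomial.eval₂Hom_congr' rfl _ rfl
    intro v hv _
    apply aux_X m g _ v.1.2
    have := Finset.le_sup (f := fun v : {i : ℕ // 0 < i} × ConjClasses G => v.1.1) hv
    omega
  have h1 := h (m+1) (by omega) ⟨1, Equiv.addRight (1 : Fin (m+1))⟩
  have h2 := h (m+1) (by omega) ⟨Pi.mulSingle 0 a, Equiv.addRight (1 : Fin (m+1))⟩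
  rw [hE] at h1 h2
  rw [h1] at h2
  unfold deltaWn at h2
  rw [if_pos, if_neg] at h2
  · exact one_ne_zero h2
  · intro h3
    have := h3 0
    rw [show cycleProd _ _ _ = a from aux_prod _ 0 a] at this
    rw [ConjClasses.mk_eq_mk_iff_isConj, isConj_one_left] at this
    exact ha this
  · intro j
    simp [cycleProd]
end

section
/- Let H and K be finite groups, let k be a field of characteristic zero, and let V be a k-vector space with a linear action of the product group H × K. Let B ⊆ V be a finite-dimensional subspace such that V is spanned by the translates (h, k') • b with h ∈ H, k' ∈ K, and b ∈ B. Then the subspace V^H of vectors fixed by the subgroup H × {1} satisfies dim_k V^H ≤ |K| · dim_k B. -/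
/-- Let `H` and `K` be finite groups, `k` a field of characteristic
zero, and `V` a `k`-vector space with a linear action `ρ` of `H × K`. If `B ⊆ V` is
a finite-dimensional subspace whose translates `(h, k') • b` span `V`, then the
subspace of `H × {1}`-fixed vectors has dimension at most `|K| · dim B`. -/
theorem stmt_13 (H K k V : Type*) [Group H] [Group K] [Fintype H] [Fintype K]
    [Field k] [CharZero k] [AddCommGroup V] [Module k V]
    (ρ : Representation k (H × K) V)
    (B : Submodule k V) (hB : FiniteDimensional k B)
    (hspan : Submodule.span k
      {v : V | ∃ (h : H) (k' : K) (b : V), b ∈ B ∧ v = ρ (h, k') b} = ⊤) :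
    Module.finrank k
        ↥(⨅ h : H, LinearMap.ker (ρ (h, 1) - LinearMap.id)) ≤
      Fintype.card K * Module.finrank k B := by
  classical
  let S : V →ₗ[k] V := ∑ h : H, ρ (h, 1)
  let T : (K → B) →ₗ[k] V :=
    ∑ c : K, (S ∘ₗ ρ (1, c) ∘ₗ B.subtype) ∘ₗ LinearMap.proj c
  have hS : ∀ v, S v = ∑ h : H, ρ (h, 1) v := fun v => by
    simp [S, LinearMap.sum_apply]
  have hT : ∀ f, T f = ∑ c : K, S (ρ (1, c) (f c : V)) := fun f => by
    simp [T, LinearMap.sum_apply]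
  have hr : ∀ v, S v ∈ LinearMap.range T := by
    intro v
    have hv : v ∈ Submodule.span k
      {v : V | ∃ (h : H) (k' : K) (b : V), b ∈ B ∧ v = ρ (h, k') b} := by
      rw [hspan]; trivial
    have hle : Submodule.span k
      {v : V | ∃ (h : H) (k' : K) (b : V), b ∈ B ∧ v = ρ (h, k') b} ≤
        (LinearMap.range T).comap S := by
      rw [Submodule.span_le]
      rintro _ ⟨h, c, b, hb, rfl⟩
      refine ⟨Pi.single c ⟨b, hb⟩, ?_⟩
      rw [hT, Finset.sum_eq_single c]
      · rw [Pi.single_eq_same, hS, hS]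
        refine (Fintype.sum_equiv (Equiv.mulRight h) _ _ ?_).symm
        intro x
        rw [← Module.End.mul_apply, ← Module.End.mul_apply, ← map_mul, ← map_mul]
        simp
      · intro d _ hd
        simp [Pi.single_eq_of_ne hd]
      · simp
    exact hle hv
  have hle : (⨅ h : H, LinearMap.ker (ρ (h, 1) - LinearMap.id)) ≤ LinearMap.range T := by
    intro v hv
    have hv' : ∀ h : H, ρ (h, 1) v = v := by
      intro h
      have := (Submodule.mem_iInf _).1 hv h
      simpa [sub_eq_zero] using this
    have h1 : S v = (Fintype.card H : k) • v := by
      rw [hS]; simp [hv', Nat.cast_smul_eq_nsmul]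
    have hne : (Fintype.card H : k) ≠ 0 := by
      exact_mod_cast Fintype.card_ne_zero
    have h2 := (LinearMap.range T).smul_mem (Fintype.card H : k)⁻¹ (hr v)
    rwa [h1, inv_smul_smul₀ hne] at h2
  calc _ ≤ Module.finrank k (LinearMap.range T) := Submodule.finrank_mono hle
    _ ≤ Module.finrank k (K → B) := LinearMap.finrank_range_le T
    _ = _ := by rw [Module.finrank_pi_fintype]; simp
end
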